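/- Let R be a Noetherian ring, 𝔞 an ideal of R, and M a nonzero finitely generated R-module of finite dimension c such that cd(𝔞, M) = c. If Ann_R(M) = ⋂_{i=1}^m 𝔮_i is a reduced primary decomposition with 𝔮_i being 𝔭_i-primary, then Ann_R(H^c_𝔞(M)) = ⋂ {𝔮_i : cd(𝔞, R/𝔭_i) = c}. -/

import Mathlib

open CategoryTheory

/-- `HasCD a M c` : the cohomological dimension of `M` with respect to `a` is `c`,
i.e. `H^c_a(M) ≠ 0` and `H^i_a(M) = 0` for all `i > c`. -/
def HasCD {R : Type} [CommRing R] (a : Ideal R) (M : ModuleCat R) (c : ℕ) : Prop :=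
  Nontrivial ((localCohomology a c).obj M) ∧
    ∀ i, c < i → Subsingleton ((localCohomology a i).obj M)

/-- The attached primes of an `R`-module `A`: primes of the form `Ann_R(A/B)`. -/
def attachedPrimes (R : Type) [CommRing R] (A : Type) [AddCommGroup A] [Module R A] :
    Set (Ideal R) :=
  {p | p.IsPrime ∧ ∃ B : Submodule R A, p = Module.annihilator R (A ⧸ B)}

set_option linter.unusedSectionVars false
set_option linter.style.haveILetI false
open CategoryTheory
namespace LCaux
open Opposite Limits

section OldExt
variable {R : Type} [CommRing R]

/-- map of Hom complexes -/
noncomputable def yonMap {P P' : ChainComplex (ModuleCat.{0} R) ℕ} (φ : P' ⟶ P) (Y : ModuleCat.{0} R) :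
    P.linearYonedaObj R Y ⟶ P'.linearYonedaObj R Y :=
  (HomologicalComplex.unopFunctor _ _).map
    ((((linearYoneda R (ModuleCat.{0} R)).obj Y).rightOp.mapHomologicalComplex _).map φ).op

lemma yonMap_f {P P' : ChainComplex (ModuleCat.{0} R) ℕ} (φ : P' ⟶ P) (Y : ModuleCat.{0} R) (n : ℕ) :
    (yonMap φ Y).f n = ((linearYoneda R (ModuleCat.{0} R)).obj Y).map (φ.f n).op := rfl

lemma homologyUnop_nat {V : Type*} [Category V] [Abelian V]
    {K L : ChainComplex Vᵒᵖ ℕ} (f : K ⟶ L) (n : ℕ) :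
    HomologicalComplex.homologyMap ((HomologicalComplex.unopFunctor _ _).map f.op) n ≫
      (HomologicalComplex.homologyUnop K n).hom =
    (HomologicalComplex.homologyUnop L n).hom ≫ (HomologicalComplex.homologyMap f n).unop := by
  apply Quiver.Hom.op_inj
  have := HomologicalComplex.homologyOp_hom_naturality
    ((HomologicalComplex.unopFunctor _ _).map f.op) n
  exact this.symm

lemma sq_inv {V : Type*} [Category V] {A B C D : V} (f : A ⟶ B) (e : B ≅ C) (e' : A ≅ D) (g : D ⟶ C)
    (h : f ≫ e.hom = e'.hom ≫ g) : g ≫ e.inv = e'.inv ≫ f := by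
  rw [Iso.comp_inv_eq, Category.assoc, h, Iso.inv_hom_id_assoc]

lemma isoExt_nat {X X' : ModuleCat.{0} R} (g : X' ⟶ X) (P : ProjectiveResolution X)
    (P' : ProjectiveResolution X') (φ : ProjectiveResolution.Hom P' P g) (Y : ModuleCat.{0} R) (n : ℕ) :
    ((Ext R (ModuleCat.{0} R) n).map g.op).app Y ≫ (P'.isoExt n Y).hom =
      (P.isoExt n Y).hom ≫ HomologicalComplex.homologyMap (yonMap φ.hom Y) n := by
  have h1 := ProjectiveResolution.isoLeftDerivedObj_inv_naturality g P' P φ.hom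
    (by simpa using φ.hom_f_zero_comp_π_f_zero) ((linearYoneda R (ModuleCat.{0} R)).obj Y).rightOp n
  have h2 := homologyUnop_nat
    ((((linearYoneda R (ModuleCat.{0} R)).obj Y).rightOp.mapHomologicalComplex _).map φ.hom) n
  have h1' := congrArg Quiver.Hom.unop h1
  have h2' := sq_inv _ _ _ _ h2
  refine (Category.assoc _ _ _).symm.trans ((congrArg (fun z => z ≫ _) h1').trans ?_)
  refine Eq.trans (Category.assoc _ _ _) ?_
  refine Eq.trans ?_ (Category.assoc _ _ _).symm
  refine congrArg (fun z => _ ≫ z) ?_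
  exact h2'


noncomputable def Zc {X : ModuleCat.{0} R} (P : ProjectiveResolution X) (Y : ModuleCat.{0} R) (n : ℕ) :
    Submodule R (P.complex.X n ⟶ Y) :=
  LinearMap.ker ((P.complex.linearYonedaObj R Y).d n (n+1)).hom

lemma mem_Zc {X : ModuleCat.{0} R} (P : ProjectiveResolution X) (Y : ModuleCat.{0} R) (n : ℕ)
    (f : P.complex.X n ⟶ Y) : f ∈ Zc P Y n ↔ P.complex.d (n+1) n ≫ f = 0 := Iff.rfl

noncomputable def zLift {X : ModuleCat.{0} R} (P : ProjectiveResolution X) (Y : ModuleCat.{0} R) (n : ℕ) :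
    ModuleCat.of R (Zc P Y n) ⟶ (P.complex.linearYonedaObj R Y).cycles n :=
  (P.complex.linearYonedaObj R Y).liftCycles (ModuleCat.ofHom (Zc P Y n).subtype) (n+1) (by simp)
    (by ext x; exact x.2)

lemma zLift_i {X : ModuleCat.{0} R} (P : ProjectiveResolution X) (Y : ModuleCat.{0} R) (n : ℕ)
    (x : Zc P Y n) :
    (P.complex.linearYonedaObj R Y).iCycles n (zLift P Y n x) = x.1 := by
  have := (P.complex.linearYonedaObj R Y).liftCycles_i (ModuleCat.ofHom (Zc P Y n).subtype) (n+1) (by simp)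
    (by ext x; exact x.2)
  exact congrArg (fun z => z.hom x) this

lemma iCyc_inj {X : ModuleCat.{0} R} (P : ProjectiveResolution X) (Y : ModuleCat.{0} R) (n : ℕ) :
    Function.Injective ((P.complex.linearYonedaObj R Y).iCycles n) :=
  (ModuleCat.mono_iff_injective _).1 inferInstance

noncomputable def toOld {X : ModuleCat.{0} R} (P : ProjectiveResolution X) (Y : ModuleCat.{0} R) (n : ℕ) :
    Zc P Y n →ₗ[R] ((Ext R (ModuleCat.{0} R) n).obj (op X)).obj Y :=
  (zLift P Y n ≫ (P.complex.linearYonedaObj R Y).homologyπ n ≫ (P.isoExt n Y).inv).hom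

lemma toOld_surj {X : ModuleCat.{0} R} (P : ProjectiveResolution X) (Y : ModuleCat.{0} R) (n : ℕ) :
    Function.Surjective (toOld P Y n) := by
  have h1 : Function.Surjective ((P.complex.linearYonedaObj R Y).homologyπ n ≫ (P.isoExt n Y).inv) :=
    (ModuleCat.epi_iff_surjective _).1 inferInstance
  have h2 : Function.Surjective (zLift P Y n) := by
    intro y
    refine ⟨⟨(P.complex.linearYonedaObj R Y).iCycles n y, ?_⟩, ?_⟩
    · have := (P.complex.linearYonedaObj R Y).iCycles_d n (n+1)
      exact congrArg (fun z => z.hom y) this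
    · apply iCyc_inj
      rw [zLift_i]
  exact h1.comp h2

lemma toOld_eq_zero {X : ModuleCat.{0} R} (P : ProjectiveResolution X) (Y : ModuleCat.{0} R) (n : ℕ)
    (f : Zc P Y n) :
    toOld P Y n f = 0 ↔ ∃ g : P.complex.X ((ComplexShape.up ℕ).prev n) ⟶ Y,
      P.complex.d n _ ≫ g = f.1 := by
  have h1 : toOld P Y n f = 0 ↔ (P.complex.linearYonedaObj R Y).homologyπ n (zLift P Y n f) = 0 := by
    have : Function.Injective (P.isoExt (R := R) n Y).inv := (ModuleCat.mono_iff_injective _).1 inferInstance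
    exact map_eq_zero_iff (P.isoExt (R := R) n Y).inv.hom this
  rw [h1]
  have ex := ShortComplex.exact_of_g_is_cokernel
    (ShortComplex.mk _ _ ((P.complex.linearYonedaObj R Y).toCycles_comp_homologyπ
      ((ComplexShape.up ℕ).prev n) n)) ((P.complex.linearYonedaObj R Y).homologyIsCokernel _ n rfl)
  rw [ShortComplex.moduleCat_exact_iff] at ex
  constructor
  · intro h
    obtain ⟨g, hg⟩ := ex _ h
    refine ⟨g, ?_⟩
    rw [← zLift_i, ← hg]
    exact (congrArg (fun z => z.hom g) ((P.complex.linearYonedaObj R Y).toCycles_i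
      ((ComplexShape.up ℕ).prev n) n)).symm
  · rintro ⟨g, hg⟩
    have : zLift P Y n f = (P.complex.linearYonedaObj R Y).toCycles _ n g := by
      apply iCyc_inj
      rw [zLift_i, ← hg]
      exact (congrArg (fun z => z.hom g) ((P.complex.linearYonedaObj R Y).toCycles_i
        ((ComplexShape.up ℕ).prev n) n)).symm
    rw [this]
    exact (congrArg (fun z => z.hom g) ((P.complex.linearYonedaObj R Y).toCycles_comp_homologyπ
      ((ComplexShape.up ℕ).prev n) n))

lemma toOld_nat {X X' : ModuleCat.{0} R} (g : X' ⟶ X) (P : ProjectiveResolution X)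
    (P' : ProjectiveResolution X') (φ : ProjectiveResolution.Hom P' P g) (Y : ModuleCat.{0} R) (n : ℕ)
    (f : Zc P Y n) (h : φ.hom.f n ≫ f.1 ∈ Zc P' Y n) :
    ((Ext R (ModuleCat.{0} R) n).map g.op).app Y (toOld P Y n f) =
      toOld P' Y n ⟨φ.hom.f n ≫ f.1, h⟩ := by
  have h1 := sq_inv _ _ _ _ (isoExt_nat g P P' φ Y n)
  have h2 := HomologicalComplex.homologyπ_naturality (yonMap φ.hom Y) n
  have h3 : HomologicalComplex.cyclesMap (yonMap φ.hom Y) n (zLift P Y n f) =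
      zLift P' Y n ⟨φ.hom.f n ≫ f.1, h⟩ := by
    apply iCyc_inj
    rw [zLift_i]
    have h4 := HomologicalComplex.cyclesMap_i (yonMap φ.hom Y) n
    refine (congrArg (fun z => z.hom (zLift P Y n f)) h4).trans ?_
    change (yonMap φ.hom Y).f n ((P.complex.linearYonedaObj R Y).iCycles n (zLift P Y n f)) = _
    rw [zLift_i]; rfl
  change _ = (P'.isoExt n Y).inv ((P'.complex.linearYonedaObj R Y).homologyπ n (zLift P' Y n _))
  rw [← h3]
  have h5 := congrArg (fun z => z.hom (zLift P Y n f)) h2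
  have h6 := congrArg (fun z => z.hom ((P.complex.linearYonedaObj R Y).homologyπ n (zLift P Y n f))) h1
  refine Eq.trans h6.symm ?_
  exact congrArg (P'.isoExt n Y).inv h5

noncomputable def toNew {X : ModuleCat.{0} R} (P : ProjectiveResolution X) (Y : ModuleCat.{0} R) (n : ℕ) :
    Zc P Y n →ₗ[R] Abelian.Ext.{0} X Y n where
  toFun f := P.extMk f.1 (n+1) rfl ((mem_Zc P Y n f.1).1 f.2)
  map_add' f g := (P.add_extMk f.1 g.1 _ rfl ((mem_Zc P Y n f.1).1 f.2) ((mem_Zc P Y n g.1).1 g.2)).symm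
  map_smul' r f := by
    rw [RingHom.id_apply, Abelian.Ext.smul_eq_comp_mk₀, P.extMk_comp_mk₀]
    congr 1

lemma toNew_surj {X : ModuleCat.{0} R} (P : ProjectiveResolution X) (Y : ModuleCat.{0} R) (n : ℕ) :
    Function.Surjective (toNew P Y n) := by
  intro y
  obtain ⟨f, hf, h⟩ := P.extMk_surjective y (n+1) rfl
  exact ⟨⟨f, hf⟩, h⟩

open CochainComplex HomComplex in
lemma toNew_eq_zero {X : ModuleCat.{0} R} (P : ProjectiveResolution X) (Y : ModuleCat.{0} R) (n : ℕ)
    (f : Zc P Y n) :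
    toNew P Y n f = 0 ↔ ∃ g : P.complex.X ((ComplexShape.up ℕ).prev n) ⟶ Y,
      P.complex.d n _ ≫ g = f.1 := by
  obtain ⟨f, hf'⟩ := f
  have hf := (mem_Zc P Y n f).1 hf'
  rcases n with _ | n
  · have : ∀ g : P.complex.X ((ComplexShape.up ℕ).prev 0) ⟶ Y,  P.complex.d 0 _ ≫ g = 0 := by
      intro g; rw [P.complex.shape, zero_comp]; simp
    simp only [this, exists_const]
    change P.extMk f 1 rfl hf = 0 ↔ _
    rw [← P.extEquivCohomologyClass.apply_eq_iff_eq, P.extEquivCohomologyClass_extMk,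
      P.extEquivCohomologyClass_zero, CohomologyClass.mk_eq_zero_iff]
    rw [Cocycle.toSingleMk_mem_coboundaries_iff _ _ _ _ _ 1 (by lia)]
    have hz : IsZero (P.cochainComplex.X 1) :=
      CochainComplex.isZero_of_isStrictlyLE _ 0 1 (by lia)
    constructor
    · rintro ⟨g, hg⟩
      rw [hz.eq_of_src g 0, comp_zero] at hg
      rw [← cancel_epi (P.cochainComplexXIso (-(0:ℕ)) 0 rfl).hom, comp_zero, hg]
    · rintro rfl
      exact ⟨0, by simp⟩
  · have : (ComplexShape.up ℕ).prev (n+1) = n := by simp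
    change P.extMk f _ rfl hf = 0 ↔ _
    rw [P.extMk_eq_zero_iff f _ rfl hf n rfl, this]

lemma ker_old_new {X : ModuleCat.{0} R} (P : ProjectiveResolution X) (Y : ModuleCat.{0} R) (n : ℕ) :
    LinearMap.ker (toOld P Y n) = LinearMap.ker (toNew P Y n) := by
  ext f
  rw [LinearMap.mem_ker, LinearMap.mem_ker, toOld_eq_zero, toNew_eq_zero]

noncomputable def oldNew (X Y : ModuleCat.{0} R) (n : ℕ) :
    ((Ext R (ModuleCat.{0} R) n).obj (op X)).obj Y ≃ₗ[R] Abelian.Ext.{0} X Y n :=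
  ((toOld (projectiveResolution X) Y n).quotKerEquivOfSurjective (toOld_surj _ _ _)).symm.trans
    ((Submodule.quotEquivOfEq _ _ (ker_old_new _ _ _)).trans
      ((toNew (projectiveResolution X) Y n).quotKerEquivOfSurjective (toNew_surj _ _ _)))

lemma oldNew_toOld (X Y : ModuleCat.{0} R) (n : ℕ) (f : Zc (projectiveResolution X) Y n) :
    oldNew X Y n (toOld _ Y n f) = toNew _ Y n f := by
  have : ((toOld (projectiveResolution X) Y n).quotKerEquivOfSurjective (toOld_surj _ _ _)).symm
      (toOld _ Y n f) = Submodule.Quotient.mk f := by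
    rw [LinearEquiv.symm_apply_eq]; rfl
  unfold oldNew
  rw [LinearEquiv.trans_apply, this]; rfl

lemma oldNew_nat {X X' : ModuleCat.{0} R} (g : X' ⟶ X) (Y : ModuleCat.{0} R) (n : ℕ)
    (x : ((Ext R (ModuleCat.{0} R) n).obj (op X)).obj Y) :
    oldNew X' Y n (((Ext R (ModuleCat.{0} R) n).map g.op).app Y x) =
      (Abelian.Ext.mk₀ g).comp (oldNew X Y n x) (zero_add n) := by
  obtain ⟨f, rfl⟩ := toOld_surj (projectiveResolution X) Y n x
  let φ : ProjectiveResolution.Hom (projectiveResolution X') (projectiveResolution X) g :=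
    ⟨ProjectiveResolution.lift g _ _, by simpa using ProjectiveResolution.lift_commutes_zero g _ _⟩
  have hf := (mem_Zc _ Y n f.1).1 f.2
  rw [toOld_nat g _ _ φ Y n f (by rw [mem_Zc, ← φ.hom.comm_assoc, hf, comp_zero]),
    oldNew_toOld, oldNew_toOld]
  exact (ProjectiveResolution.mk₀_comp_extMk f.1 (n+1) rfl hf φ).symm

end OldExt
end LCaux

open CategoryTheory
namespace LCaux
open Opposite Limits

section LCdef
variable {R : Type} [CommRing R]

/-- Ext modules, unbundled -/
abbrev EX (X : Type) [AddCommGroup X] [Module R X] (N : Type) [AddCommGroup N] [Module R N] (i : ℕ) : Type :=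
  Abelian.Ext.{0} (ModuleCat.of R X) (ModuleCat.of R N) i

/-- covariant map -/
noncomputable def EXmap (X : Type) [AddCommGroup X] [Module R X] {N N' : Type} [AddCommGroup N] [Module R N]
    [AddCommGroup N'] [Module R N'] (i : ℕ) (f : N →ₗ[R] N') : EX (R := R) X N i →ₗ[R] EX (R := R) X N' i :=
  (Abelian.Ext.mk₀ (ModuleCat.ofHom f)).postcompOfLinear R (ModuleCat.of R X) (add_zero i)

noncomputable def EXpre {X X' : Type} [AddCommGroup X] [Module R X] [AddCommGroup X'] [Module R X']
    (N : Type) [AddCommGroup N] [Module R N] (i : ℕ) (g : X' →ₗ[R] X) : EX (R := R) X N i →ₗ[R] EX (R := R) X' N i :=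
  (Abelian.Ext.mk₀ (ModuleCat.ofHom g)).precompOfLinear R (ModuleCat.of R N) (zero_add i)

section
variable {X X' X'' N N' N'' : Type} [AddCommGroup X] [Module R X] [AddCommGroup X'] [Module R X']
  [AddCommGroup X''] [Module R X''] [AddCommGroup N] [Module R N] [AddCommGroup N'] [Module R N']
  [AddCommGroup N''] [Module R N'']

lemma EXmap_apply (i : ℕ) (f : N →ₗ[R] N') (x : EX (R := R) X N i) :
    EXmap X i f x = x.comp (Abelian.Ext.mk₀ (ModuleCat.ofHom f)) (add_zero i) := rfl

lemma EXpre_apply (i : ℕ) (g : X' →ₗ[R] X) (x : EX (R := R) X N i) :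
    EXpre N i g x = (Abelian.Ext.mk₀ (ModuleCat.ofHom g)).comp x (zero_add i) := rfl

lemma EXpre_id (i : ℕ) (x : EX (R := R) X N i) : EXpre N i (LinearMap.id) x = x := by
  rw [EXpre_apply]; exact Abelian.Ext.mk₀_id_comp x

lemma EXmap_id (i : ℕ) (x : EX (R := R) X N i) : EXmap X i (LinearMap.id) x = x := by
  rw [EXmap_apply]; exact Abelian.Ext.comp_mk₀_id x

lemma EXpre_comp (i : ℕ) (g : X' →ₗ[R] X) (h : X'' →ₗ[R] X') (x : EX (R := R) X N i) :
    EXpre N i (g ∘ₗ h) x = EXpre N i h (EXpre N i g x) := by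
  simp only [EXpre_apply, ModuleCat.ofHom_comp]
  rw [Abelian.Ext.mk₀_comp_mk₀_assoc]

lemma EXmap_comp (i : ℕ) (g : N' →ₗ[R] N'') (h : N →ₗ[R] N') (x : EX (R := R) X N i) :
    EXmap X i (g ∘ₗ h) x = EXmap X i g (EXmap X i h x) := by
  simp only [EXmap_apply, ModuleCat.ofHom_comp]
  rw [Abelian.Ext.comp_assoc_of_third_deg_zero, Abelian.Ext.mk₀_comp_mk₀]

lemma EXmap_pre (i : ℕ) (f : N →ₗ[R] N') (g : X' →ₗ[R] X) (x : EX (R := R) X N i) :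
    EXmap X' i f (EXpre N i g x) = EXpre N' i g (EXmap X i f x) := by
  simp only [EXmap_apply, EXpre_apply]
  rw [Abelian.Ext.comp_assoc_of_third_deg_zero]

lemma EXmap_add (i : ℕ) (f g : N →ₗ[R] N') (x : EX (R := R) X N i) :
    EXmap X i (f + g) x = EXmap X i f x + EXmap X i g x := by
  simp only [EXmap_apply, ModuleCat.ofHom_add, Abelian.Ext.mk₀_add, Abelian.Ext.comp_add]

lemma EXmap_smul_id (i : ℕ) (r : R) (x : EX (R := R) X N i) :
    EXmap X i (r • LinearMap.id) x = r • x := by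
  rw [EXmap_apply, Abelian.Ext.smul_eq_comp_mk₀]; rfl

lemma EXpre_smul_id (i : ℕ) (r : R) (x : EX (R := R) X N i) :
    EXpre N i (r • LinearMap.id) x = r • x := by
  rw [EXpre_apply]
  have : ModuleCat.ofHom (r • (LinearMap.id : X →ₗ[R] X)) = r • 𝟙 (ModuleCat.of R X) := rfl
  rw [this, Abelian.Ext.mk₀_smul, Abelian.Ext.smul_comp, Abelian.Ext.mk₀_id_comp]

lemma EX_kill (i : ℕ) (r : R) (h : ∀ x : X, r • x = 0) (x : EX (R := R) X N i) : r • x = 0 := by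
  rw [← EXpre_smul_id, EXpre_apply]
  have : r • (LinearMap.id : X →ₗ[R] X) = 0 := by ext x; simp [h]
  rw [this]
  have : ModuleCat.ofHom (0 : X →ₗ[R] X) = 0 := rfl
  rw [this, Abelian.Ext.mk₀_zero, Abelian.Ext.zero_comp]

/-- short exact sequence as a ShortComplex -/
noncomputable def sesC (f : N →ₗ[R] N') (g : N' →ₗ[R] N'') (h : Function.Exact f g) :
    ShortComplex (ModuleCat.{0} R) :=
  ShortComplex.mk (ModuleCat.ofHom f) (ModuleCat.ofHom g) (by
    ext x; exact h.apply_apply_eq_zero x)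

lemma sesC_se (f : N →ₗ[R] N') (g : N' →ₗ[R] N'') (h : Function.Exact f g)
    (hf : Function.Injective f) (hg : Function.Surjective g) : (sesC f g h).ShortExact :=
  ModuleCat.shortComplex_shortExact _ h hf hg

/-- class of the extension -/
noncomputable def EXcl (f : N →ₗ[R] N') (g : N' →ₗ[R] N'') (h : Function.Exact f g)
    (hf : Function.Injective f) (hg : Function.Surjective g) : EX (R := R) N'' N 1 :=
  (sesC_se f g h hf hg).extClass

lemma comp_EXcl (f : N →ₗ[R] N') (g : N' →ₗ[R] N'') (h : Function.Exact f g)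
    (hf : Function.Injective f) (hg : Function.Surjective g) :
    (Abelian.Ext.mk₀ (ModuleCat.ofHom g)).comp (EXcl f g h hf hg) (zero_add 1) = 0 :=
  (sesC_se f g h hf hg).comp_extClass

lemma EXcl_comp (f : N →ₗ[R] N') (g : N' →ₗ[R] N'') (h : Function.Exact f g)
    (hf : Function.Injective f) (hg : Function.Surjective g) :
    (EXcl f g h hf hg).comp (Abelian.Ext.mk₀ (ModuleCat.ofHom f)) (add_zero 1) = 0 :=
  (sesC_se f g h hf hg).extClass_comp

/-- connecting map -/
noncomputable def EXδ (X : Type) [AddCommGroup X] [Module R X] (i : ℕ)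
    (f : N →ₗ[R] N') (g : N' →ₗ[R] N'') (h : Function.Exact f g)
    (hf : Function.Injective f) (hg : Function.Surjective g) : EX (R := R) X N'' i →ₗ[R] EX (R := R) X N (i+1) :=
  (EXcl f g h hf hg).postcompOfLinear R (ModuleCat.of R X) rfl

lemma EXδ_apply (i : ℕ)
    (f : N →ₗ[R] N') (g : N' →ₗ[R] N'') (h : Function.Exact f g)
    (hf : Function.Injective f) (hg : Function.Surjective g) (x : EX (R := R) X N'' i) :
    EXδ X i f g h hf hg x = x.comp (EXcl f g h hf hg) rfl := rfl

lemma EXδ_pre (i : ℕ)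
    (f : N →ₗ[R] N') (g : N' →ₗ[R] N'') (h : Function.Exact f g)
    (hf : Function.Injective f) (hg : Function.Surjective g) (u : X' →ₗ[R] X) (x : EX (R := R) X N'' i) :
    EXδ X' i f g h hf hg (EXpre N'' i u x) = EXpre N (i+1) u (EXδ X i f g h hf hg x) := by
  rw [EXδ_apply, EXpre_apply, EXδ_apply, EXpre_apply]
  exact Abelian.Ext.comp_assoc _ _ _ _ _ (by lia)

lemma EX_exact2 (i : ℕ) (f : N →ₗ[R] N') (g : N' →ₗ[R] N'') (h : Function.Exact f g)
    (hf : Function.Injective f) (hg : Function.Surjective g) :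
    Function.Exact (EXmap X i f) (EXmap X i g) := by
  intro x
  constructor
  · intro hx
    exact Abelian.Ext.covariant_sequence_exact₂ (ModuleCat.of R X) (sesC_se f g h hf hg) x hx
  · rintro ⟨y, rfl⟩
    rw [← EXmap_comp, h.linearMap_comp_eq_zero, EXmap_apply]
    have : ModuleCat.ofHom (0 : N →ₗ[R] N'') = 0 := rfl
    rw [this, Abelian.Ext.mk₀_zero, Abelian.Ext.comp_zero]

lemma EX_exact3 (i : ℕ) (f : N →ₗ[R] N') (g : N' →ₗ[R] N'') (h : Function.Exact f g)
    (hf : Function.Injective f) (hg : Function.Surjective g) :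
    Function.Exact (EXmap X i g) (EXδ X i f g h hf hg) := by
  intro x
  constructor
  · intro hx
    exact Abelian.Ext.covariant_sequence_exact₃ (ModuleCat.of R X) (sesC_se f g h hf hg) x rfl hx
  · rintro ⟨y, rfl⟩
    rw [EXδ_apply, EXmap_apply, Abelian.Ext.comp_assoc _ _ _ _ (zero_add 1) (by lia), comp_EXcl,
      Abelian.Ext.comp_zero]

lemma EX_exact1 (i : ℕ) (f : N →ₗ[R] N') (g : N' →ₗ[R] N'') (h : Function.Exact f g)
    (hf : Function.Injective f) (hg : Function.Surjective g) :
    Function.Exact (EXδ X i f g h hf hg) (EXmap X (i+1) f) := by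
  intro x
  constructor
  · intro hx
    exact Abelian.Ext.covariant_sequence_exact₁ (ModuleCat.of R X) (sesC_se f g h hf hg) x hx rfl
  · rintro ⟨y, rfl⟩
    rw [EXδ_apply, EXmap_apply, Abelian.Ext.comp_assoc _ _ _ _ (add_zero 1) (by lia), EXcl_comp,
      Abelian.Ext.comp_zero]


lemma EX_inj_vanish (i : ℕ) [hN : Module.Injective R N] (x : EX (R := R) X N (i+1)) : x = 0 := by
  have : Injective (ModuleCat.of R N) := Module.injective_object_of_injective_module R N
  exact Abelian.Ext.eq_zero_of_injective x

/-- degree zero -/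
noncomputable def EX0 : EX (R := R) X N 0 ≃ₗ[R] (X →ₗ[R] N) :=
  (Abelian.Ext.linearEquiv₀ (R := R)).trans (ModuleCat.homLinearEquiv (S := R))

lemma EX0_symm (f : X →ₗ[R] N) : EX0.symm f = Abelian.Ext.mk₀ (ModuleCat.ofHom f) := rfl

lemma EX0_map (f : N →ₗ[R] N') (x : EX (R := R) X N 0) : EX0 (EXmap X 0 f x) = f ∘ₗ EX0 x := by
  obtain ⟨y, rfl⟩ := EX0.symm.surjective x
  rw [LinearEquiv.apply_symm_apply, ← LinearEquiv.eq_symm_apply, EX0_symm, EX0_symm, EXmap_apply,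
    Abelian.Ext.mk₀_comp_mk₀]
  rfl

lemma EX0_pre (f : X' →ₗ[R] X) (x : EX (R := R) X N 0) : EX0 (EXpre N 0 f x) = EX0 x ∘ₗ f := by
  obtain ⟨y, rfl⟩ := EX0.symm.surjective x
  rw [LinearEquiv.apply_symm_apply, ← LinearEquiv.eq_symm_apply, EX0_symm, EX0_symm, EXpre_apply,
    Abelian.Ext.mk₀_comp_mk₀]
  rfl
end

section LC
variable (a : Ideal R) (i : ℕ) (N : Type) [AddCommGroup N] [Module R N]

/-- transition map -/
noncomputable def LCt (n m : ℕ) (h : n ≤ m) : EX (R := R) (R ⧸ a ^ n) N i →ₗ[R] EX (R := R) (R ⧸ a ^ m) N i :=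
  EXpre N i (Submodule.factor (Ideal.pow_le_pow_right h))

instance LCds : DirectedSystem (fun n => EX (R := R) (R ⧸ a ^ n) N i) (fun n m h => LCt a i N n m h) where
  map_self n x := by
    have : Submodule.factor (Ideal.pow_le_pow_right (le_refl n) : a ^ n ≤ a ^ n) = LinearMap.id := by
      ext; rfl
    rw [LCt, this, EXpre_id]
  map_map n m k h1 h2 x := by
    rw [LCt, LCt, LCt, ← EXpre_comp]
    congr 2
    ext; rfl

/-- local cohomology, unbundled -/
abbrev LC : Type := Module.DirectLimit (fun n => EX (R := R) (R ⧸ a ^ n) N i) (LCt a i N)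

noncomputable def LCof (n : ℕ) : EX (R := R) (R ⧸ a ^ n) N i →ₗ[R] LC a i N :=
  Module.DirectLimit.of R ℕ (fun n => EX (R := R) (R ⧸ a ^ n) N i) (LCt a i N) n

lemma LC_exists (x : LC a i N) : ∃ n y, LCof a i N n y = x := Module.DirectLimit.exists_of x

variable {a i N}
lemma LCof_t {n m : ℕ} (h : n ≤ m) (y) : LCof a i N m (LCt a i N n m h y) = LCof a i N n y :=
  Module.DirectLimit.of_f

lemma LCof_zero {n : ℕ} (y) (h : LCof a i N n y = 0) : ∃ m, ∃ h : n ≤ m, LCt a i N n m h y = 0 :=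
  Module.DirectLimit.of.zero_exact h

lemma LC_exists_ge (x : LC a i N) (k : ℕ) : ∃ n, k ≤ n ∧ ∃ y, LCof a i N n y = x := by
  obtain ⟨n, y, rfl⟩ := LC_exists a i N x
  exact ⟨max k n, le_max_left _ _, _, LCof_t (le_max_right _ _) y⟩

variable {N' N'' : Type} [AddCommGroup N'] [Module R N'] [AddCommGroup N''] [Module R N'']

variable (a i) in
noncomputable def LCmap (f : N →ₗ[R] N') : LC a i N →ₗ[R] LC a i N' :=
  Module.DirectLimit.map (fun n => EXmap (R ⧸ a ^ n) i f) (by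
    intro n m h; ext x; exact EXmap_pre i f _ x)

lemma LCmap_of (f : N →ₗ[R] N') (n : ℕ) (x) :
    LCmap a i f (LCof a i N n x) = LCof a i N' n (EXmap _ i f x) :=
  Module.DirectLimit.map_apply_of _ _ _

variable (a i) in
noncomputable def LCδ (f : N →ₗ[R] N') (g : N' →ₗ[R] N'') (h : Function.Exact f g)
    (hf : Function.Injective f) (hg : Function.Surjective g) : LC a i N'' →ₗ[R] LC a (i+1) N :=
  Module.DirectLimit.map (fun n => EXδ (R ⧸ a ^ n) i f g h hf hg) (by
    intro n m _; ext x; exact EXδ_pre i f g h hf hg _ x)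

lemma LCδ_of (f : N →ₗ[R] N') (g : N' →ₗ[R] N'') (h : Function.Exact f g)
    (hf : Function.Injective f) (hg : Function.Surjective g) (n : ℕ) (x) :
    LCδ a i f g h hf hg (LCof a i N'' n x) = LCof a (i+1) N n (EXδ _ i f g h hf hg x) :=
  Module.DirectLimit.map_apply_of _ _ _

lemma LCmap_id (x : LC a i N) : LCmap a i LinearMap.id x = x := by
  obtain ⟨n, y, rfl⟩ := LC_exists a i N x
  rw [LCmap_of, EXmap_id]

lemma LCmap_comp (g : N' →ₗ[R] N'') (f : N →ₗ[R] N') (x : LC a i N) :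
    LCmap a i (g ∘ₗ f) x = LCmap a i g (LCmap a i f x) := by
  obtain ⟨n, y, rfl⟩ := LC_exists a i N x
  rw [LCmap_of, LCmap_of, LCmap_of, EXmap_comp]

lemma LCmap_smul_id (r : R) (x : LC a i N) : LCmap a i (r • LinearMap.id) x = r • x := by
  obtain ⟨n, y, rfl⟩ := LC_exists a i N x
  rw [LCmap_of, EXmap_smul_id, map_smul]

lemma LCmap_add (f g : N →ₗ[R] N') (x : LC a i N) :
    LCmap a i (f + g) x = LCmap a i f x + LCmap a i g x := by
  obtain ⟨n, y, rfl⟩ := LC_exists a i N x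
  rw [LCmap_of, LCmap_of, LCmap_of, EXmap_add, map_add]

lemma LCmap_zero (x : LC a i N) :
    LCmap a i (0 : N →ₗ[R] N') x = 0 := by
  have := LCmap_add (a := a) (i := i) (0 : N →ₗ[R] N') 0 x
  simpa using this

lemma LC_torsion (x : LC a i N) : ∃ n, ∀ r ∈ a ^ n, r • x = 0 := by
  obtain ⟨n, y, rfl⟩ := LC_exists a i N x
  refine ⟨n, fun r hr => ?_⟩
  rw [← map_smul, EX_kill, map_zero]
  intro x
  obtain ⟨x, rfl⟩ := Ideal.Quotient.mk_surjective x
  rw [← Ideal.Quotient.mk_eq_mk, ← Submodule.Quotient.mk_smul, Submodule.Quotient.mk_eq_zero]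
  exact Ideal.mul_mem_right _ _ hr

lemma DLexact {G G' G'' : ℕ → Type} [∀ n, AddCommGroup (G n)] [∀ n, Module R (G n)]
    [∀ n, AddCommGroup (G' n)] [∀ n, Module R (G' n)] [∀ n, AddCommGroup (G'' n)] [∀ n, Module R (G'' n)]
    {t : ∀ n m, n ≤ m → G n →ₗ[R] G m} {t' : ∀ n m, n ≤ m → G' n →ₗ[R] G' m}
    {t'' : ∀ n m, n ≤ m → G'' n →ₗ[R] G'' m}
    [DirectedSystem G'' (fun n m h => t'' n m h)]
    (f : ∀ n, G n →ₗ[R] G' n) (g : ∀ n, G' n →ₗ[R] G'' n)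
    (hf : ∀ n m h, f m ∘ₗ t n m h = t' n m h ∘ₗ f n)
    (hg : ∀ n m h, g m ∘ₗ t' n m h = t'' n m h ∘ₗ g n) (h : ∀ n, Function.Exact (f n) (g n)) :
    Function.Exact (Module.DirectLimit.map f hf) (Module.DirectLimit.map g hg) := by
  intro x
  constructor
  · intro hx
    obtain ⟨n, y, rfl⟩ := Module.DirectLimit.exists_of x
    rw [Module.DirectLimit.map_apply_of] at hx
    obtain ⟨m, hm, h2⟩ := Module.DirectLimit.of.zero_exact hx
    have h3 : g m (t' n m hm y) = 0 := by
      rw [← h2]; exact congrArg (fun z => z y) (hg n m hm)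
    obtain ⟨z, hz⟩ := (h m _).1 h3
    refine ⟨Module.DirectLimit.of R ℕ G t m z, ?_⟩
    rw [Module.DirectLimit.map_apply_of, hz, Module.DirectLimit.of_f]
  · rintro ⟨y, rfl⟩
    obtain ⟨n, y, rfl⟩ := Module.DirectLimit.exists_of y
    rw [Module.DirectLimit.map_apply_of, Module.DirectLimit.map_apply_of, (h n).apply_apply_eq_zero,
      map_zero]

lemma LC_exact2 (f : N →ₗ[R] N') (g : N' →ₗ[R] N'') (h : Function.Exact f g)
    (hf : Function.Injective f) (hg : Function.Surjective g) :
    Function.Exact (LCmap a i f) (LCmap a i g) :=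
  DLexact _ _ _ _ (fun _ => EX_exact2 i f g h hf hg)

lemma LC_exact3 (f : N →ₗ[R] N') (g : N' →ₗ[R] N'') (h : Function.Exact f g)
    (hf : Function.Injective f) (hg : Function.Surjective g) :
    Function.Exact (LCmap a i g) (LCδ a i f g h hf hg) :=
  DLexact _ _ _ _ (fun _ => EX_exact3 i f g h hf hg)

lemma LC_exact1 (f : N →ₗ[R] N') (g : N' →ₗ[R] N'') (h : Function.Exact f g)
    (hf : Function.Injective f) (hg : Function.Surjective g) :
    Function.Exact (LCδ a i f g h hf hg) (LCmap a (i+1) f) :=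
  DLexact _ _ _ _ (fun _ => EX_exact1 i f g h hf hg)

lemma LC_inj_vanish [Module.Injective R N] (x : LC a (i+1) N) : x = 0 := by
  obtain ⟨n, y, rfl⟩ := LC_exists a _ N x
  rw [EX_inj_vanish i y, map_zero]

/-- torsion submodule -/
def Gam (a : Ideal R) (N : Type) [AddCommGroup N] [Module R N] : Submodule R N where
  carrier := {x | ∃ n, ∀ r ∈ a ^ n, r • x = 0}
  zero_mem' := ⟨0, by simp⟩
  add_mem' := by
    rintro x y ⟨n, hn⟩ ⟨m, hm⟩
    refine ⟨max n m, fun r hr => ?_⟩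
    rw [smul_add, hn r (Ideal.pow_le_pow_right (le_max_left _ _) hr),
      hm r (Ideal.pow_le_pow_right (le_max_right _ _) hr), add_zero]
  smul_mem' := by
    rintro s x ⟨n, hn⟩
    exact ⟨n, fun r hr => by rw [smul_comm, hn r hr, smul_zero]⟩

/-- evaluation at one -/
noncomputable def ev1 (a : Ideal R) (N : Type) [AddCommGroup N] [Module R N] (n : ℕ) :
    EX (R := R) (R ⧸ a ^ n) N 0 →ₗ[R] N where
  toFun x := EX0 x (Submodule.Quotient.mk 1)
  map_add' x y := by simp
  map_smul' r x := by simp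

noncomputable def LC0fun (a : Ideal R) (N : Type) [AddCommGroup N] [Module R N] : LC a 0 N →ₗ[R] N :=
  Module.DirectLimit.lift R ℕ _ _ (fun n => ev1 a N n) (by
    intro n m h x
    change EX0 (EXpre N 0 _ x) _ = EX0 x _
    rw [EX0_pre]; rfl)

lemma LC0fun_of (n : ℕ) (x) : LC0fun a N (LCof a 0 N n x) = EX0 x (Submodule.Quotient.mk 1) :=
  Module.DirectLimit.lift_of _ _ _

lemma LC0fun_inj : Function.Injective (LC0fun a N) := by
  rw [injective_iff_map_eq_zero]
  intro x hx
  obtain ⟨n, y, rfl⟩ := LC_exists a _ N x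
  rw [LC0fun_of] at hx
  have : EX0 y = 0 := by
    apply Submodule.linearMap_qext
    ext
    simpa using hx
  rw [(LinearEquiv.map_eq_zero_iff EX0).1 this, map_zero]

lemma LC0fun_range (x : N) : x ∈ Set.range (LC0fun a N) ↔ x ∈ Gam a N := by
  constructor
  · rintro ⟨y, rfl⟩
    obtain ⟨n, hn⟩ := LC_torsion y
    exact ⟨n, fun r hr => by rw [← map_smul, hn r hr, map_zero]⟩
  · rintro ⟨n, hn⟩
    refine ⟨LCof a 0 N n (EX0.symm (Submodule.liftQ _ (LinearMap.toSpanSingleton R N x) ?_)), ?_⟩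
    · intro r hr; simpa using hn r hr
    · rw [LC0fun_of, LinearEquiv.apply_symm_apply, Submodule.liftQ_apply]; simp

lemma LC0fun_nat (f : N →ₗ[R] N') (x : LC a 0 N) : LC0fun a N' (LCmap a 0 f x) = f (LC0fun a N x) := by
  obtain ⟨n, y, rfl⟩ := LC_exists a _ N x
  rw [LCmap_of, LC0fun_of, LC0fun_of, EX0_map]; rfl

section compare
open localCohomology

noncomputable def mlι (a : Ideal R) (i : ℕ) (M : ModuleCat.{0} R) (n : ℕ) :
    ((Ext R (ModuleCat.{0} R) i).obj (op (ModuleCat.of R (R ⧸ a ^ n)))).obj M →ₗ[R]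
      (localCohomology a i).obj M :=
  ((colimit.ι (diagram (idealPowersDiagram a) i) (op (op n))).app M).hom

lemma mlι_w (a : Ideal R) (i : ℕ) (M : ModuleCat.{0} R) (n m : ℕ) (h : n ≤ m) (x) :
    mlι a i M m (((Ext R (ModuleCat.{0} R) i).map
      (ModuleCat.ofHom (Submodule.factor (Ideal.pow_le_pow_right h : a ^ m ≤ a ^ n))).op).app M x) =
    mlι a i M n x := by
  have := colimit.w (diagram (idealPowersDiagram a) i) (homOfLE h).op.op
  exact congrArg (fun z => (z.app M).hom x) this

lemma ml_isColim (a : Ideal R) (i : ℕ) (M : ModuleCat.{0} R) :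
   Nonempty (IsColimit (((evaluation _ _).obj M).mapCocone
      (colimit.cocone (diagram (idealPowersDiagram a) i)))) :=
  ⟨isColimitOfPreserves ((evaluation _ _).obj M)
    (colimit.isColimit (diagram (idealPowersDiagram a) i))⟩

lemma ml_exists (a : Ideal R) (i : ℕ) (M : ModuleCat.{0} R) (x : (localCohomology a i).obj M) :
    ∃ n y, mlι a i M n y = x := by
  obtain ⟨h⟩ := ml_isColim a i M
  obtain ⟨j, y, hy⟩ := Concrete.isColimit_exists_rep _ h x
  exact ⟨j.unop.unop, y, hy⟩

lemma ml_zero (a : Ideal R) (i : ℕ) (M : ModuleCat.{0} R) (n : ℕ) (x) (hx : mlι a i M n x = 0) :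
    ∃ m, ∃ h : n ≤ m, ((Ext R (ModuleCat.{0} R) i).map
      (ModuleCat.ofHom (Submodule.factor (Ideal.pow_le_pow_right h : a ^ m ≤ a ^ n))).op).app M x = 0 := by
  obtain ⟨h⟩ := ml_isColim a i M
  have hx2 : mlι a i M n x = mlι a i M n 0 := by rw [hx, map_zero]
  obtain ⟨k, f, g, hy⟩ := (Concrete.isColimit_rep_eq_iff_exists
    ((diagram (idealPowersDiagram a) i) ⋙ ((evaluation _ _).obj M)) h (i := op (op n))
    (j := op (op n)) x (0 : ((Ext R (ModuleCat.{0} R) i).obj (op (ModuleCat.of R (R ⧸ a ^ n)))).obj M)).1 hx2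
  refine ⟨k.unop.unop, leOfHom f.unop.unop, ?_⟩
  have h3 : ((diagram (idealPowersDiagram a) i ⋙ (evaluation _ _).obj M).map g)
      (0 : ((Ext R (ModuleCat.{0} R) i).obj (op (ModuleCat.of R (R ⧸ a ^ n)))).obj M) = 0 :=
    map_zero (((diagram (idealPowersDiagram a) i ⋙ (evaluation _ _).obj M).map g).hom)
  exact hy.trans h3

noncomputable def lcHom (a : Ideal R) (i : ℕ) (M : ModuleCat.{0} R) :
    LC a i M →ₗ[R] (localCohomology a i).obj M :=
  Module.DirectLimit.lift R ℕ _ _ (fun n => mlι a i M n ∘ₗ (oldNew (ModuleCat.of R (R ⧸ a ^ n)) M i).symm.toLinearMap)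
    (by
      intro n m h x
      simp only [LinearMap.comp_apply, LinearEquiv.coe_coe]
      rw [← mlι_w a i M n m h]
      congr 1
      rw [LinearEquiv.symm_apply_eq, oldNew_nat, LinearEquiv.apply_symm_apply]
      rfl)

lemma lcHom_of (a : Ideal R) (i : ℕ) (M : ModuleCat.{0} R) (n : ℕ) (x) :
    lcHom a i M (LCof a i M n x) = mlι a i M n ((oldNew (ModuleCat.of R (R ⧸ a ^ n)) M i).symm x) :=
  Module.DirectLimit.lift_of _ _ _

/-- comparison with Mathlib local cohomology -/
noncomputable def lcEquiv (a : Ideal R) (i : ℕ) (M : ModuleCat.{0} R) :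
    LC a i M ≃ₗ[R] (localCohomology a i).obj M :=
  LinearEquiv.ofBijective (lcHom a i M) (by
    constructor
    · rw [injective_iff_map_eq_zero]
      intro x hx
      obtain ⟨n, y, rfl⟩ := LC_exists a i M x
      rw [lcHom_of] at hx
      obtain ⟨m, h, h1⟩ := ml_zero a i M n _ hx
      rw [← LCof_t h]
      have h2 := congrArg (oldNew (ModuleCat.of R (R ⧸ a ^ m)) M i) h1
      rw [oldNew_nat, LinearEquiv.apply_symm_apply, map_zero] at h2
      have h3 : LCt a i M n m h y = 0 := h2
      rw [h3, map_zero]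
    · intro x
      obtain ⟨n, y, rfl⟩ := ml_exists a i M x
      exact ⟨LCof a i M n (oldNew _ M i y), by rw [lcHom_of, LinearEquiv.symm_apply_apply]⟩)

end compare

end LC

end LCdef
end LCaux

open CategoryTheory
namespace LCaux
open Opposite Limits

section basics
variable {R : Type} [CommRing R]

/-- vanishing of local cohomology -/
abbrev LCv (a : Ideal R) (i : ℕ) (N : Type) [AddCommGroup N] [Module R N] : Prop := ∀ x : LC a i N, x = 0

variable {N N' N'' : Type} [AddCommGroup N] [Module R N] [AddCommGroup N'] [Module R N']
  [AddCommGroup N''] [Module R N''] {a : Ideal R} {i : ℕ}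

lemma exists_inj_embed (R : Type) [CommRing R] (N : Type) [AddCommGroup N] [Module R N] :
    ∃ (J : Type) (_ : AddCommGroup J) (_ : Module R J) (_ : Module.Injective R J) (f : N →ₗ[R] J),
      Function.Injective f := by
  let J := Injective.under (ModuleCat.of R N)
  refine ⟨J, inferInstance, inferInstance, ?_, (Injective.ι (ModuleCat.of R N)).hom, ?_⟩
  · have : CategoryTheory.Injective (ModuleCat.of R J) := inferInstanceAs (CategoryTheory.Injective J)
    exact (Module.injective_iff_injective_object R J).2 this
  · exact (ModuleCat.mono_iff_injective _).1 inferInstance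

lemma inj_extend {J X Y : Type} [AddCommGroup J] [Module R J] [Module.Injective R J]
    [AddCommGroup X] [Module R X] [AddCommGroup Y] [Module R Y] (p : X →ₗ[R] Y) (g : X →ₗ[R] J)
    (h : LinearMap.ker p ≤ LinearMap.ker g) : ∃ h : Y →ₗ[R] J, ∀ x, h (p x) = g x := by
  obtain ⟨k, hk⟩ := Module.Injective.out (R := R) (Q := J) ((LinearMap.ker p).liftQ p le_rfl)
    (LinearMap.ker_eq_bot.1 (Submodule.ker_liftQ_eq_bot _ _ _ le_rfl)) ((LinearMap.ker p).liftQ g h)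
  exact ⟨k, fun x => by simpa using hk (Submodule.Quotient.mk x)⟩

lemma LCmap_equiv (e : N ≃ₗ[R] N') : Function.Bijective (LCmap a i e.toLinearMap) := by
  have h1 : ∀ x, LCmap a i e.symm.toLinearMap (LCmap a i e.toLinearMap x) = x := fun x => by
    rw [← LCmap_comp]; simpa using LCmap_id x
  have h2 : ∀ x, LCmap a i e.toLinearMap (LCmap a i e.symm.toLinearMap x) = x := fun x => by
    rw [← LCmap_comp]; simpa using LCmap_id x
  exact ⟨Function.LeftInverse.injective h1, Function.RightInverse.surjective h2⟩

/-- functoriality for isomorphisms -/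
noncomputable def LCeq (a : Ideal R) (i : ℕ) (e : N ≃ₗ[R] N') : LC a i N ≃ₗ[R] LC a i N' :=
  LinearEquiv.ofBijective (LCmap a i e.toLinearMap) (LCmap_equiv e)

lemma LCv_equiv (e : N ≃ₗ[R] N') (h : LCv a i N) : LCv a i N' := by
  intro x
  obtain ⟨y, rfl⟩ := (LCmap_equiv (a := a) (i := i) e).2 x
  rw [h y, map_zero]

lemma LC_bij_vanish (y : R) (hy : y ∈ a) (hb : Function.Bijective (fun n : N => y • n)) : LCv a i N := by
  intro x
  let e : N ≃ₗ[R] N := LinearEquiv.ofBijective (y • LinearMap.id) hb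
  have hinj : ∀ x : LC a i N, y • x = 0 → x = 0 := by
    intro x hx
    rw [← LCmap_smul_id] at hx
    exact (LCmap_equiv (a := a) (i := i) e).1 (hx.trans (map_zero _).symm)
  obtain ⟨n, hn⟩ := LC_torsion x
  have := hn (y ^ n) (Ideal.pow_mem_pow hy n)
  clear hn
  induction n with
  | zero => simpa using this
  | succ n ih =>
    apply ih
    apply hinj
    rw [smul_smul, ← pow_succ', this]

lemma LCv_mid (f : N →ₗ[R] N') (g : N' →ₗ[R] N'') (h : Function.Exact f g)
    (hf : Function.Injective f) (hg : Function.Surjective g) (h1 : LCv a i N) (h2 : LCv a i N'') :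
    LCv a i N' := by
  intro x
  obtain ⟨y, rfl⟩ := (LC_exact2 f g h hf hg x).1 (h2 _)
  rw [h1 y, map_zero]

lemma LCv_right (f : N →ₗ[R] N') (g : N' →ₗ[R] N'') (h : Function.Exact f g)
    (hf : Function.Injective f) (hg : Function.Surjective g) (h1 : LCv a i N') (h2 : LCv a (i+1) N) :
    LCv a i N'' := by
  intro x
  obtain ⟨y, rfl⟩ := (LC_exact3 f g h hf hg x).1 (h2 _)
  rw [h1 y, map_zero]

lemma LCv_left (f : N →ₗ[R] N') (g : N' →ₗ[R] N'') (h : Function.Exact f g)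
    (hf : Function.Injective f) (hg : Function.Surjective g) (h1 : LCv a i N'') (h2 : LCv a (i+1) N') :
    LCv a (i+1) N := by
  intro x
  obtain ⟨y, rfl⟩ := (LC_exact1 f g h hf hg x).1 (h2 _)
  rw [h1 y, map_zero]

lemma LC_surj_left (f : N →ₗ[R] N') (g : N' →ₗ[R] N'') (h : Function.Exact f g)
    (hf : Function.Injective f) (hg : Function.Surjective g) (h1 : LCv a i N'') :
    Function.Surjective (LCmap a i f) := fun x => (LC_exact2 f g h hf hg x).1 (h1 _)

lemma LC_surj_right (f : N →ₗ[R] N') (g : N' →ₗ[R] N'') (h : Function.Exact f g)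
    (hf : Function.Injective f) (hg : Function.Surjective g) (h1 : LCv a (i+1) N) :
    Function.Surjective (LCmap a i g) := fun x => (LC_exact3 f g h hf hg x).1 (h1 _)

lemma LC_surj_δ (f : N →ₗ[R] N') (g : N' →ₗ[R] N'') (h : Function.Exact f g)
    (hf : Function.Injective f) (hg : Function.Surjective g) (h1 : LCv a (i+1) N') :
    Function.Surjective (LCδ a i f g h hf hg) := fun x => (LC_exact1 f g h hf hg x).1 (h1 _)

/-- submodule exact sequence -/
lemma ses_sub (L : Submodule R N) : Function.Exact L.subtype L.mkQ := LinearMap.exact_subtype_mkQ L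

lemma ses_range (f : N →ₗ[R] N') : Function.Exact f (LinearMap.range f).mkQ :=
  LinearMap.exact_iff.2 (by simp)

lemma Gam_mem {x : N} : x ∈ Gam a N ↔ ∃ n, ∀ r ∈ a ^ n, r • x = 0 := Iff.rfl

lemma Gam_span_mem {y : R} {x : N} : x ∈ Gam (Ideal.span {y}) N ↔ ∃ n, y ^ n • x = 0 := by
  rw [Gam_mem]
  refine exists_congr fun n => ?_
  rw [Ideal.span_singleton_pow]
  constructor
  · intro h; exact h _ (Ideal.mem_span_singleton_self _)
  · intro h r hr
    obtain ⟨s, rfl⟩ := Ideal.mem_span_singleton'.1 hr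
    rw [mul_smul, h, smul_zero]

variable [IsNoetherianRing R]

lemma Gam_inj (J : Type) [AddCommGroup J] [Module R J] [Module.Injective R J] (a : Ideal R) :
    Module.Injective R (Gam a J) := by
  apply Module.Baer.injective
  intro I g
  have h1 : ∃ n, ∀ r ∈ a ^ n, ∀ x, r • g x = 0 := by
    have : ∀ S : Submodule R I, S.FG → ∃ n, ∀ r ∈ a ^ n, ∀ x ∈ S, r • g x = 0 := by
      intro S hS
      induction S, hS using Submodule.fg_induction with
      | singleton x =>
        obtain ⟨n, hn⟩ := (g x).2
        refine ⟨n, fun r hr z hz => ?_⟩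
        obtain ⟨s, rfl⟩ := Submodule.mem_span_singleton.1 hz
        rw [map_smul, smul_comm]
        have : r • g x = 0 := Subtype.ext (hn r hr)
        rw [this, smul_zero]
      | sup S T _ _ h1 h2 =>
        obtain ⟨n, hn⟩ := h1
        obtain ⟨m, hm⟩ := h2
        refine ⟨max n m, fun r hr z hz => ?_⟩
        obtain ⟨s, hs, t, ht, rfl⟩ := Submodule.mem_sup.1 hz
        rw [map_add, smul_add, hn r (Ideal.pow_le_pow_right (le_max_left _ _) hr) s hs,
          hm r (Ideal.pow_le_pow_right (le_max_right _ _) hr) t ht, add_zero]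
    obtain ⟨n, hn⟩ := this ⊤ (IsNoetherian.noetherian _)
    exact ⟨n, fun r hr x => hn r hr x trivial⟩
  obtain ⟨n, hn⟩ := h1
  obtain ⟨k, hk⟩ := Ideal.exists_pow_inf_eq_pow_smul a (I : Submodule R R)
  have h2 := hk (n + k) (by omega)
  rw [Nat.add_sub_cancel] at h2
  have h3 : ∀ x : I, (x : R) ∈ a ^ (n + k) → g x = 0 := by
    intro x hx
    have h4 : (x : R) ∈ a ^ n • (I : Submodule R R) := by
      have : (x : R) ∈ (a ^ (n+k) • ⊤ ⊓ I : Submodule R R) := ⟨by simpa using hx, x.2⟩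
      rw [h2] at this
      exact Submodule.smul_mono le_rfl inf_le_right this
    have h5 : ∀ z (hz : z ∈ a ^ n • (I : Submodule R R)), ∃ h : z ∈ I, g ⟨z, h⟩ = 0 := by
      intro z hz
      induction hz using Submodule.smul_induction_on' with
      | smul r hr s hs =>
        exact ⟨I.mul_mem_left r hs, by
          have : (⟨r • s, I.mul_mem_left r hs⟩ : I) = r • ⟨s, hs⟩ := rfl
          rw [this, map_smul, hn r hr]⟩
      | add z hz w hw h1 h2 =>
        obtain ⟨hz, h1⟩ := h1
        obtain ⟨hw, h2⟩ := h2
        refine ⟨I.add_mem hz hw, ?_⟩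
        have : (⟨z + w, I.add_mem hz hw⟩ : I) = ⟨z, hz⟩ + ⟨w, hw⟩ := rfl
        rw [this, map_add, h1, h2, add_zero]
    exact (h5 _ h4).2
  obtain ⟨h, hh⟩ := inj_extend ((Submodule.mkQ (a ^ (n + k))) ∘ₗ I.subtype) ((Gam a J).subtype ∘ₗ g) (by
    intro x hx
    rw [LinearMap.mem_ker, LinearMap.comp_apply, Submodule.mkQ_apply, Submodule.Quotient.mk_eq_zero] at hx
    rw [LinearMap.mem_ker, LinearMap.comp_apply, h3 x hx, map_zero])
  refine ⟨LinearMap.codRestrict _ (h ∘ₗ Submodule.mkQ _) ?_, ?_⟩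
  · intro x
    refine ⟨n + k, fun r hr => ?_⟩
    rw [← map_smul, LinearMap.comp_apply, Submodule.mkQ_apply,
      (Submodule.Quotient.mk_eq_zero (a ^ (n + k)) (x := r • x)).2 (Ideal.mul_mem_right x _ hr), map_zero]
  · intro x mem
    apply Subtype.ext
    exact hh ⟨x, mem⟩

/-- torsion modules -/
def IsTors (a : Ideal R) (N : Type) [AddCommGroup N] [Module R N] : Prop :=
  ∀ x : N, ∃ n, ∀ r ∈ a ^ n, r • x = 0

lemma tors_embed (h : IsTors a N) : ∃ (J : Type) (_ : AddCommGroup J) (_ : Module R J)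
    (_ : Module.Injective R J) (f : N →ₗ[R] J), Function.Injective f ∧ IsTors a J := by
  obtain ⟨J, _, _, _, f, hf⟩ := exists_inj_embed R N
  refine ⟨Gam a J, inferInstance, inferInstance, Gam_inj J a,
    LinearMap.codRestrict _ f (fun x => ?_), ?_, ?_⟩
  · obtain ⟨n, hn⟩ := h x
    exact ⟨n, fun r hr => by rw [← map_smul, hn r hr, map_zero]⟩
  · intro x y hxy
    exact hf (congrArg Subtype.val hxy)
  · rintro ⟨x, n, hn⟩
    exact ⟨n, fun r hr => Subtype.ext (hn r hr)⟩

lemma IsTors.quot (h : IsTors a N) (g : N →ₗ[R] N') (hg : Function.Surjective g) : IsTors a N' := by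
  intro x
  obtain ⟨x, rfl⟩ := hg x
  obtain ⟨n, hn⟩ := h x
  exact ⟨n, fun r hr => by rw [← map_smul, hn r hr, map_zero]⟩

lemma LC0_surj_of_tors (f : N →ₗ[R] N') (hf : Function.Surjective f) (h : IsTors a N) :
    Function.Surjective (LCmap a 0 f) := by
  intro x
  obtain ⟨y, hy⟩ := hf (LC0fun a N' x)
  obtain ⟨z, hz⟩ := (LC0fun_range (a := a) y).2 (h y)
  refine ⟨z, LC0fun_inj ?_⟩
  rw [LC0fun_nat, hz, hy]

/-- E3 -/
lemma LC_tors_vanish (h : IsTors a N) : LCv a (i+1) N := by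
  induction i generalizing N with
  | zero =>
    obtain ⟨J, _, _, _, f, hf, hJ⟩ := tors_embed h
    intro x
    obtain ⟨y, rfl⟩ := LC_surj_δ f _ (ses_range f) hf (Submodule.mkQ_surjective _)
      (fun x => LC_inj_vanish x) x
    obtain ⟨y, rfl⟩ := LC0_surj_of_tors (LinearMap.range f).mkQ (Submodule.mkQ_surjective _) hJ y
    exact (LC_exact3 _ _ _ _ _).apply_apply_eq_zero y
  | succ i ih =>
    obtain ⟨J, _, _, _, f, hf, hJ⟩ := tors_embed h
    exact LCv_left f _ (ses_range f) hf (Submodule.mkQ_surjective _)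
      (ih (hJ.quot _ (Submodule.mkQ_surjective _))) (fun x => LC_inj_vanish x)

lemma inj_mod_bij (J : Type) [AddCommGroup J] [Module R J] [Module.Injective R J] (y : R) :
    Function.Bijective (fun x : J ⧸ Gam (Ideal.span {y}) J => y • x) := by
  constructor
  · have : Function.Injective ((y • LinearMap.id : (J ⧸ Gam (Ideal.span {y}) J) →ₗ[R] _)) := by
      rw [injective_iff_map_eq_zero]
      intro x hx
      obtain ⟨x, rfl⟩ := Submodule.mkQ_surjective _ x
      have hx : y • (Submodule.mkQ (Gam (Ideal.span {y}) J)) x = 0 := hx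
      rw [← map_smul, Submodule.mkQ_apply, Submodule.Quotient.mk_eq_zero, Gam_span_mem] at hx
      rw [Submodule.mkQ_apply, Submodule.Quotient.mk_eq_zero, Gam_span_mem]
      obtain ⟨n, hn⟩ := hx
      exact ⟨n+1, by rw [pow_succ, mul_smul, hn]⟩
    exact this
  · intro j
    obtain ⟨j, rfl⟩ := Submodule.mkQ_surjective _ j
    obtain ⟨k, hk⟩ := monotone_stabilizes_iff_noetherian.2 (inferInstance : IsNoetherian R R)
      ⟨fun n => LinearMap.ker (y ^ n • (LinearMap.id : R →ₗ[R] R)), by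
        intro n m h x hx
        rw [LinearMap.mem_ker] at hx ⊢
        obtain ⟨t, rfl⟩ := Nat.exists_eq_add_of_le h
        have hx : y ^ n * x = 0 := hx
        change y ^ (n + t) * x = 0
        rw [pow_add, mul_right_comm, hx, zero_mul]⟩
    have hk1 := hk (k+1) (by omega)
    obtain ⟨h, hh⟩ := inj_extend (J := J) (y ^ (k+1) • (LinearMap.id : R →ₗ[R] R))
      (LinearMap.toSpanSingleton R J (y ^ k • j)) (by
        intro r hr
        have : r ∈ LinearMap.ker (y ^ k • (LinearMap.id : R →ₗ[R] R)) := by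
          change _ = LinearMap.ker (y ^ (k+1) • (LinearMap.id : R →ₗ[R] R)) at hk1
          rw [← hk1] at hr; exact hr
        have h2 : y ^ k * r = 0 := this
        rw [LinearMap.mem_ker, LinearMap.toSpanSingleton_apply, smul_smul, mul_comm, h2, zero_smul])
    refine ⟨Submodule.mkQ _ (h 1), ?_⟩
    have h1 := hh 1
    change y • Submodule.mkQ _ (h 1) = _
    rw [← map_smul, Submodule.mkQ_apply, Submodule.mkQ_apply, Submodule.Quotient.eq, Gam_span_mem]
    refine ⟨k, ?_⟩
    rw [LinearMap.toSpanSingleton_apply, one_smul, LinearMap.smul_apply, LinearMap.id_apply, map_smul] at h1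
    rw [smul_sub, smul_smul, ← pow_succ, h1, sub_self]

lemma isTors_of_gens (l : Set R) (h : ∀ y ∈ l, ∀ x : N, ∃ n, y ^ n • x = 0) : IsTors (Ideal.span l) N := by
  intro x
  let I : Ideal R := LinearMap.ker (LinearMap.toSpanSingleton R N x)
  have h1 : Ideal.span l ≤ I.radical := by
    rw [Ideal.span_le]
    intro y hy
    obtain ⟨n, hn⟩ := h y hy x
    exact ⟨n, hn⟩
  obtain ⟨n, hn⟩ := Ideal.exists_pow_le_of_le_radical_of_fg h1 (IsNoetherian.noetherian _)
  exact ⟨n, fun r hr => hn hr⟩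

/-- acyclicity criterion -/
lemma acy (C : ∀ (J : Type) [AddCommGroup J] [Module R J], Prop)
    (hC : ∀ (J : Type) [AddCommGroup J] [Module R J], C J → ∀ y ∈ a, ∃ (J' : Type) (_ : AddCommGroup J')
      (_ : Module R J') (f : J' →ₗ[R] J), C J' ∧ Function.Injective f ∧ (∀ x : J', ∃ n, y ^ n • x = 0) ∧
      Function.Bijective (fun x : J ⧸ LinearMap.range f => y • x))
    (J : Type) [AddCommGroup J] [Module R J] (h : C J) (i : ℕ) : LCv a (i+1) J := by
  obtain ⟨s, hs⟩ := (IsNoetherian.noetherian a : a.FG)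
  have key : ∀ s : Finset R, (∀ y ∈ s, y ∈ a) → ∃ (J' : Type) (_ : AddCommGroup J')
      (_ : Module R J'), C J' ∧ (∀ y ∈ s, ∀ x : J', ∃ n, y ^ n • x = 0) ∧
      (∀ i, LCv a i J' → LCv a i J) := by
    classical
    intro s
    induction s using Finset.induction_on with
    | empty => exact fun _ => ⟨J, inferInstance, inferInstance, h, by simp, fun i h => h⟩
    | insert y s hy ih =>
      intro hs
      obtain ⟨J1, _, _, h1, h2, h3⟩ := ih (fun y hy => hs y (Finset.mem_insert_of_mem hy))
      obtain ⟨J2, _, _, f, h4, h5, h6, h7⟩ := hC J1 h1 y (hs y (Finset.mem_insert_self _ _))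
      refine ⟨J2, inferInstance, inferInstance, h4, ?_, ?_⟩
      · intro z hz x
        rcases Finset.mem_insert.1 hz with rfl | hz
        · exact h6 x
        · obtain ⟨n, hn⟩ := h2 z hz (f x)
          exact ⟨n, h5 (by rw [map_smul, hn, map_zero])⟩
      · intro i hi
        exact h3 i (LCv_mid f _ (ses_range f) h5 (Submodule.mkQ_surjective _) hi
          (LC_bij_vanish y (hs y (Finset.mem_insert_self _ _)) h7))
  obtain ⟨J', _, _, _, h2, h3⟩ := key s (fun y hy => hs ▸ Ideal.subset_span hy)
  have h4 := isTors_of_gens (N := J') (s : Set R) h2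
  rw [show Ideal.span (s : Set R) = a from hs] at h4
  exact h3 _ (LC_tors_vanish h4)

end basics
end LCaux

open CategoryTheory
namespace LCaux
open Opposite Limits

lemma induced_addEquiv {A A' B B' : Type} [AddCommGroup A] [AddCommGroup A'] [AddCommGroup B] [AddCommGroup B']
    (d : A →+ B) (d' : A' →+ B') (hd : Function.Surjective d) (hd' : Function.Surjective d')
    (e : A ≃+ A') (h : ∀ x, d x = 0 ↔ d' (e x) = 0) :
    ∃ f : B ≃+ B', ∀ x, f (d x) = d' (e x) := by
  have hker : d.ker.map e.toAddMonoidHom = d'.ker := by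
    ext z
    constructor
    · rintro ⟨x, hx, rfl⟩
      exact (h x).1 hx
    · intro hz
      refine ⟨e.symm z, (h _).2 ?_, e.apply_symm_apply z⟩
      rw [e.apply_symm_apply]; exact hz
  let f := ((QuotientAddGroup.quotientKerEquivOfSurjective d hd).symm.trans
    (QuotientAddGroup.congr d.ker d'.ker e hker)).trans (QuotientAddGroup.quotientKerEquivOfSurjective d' hd')
  refine ⟨f, fun x => ?_⟩
  have : (QuotientAddGroup.quotientKerEquivOfSurjective d hd).symm (d x) = QuotientAddGroup.mk x := by
    rw [AddEquiv.symm_apply_eq]; rfl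
  change (QuotientAddGroup.quotientKerEquivOfSurjective d' hd') (QuotientAddGroup.congr d.ker d'.ker e hker
    ((QuotientAddGroup.quotientKerEquivOfSurjective d hd).symm (d x))) = _
  rw [this]; rfl

section E6
variable {R S : Type} [CommRing R] [CommRing S] [IsNoetherianRing R] [IsNoetherianRing S] [Algebra R S]
variable {a : Ideal R}

lemma bij_range_of_exact {N N' N'' : Type} [AddCommGroup N] [Module R N] [AddCommGroup N'] [Module R N']
  [AddCommGroup N''] [Module R N''] (f : N →ₗ[R] N') (g : N' →ₗ[R] N'') (h : Function.Exact f g)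
    (hg : Function.Surjective g) (y : R) (hb : Function.Bijective (fun x : N'' => y • x)) :
    Function.Bijective (fun x : N' ⧸ LinearMap.range f => y • x) := by
  let e := h.linearEquivOfSurjective hg
  have : (fun x : N' ⧸ LinearMap.range f => y • x) = e.symm ∘ (fun x : N'' => y • x) ∘ e := by
    ext x; simp
  rw [this]
  exact e.symm.bijective.comp (hb.comp e.bijective)

lemma acyE6_step (J : Type) [AddCommGroup J] [Module R J] [Module S J] [IsScalarTower R S J] [Module.Injective S J]
    (y : R) : ∃ (J' : Type) (_ : AddCommGroup J')
      (_ : Module R J') (f : J' →ₗ[R] J), (∃ (_ : Module S J') (_ : IsScalarTower R S J'), Module.Injective S J')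
       ∧ Function.Injective f ∧ (∀ x : J', ∃ n, y ^ n • x = 0) ∧
      Function.Bijective (fun x : J ⧸ LinearMap.range f => y • x) := by
  obtain ⟨G, hG⟩ : ∃ G, G = Gam (Ideal.span {algebraMap R S y}) J := ⟨_, rfl⟩
  have h3 : ∀ x : G, ∃ n, y ^ n • x = 0 := by
    intro x
    have hx : (x : J) ∈ Gam (Ideal.span {algebraMap R S y}) J := by rw [← hG]; exact x.2
    obtain ⟨n, hn⟩ := Gam_span_mem.1 hx
    refine ⟨n, Subtype.ext ?_⟩
    change y ^ n • (x : J) = 0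
    rw [← hn, ← map_pow, algebraMap_smul]
  have h4 : Function.Bijective (fun x : J ⧸ G => y • x) := by
    have := inj_mod_bij (R := S) J (algebraMap R S y)
    have h5 : (fun x : J ⧸ G => y • x) = fun x : J ⧸ G => (algebraMap R S y) • x := by
      ext x; rw [algebraMap_smul]
    rw [h5, hG]; exact this
  have h5 : Module.Injective S G := by rw [hG]; exact Gam_inj J _
  have h6 : Function.Bijective (fun x : J ⧸ LinearMap.range (G.subtype.restrictScalars R) => y • x) :=
    bij_range_of_exact _ (G.mkQ.restrictScalars R) (ses_sub G) (Submodule.mkQ_surjective _) y h4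
  exact ⟨G, inferInstance, inferInstance, G.subtype.restrictScalars R, ⟨inferInstance, inferInstance, h5⟩,
    Subtype.val_injective, h3, h6⟩

lemma acyE6 (J : Type) [AddCommGroup J] [Module R J] [Module S J] [IsScalarTower R S J] [Module.Injective S J]
    (i : ℕ) : LCv a (i+1) J := by
  refine acy (fun J _ _ => ∃ (_ : Module S J) (_ : IsScalarTower R S J), Module.Injective S J) ?_ J
    ⟨inferInstance, inferInstance, inferInstance⟩ i
  rintro J _ _ ⟨_, _, _⟩ y hy
  exact acyE6_step (S := S) J y

lemma Gam_restrict {N : Type} [AddCommGroup N] [Module R N] [Module S N] [IsScalarTower R S N] (x : N) :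
    x ∈ Gam a N ↔ x ∈ Gam (a.map (algebraMap R S)) N := by
  rw [Gam_mem, Gam_mem]
  refine exists_congr fun n => ?_
  rw [← Ideal.map_pow]
  constructor
  · intro h r hr
    have : Ideal.map (algebraMap R S) (a ^ n) ≤ LinearMap.ker (LinearMap.toSpanSingleton S N x) := by
      rw [Ideal.map_le_iff_le_comap]
      intro r hr
      change algebraMap R S r • x = 0
      rw [algebraMap_smul, h r hr]
    exact this hr
  · intro h r hr
    rw [← algebraMap_smul S r x]
    exact h _ (Ideal.mem_map_of_mem _ hr)

lemma E6_zero (N : Type) [AddCommGroup N] [Module R N] [Module S N] [IsScalarTower R S N] :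
    ∃ e : LC a 0 N ≃+ LC (a.map (algebraMap R S)) 0 N,
      ∀ x, LC0fun (a.map (algebraMap R S)) N (e x) = LC0fun a N x := by
  have h1 : ∀ x : LC a 0 N, ∃ y, LC0fun (a.map (algebraMap R S)) N y = LC0fun a N x := fun x =>
    (LC0fun_range _).2 ((Gam_restrict _).1 ((LC0fun_range _).1 ⟨x, rfl⟩))
  choose e he using h1
  have hadd : ∀ x y, e (x + y) = e x + e y := fun x y => LC0fun_inj (by simp [he])
  have hb : Function.Bijective e := by
    constructor
    · intro x y h
      apply LC0fun_inj
      rw [← he, ← he, h]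
    · intro y
      obtain ⟨x, hx⟩ := (LC0fun_range (a := a) _).2 ((Gam_restrict _).2 ((LC0fun_range _).1 ⟨y, rfl⟩))
      exact ⟨x, LC0fun_inj (by rw [he, hx])⟩
  exact ⟨AddEquiv.ofBijective (⟨⟨e, LC0fun_inj (by rw [he, map_zero, map_zero])⟩, hadd⟩ : _ →+ _) hb, he⟩

lemma LC0_range_iff {R : Type} [CommRing R] {a : Ideal R} {N N' : Type} [AddCommGroup N] [Module R N] [AddCommGroup N'] [Module R N']
    (g : N →ₗ[R] N') (x : LC a 0 N') :
    x ∈ Set.range (LCmap a 0 g) ↔ ∃ z ∈ Gam a N, g z = LC0fun a N' x := by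
  constructor
  · rintro ⟨y, rfl⟩
    exact ⟨LC0fun a N y, (LC0fun_range _).1 ⟨y, rfl⟩, (LC0fun_nat g y).symm⟩
  · rintro ⟨z, hz, h⟩
    obtain ⟨y, rfl⟩ := (LC0fun_range _).2 hz
    exact ⟨y, LC0fun_inj (by rw [LC0fun_nat, h])⟩

lemma E6 (i : ℕ) (N : Type) [AddCommGroup N] [Module R N] [Module S N] [IsScalarTower R S N] :
    ∃ e : LC a i N ≃+ LC (a.map (algebraMap R S)) i N, ∀ (r : R) x, e (r • x) = algebraMap R S r • e x := by
  induction i generalizing N with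
  | zero =>
    obtain ⟨e, he⟩ := E6_zero (R := R) (S := S) (a := a) N
    refine ⟨e, fun r x => LC0fun_inj ?_⟩
    rw [he, map_smul, map_smul, he, algebraMap_smul]
  | succ i ih =>
    obtain ⟨J, _, _, _, fS, hf⟩ := exists_inj_embed S N
    let _ : Module R J := Module.compHom J (algebraMap R S)
    have : IsScalarTower R S J := IsScalarTower.of_algebraMap_smul (fun r x => rfl)
    let QS := J ⧸ LinearMap.range fS
    let gS : J →ₗ[S] QS := (LinearMap.range fS).mkQ
    have hgs : Function.Surjective gS := Submodule.mkQ_surjective _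
    have hex : Function.Exact fS gS := ses_range fS
    let f : N →ₗ[R] J := fS.restrictScalars R
    let g : J →ₗ[R] QS := gS.restrictScalars R
    have hgs2 : Function.Surjective g := hgs
    have hex2 : Function.Exact f g := hex
    have main : ∃ e : LC a i QS ≃+ LC (a.map (algebraMap R S)) i QS,
      (∀ (r : R) x, e (r • x) = algebraMap R S r • e x) ∧
      (∀ x, LCδ a i f g hex2 hf hgs2 x = 0 ↔ LCδ (a.map (algebraMap R S)) i fS gS hex hf hgs (e x) = 0) := by
      cases i with
      | zero =>
        obtain ⟨e, he⟩ := E6_zero (R := R) (S := S) (a := a) QS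
        refine ⟨e, fun r x => LC0fun_inj ?_, fun x => ?_⟩
        · rw [he, map_smul, map_smul, he, algebraMap_smul]
        · rw [LC_exact3 f g hex2 hf hgs2 x, LC_exact3 fS gS hex hf hgs (e x), LC0_range_iff, LC0_range_iff, he]
          simp only [Gam_restrict (R := R) (S := S)]
          rfl
      | succ i =>
        obtain ⟨e, he⟩ := ih QS
        refine ⟨e, he, fun x => ?_⟩
        rw [LC_exact3 f g hex2 hf hgs2 x, LC_exact3 fS gS hex hf hgs (e x)]
        constructor
        · rintro ⟨y, rfl⟩
          exact ⟨0, by rw [acyE6 (S := S) J i y]; simp⟩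
        · rintro ⟨y, hy⟩
          refine ⟨0, e.injective ?_⟩
          rw [← hy, LC_inj_vanish y]; simp
    obtain ⟨e, he1, he2⟩ := main
    have hs1 : Function.Surjective (LCδ a i f g hex2 hf hgs2) :=
      LC_surj_δ f g hex2 hf hgs2 (acyE6 (S := S) J i)
    obtain ⟨e', he'⟩ := induced_addEquiv (LCδ a i f g hex2 hf hgs2).toAddMonoidHom
      (LCδ (a.map (algebraMap R S)) i fS gS hex hf hgs).toAddMonoidHom hs1
      (LC_surj_δ fS gS hex hf hgs (fun x => LC_inj_vanish x)) e he2
    refine ⟨e', fun r x => ?_⟩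
    obtain ⟨x, rfl⟩ := hs1 x
    have h1 : ∀ x, e' (LCδ a i f g hex2 hf hgs2 x) = LCδ (a.map (algebraMap R S)) i fS gS hex hf hgs (e x) := he'
    rw [← map_smul, h1, he1, map_smul, h1]

lemma E6_vanish_iff (i : ℕ) (N : Type) [AddCommGroup N] [Module R N] [Module S N] [IsScalarTower R S N] :
    LCv a i N ↔ LCv (a.map (algebraMap R S)) i N := by
  obtain ⟨e, _⟩ := E6 (R := R) (S := S) (a := a) i N
  constructor
  · intro h x; rw [← e.apply_symm_apply x, h (e.symm x), map_zero]
  · intro h x; rw [← e.symm_apply_apply x, h (e x), map_zero]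

lemma E6_kill_iff (i : ℕ) (N : Type) [AddCommGroup N] [Module R N] [Module S N] [IsScalarTower R S N] (r : R) :
    (∀ x : LC a i N, r • x = 0) ↔ ∀ x : LC (a.map (algebraMap R S)) i N, algebraMap R S r • x = 0 := by
  obtain ⟨e, he⟩ := E6 (R := R) (S := S) (a := a) i N
  constructor
  · intro h x; rw [← e.apply_symm_apply x, ← he, h, map_zero]
  · intro h x
    apply e.injective
    rw [he, h, map_zero]

end E6

section E7
open TensorProduct
variable {R S : Type} [CommRing R] [CommRing S] [IsNoetherianRing R] [Algebra R S] [Module.Flat R S]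
variable {a : Ideal R}

lemma smul_bij_tensor {N : Type} [AddCommGroup N] [Module R N] (y : R) (hb : Function.Bijective (fun x : N => y • x)) :
    Function.Bijective (fun x : S ⊗[R] N => y • x) := by
  let e : N ≃ₗ[R] N := LinearEquiv.ofBijective (y • LinearMap.id) hb
  have : (fun x : S ⊗[R] N => y • x) = (TensorProduct.congr (LinearEquiv.refl R S) e) := by
    ext x
    induction x with
    | zero => simp
    | tmul s n => simp [e]
    | add x z hx hz => simp only [map_add, ← hx, ← hz, smul_add]
  rw [this]
  exact LinearEquiv.bijective _

lemma acyE7 (J : Type) [AddCommGroup J] [Module R J] [Module.Injective R J]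
    (i : ℕ) : LCv a (i+1) (S ⊗[R] J) := by
  refine acy (fun K _ _ => ∃ (J : Type) (_ : AddCommGroup J) (_ : Module R J) (_ : Module.Injective R J),
    Nonempty (K ≃ₗ[R] S ⊗[R] J)) ?_ _ ⟨J, inferInstance, inferInstance, inferInstance, ⟨LinearEquiv.refl _ _⟩⟩ i
  rintro K _ _ ⟨J, _, _, _, ⟨e⟩⟩ y hy
  let G := Gam (Ideal.span {y}) J
  let f : S ⊗[R] G →ₗ[R] K := e.symm.toLinearMap ∘ₗ LinearMap.lTensor S G.subtype
  let g : K →ₗ[R] S ⊗[R] (J ⧸ G) := LinearMap.lTensor S G.mkQ ∘ₗ e.toLinearMap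
  have hex := lTensor_exact S (ses_sub G) (Submodule.mkQ_surjective G)
  have hfg : Function.Exact f g := by
    intro x
    constructor
    · intro hx
      obtain ⟨z, hz⟩ := (hex (e x)).1 hx
      exact ⟨z, by simp [f, hz]⟩
    · rintro ⟨z, rfl⟩
      simp only [f, g, LinearMap.comp_apply, LinearEquiv.coe_coe, LinearEquiv.apply_symm_apply]
      exact hex.apply_apply_eq_zero z
  have hg : Function.Surjective g := (LinearMap.lTensor_surjective S (Submodule.mkQ_surjective G)).comp e.surjective
  refine ⟨S ⊗[R] G, inferInstance, inferInstance, f, ⟨G, inferInstance, inferInstance, Gam_inj J _,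
    ⟨LinearEquiv.refl _ _⟩⟩, ?_, ?_, bij_range_of_exact f g hfg hg y
      (smul_bij_tensor y (inj_mod_bij J y))⟩
  · exact e.symm.injective.comp (Module.Flat.lTensor_preserves_injective_linearMap _ Subtype.val_injective)
  · intro x
    induction x with
    | zero => exact ⟨0, by simp⟩
    | tmul s n =>
      obtain ⟨k, hk⟩ := Gam_span_mem.1 n.2
      refine ⟨k, ?_⟩
      have : y ^ k • n = 0 := Subtype.ext hk
      rw [← TensorProduct.tmul_smul, this, TensorProduct.tmul_zero]
    | add x z hx hz =>
      obtain ⟨k, hk⟩ := hx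
      obtain ⟨l, hl⟩ := hz
      refine ⟨k + l, ?_⟩
      rw [smul_add, pow_add, mul_smul, mul_smul, hl, smul_comm, hk]; simp

lemma tensor_nzd {Q : Type} [AddCommGroup Q] [Module R Q] (h : ∀ q : Q, (∀ r ∈ a, r • q = 0) → q = 0)
    (w : S ⊗[R] Q) (hw : ∀ r ∈ a, r • w = 0) : w = 0 := by
  classical
  obtain ⟨s, hs⟩ := (IsNoetherian.noetherian a : a.FG)
  let φ : Q →ₗ[R] (s → Q) := LinearMap.pi (fun y => (y : R) • LinearMap.id)
  have hφ : Function.Injective φ := by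
    rw [injective_iff_map_eq_zero]
    intro q hq
    apply h
    intro r hr
    rw [← hs] at hr
    have : (Submodule.span R (s : Set R)) ≤ LinearMap.ker (LinearMap.toSpanSingleton R Q q) := by
      rw [Submodule.span_le]
      intro y hy
      exact congrFun hq ⟨y, hy⟩
    exact this hr
  have h2 := Module.Flat.lTensor_preserves_injective_linearMap (M := S) φ hφ
  apply h2
  apply (TensorProduct.piRight R R S (fun _ : s => Q)).injective
  rw [map_zero, map_zero]
  ext y
  have : ∀ w : S ⊗[R] Q, TensorProduct.piRight R R S (fun _ : s => Q) (LinearMap.lTensor S φ w) y = (y : R) • w := by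
    intro w
    induction w with
    | zero => simp
    | tmul s n => simp [φ]
    | add x z hx hz => simp only [map_add, Pi.add_apply, hx, hz, smul_add]
  rw [this]
  exact hw y (hs ▸ Submodule.subset_span y.2)

lemma tensor_nzd_pow {Q : Type} [AddCommGroup Q] [Module R Q] (h : ∀ q : Q, (∀ r ∈ a, r • q = 0) → q = 0)
    (n : ℕ) (w : S ⊗[R] Q) (hw : ∀ r ∈ a ^ n, r • w = 0) : w = 0 := by
  induction n with
  | zero => simpa using hw 1 (by simp)
  | succ n ih =>
    apply ih
    intro r hr
    apply tensor_nzd h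
    intro t ht
    rw [smul_smul]
    apply hw
    rw [pow_succ']
    exact Ideal.mul_mem_mul ht hr

lemma Gam_quot_zero {N : Type} [AddCommGroup N] [Module R N] (q : N ⧸ Gam a N) (hq : ∀ r ∈ a, r • q = 0) : q = 0 := by
  obtain ⟨x, rfl⟩ := Submodule.mkQ_surjective _ q
  obtain ⟨s, hs⟩ := (IsNoetherian.noetherian a : a.FG)
  rw [Submodule.mkQ_apply, Submodule.Quotient.mk_eq_zero]
  have h1 : ∀ r ∈ a, ∃ n, ∀ t ∈ a ^ n, t • r • x = 0 := by
    intro r hr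
    have := hq r hr
    rw [← map_smul, Submodule.mkQ_apply, Submodule.Quotient.mk_eq_zero] at this
    exact this
  choose! n hn using h1
  let m := s.sup n
  refine ⟨m + 1, fun r hr => ?_⟩
  have : a ^ (m+1) ≤ LinearMap.ker (LinearMap.toSpanSingleton R N x) := by
    rw [pow_succ, Ideal.mul_le]
    intro t ht r hr
    have h3 : a ≤ LinearMap.ker (LinearMap.toSpanSingleton R N (t • x)) := by
      conv_lhs => rw [← hs]
      rw [Submodule.span_le]
      intro y hy
      change y • t • x = 0
      rw [smul_comm]
      exact hn y (hs ▸ Submodule.subset_span hy) t (Ideal.pow_le_pow_right (Finset.le_sup hy) ht)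
    have h4 : r • t • x = 0 := h3 hr
    change (t * r) • x = 0
    rw [mul_comm, mul_smul, h4]
  exact this hr

lemma Gam_tensor {N : Type} [AddCommGroup N] [Module R N] (z : S ⊗[R] N) :
    z ∈ Gam a (S ⊗[R] N) ↔ z ∈ Set.range (LinearMap.lTensor S (Gam a N).subtype) := by
  have hex := lTensor_exact S (ses_sub (Gam a N)) (Submodule.mkQ_surjective _)
  constructor
  · rintro ⟨n, hn⟩
    rw [← hex z]
    apply tensor_nzd_pow (a := a) Gam_quot_zero n
    intro r hr
    rw [← map_smul, hn r hr, map_zero]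
  · rintro ⟨w, rfl⟩
    induction w with
    | zero => simp
    | tmul s x =>
      obtain ⟨n, hn⟩ := x.2
      refine ⟨n, fun r hr => ?_⟩
      rw [LinearMap.lTensor_tmul, ← TensorProduct.tmul_smul, Submodule.subtype_apply, hn r hr, TensorProduct.tmul_zero]
    | add x y hx hy => rw [map_add]; exact Submodule.add_mem _ hx hy

lemma LC0fun_tensor_range {N : Type} [AddCommGroup N] [Module R N] (z : S ⊗[R] N) :
    z ∈ Set.range (LinearMap.lTensor S (LC0fun a N)) ↔ z ∈ Gam a (S ⊗[R] N) := by
  rw [Gam_tensor]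
  let p : LC a 0 N →ₗ[R] Gam a N := LinearMap.codRestrict _ (LC0fun a N) (fun x => (LC0fun_range _).1 ⟨x, rfl⟩)
  have hp : Function.Surjective p := by
    intro x
    obtain ⟨y, hy⟩ := (LC0fun_range _).2 x.2
    exact ⟨y, Subtype.ext hy⟩
  have h1 : LC0fun a N = (Gam a N).subtype ∘ₗ p := rfl
  rw [h1, LinearMap.lTensor_comp, LinearMap.coe_comp, Set.range_comp,
    (LinearMap.lTensor_surjective S hp).range_eq, Set.image_univ]

lemma E7_zero (N : Type) [AddCommGroup N] [Module R N] :
    ∃ e : (S ⊗[R] LC a 0 N) ≃+ LC a 0 (S ⊗[R] N),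
      (∀ (r : R) x, e (r • x) = r • e x) ∧ ∀ x, LC0fun a _ (e x) = LinearMap.lTensor S (LC0fun a N) x := by
  have h1 : ∀ x : S ⊗[R] LC a 0 N, ∃ y, LC0fun a (S ⊗[R] N) y = LinearMap.lTensor S (LC0fun a N) x := fun x =>
    (LC0fun_range _).2 ((LC0fun_tensor_range _).1 ⟨x, rfl⟩)
  choose e he using h1
  have hadd : ∀ x y, e (x + y) = e x + e y := fun x y => LC0fun_inj (by simp [he])
  have hb : Function.Bijective e := by
    constructor
    · intro x y h
      apply Module.Flat.lTensor_preserves_injective_linearMap (M := S) _ (LC0fun_inj (a := a) (N := N))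
      rw [← he, ← he, h]
    · intro y
      obtain ⟨x, hx⟩ := (LC0fun_tensor_range (a := a) _).2 ((LC0fun_range _).1 ⟨y, rfl⟩)
      exact ⟨x, LC0fun_inj (by rw [he, hx])⟩
  exact ⟨AddEquiv.ofBijective (⟨⟨e, LC0fun_inj (by rw [he, map_zero, map_zero])⟩, hadd⟩ : _ →+ _) hb, fun r x =>
    LC0fun_inj (by
      change LC0fun a _ (e _) = LC0fun a _ (r • e _)
      rw [he, map_smul, map_smul, he]), he⟩

lemma E7 (i : ℕ) (N : Type) [AddCommGroup N] [Module R N] :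
    ∃ e : (S ⊗[R] LC a i N) ≃+ LC a i (S ⊗[R] N), ∀ (r : R) x, e (r • x) = r • e x := by
  induction i generalizing N with
  | zero =>
    obtain ⟨e, he, _⟩ := E7_zero (R := R) (S := S) (a := a) N
    exact ⟨e, he⟩
  | succ i ih =>
    obtain ⟨J, _, _, _, f, hf⟩ := exists_inj_embed R N
    let Q := J ⧸ LinearMap.range f
    let g : J →ₗ[R] Q := (LinearMap.range f).mkQ
    have hgs : Function.Surjective g := Submodule.mkQ_surjective _
    have hex : Function.Exact f g := ses_range f
    let fS := LinearMap.lTensor S f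
    let gS := LinearMap.lTensor S g
    have hfS : Function.Injective fS := Module.Flat.lTensor_preserves_injective_linearMap _ hf
    have hgsS : Function.Surjective gS := LinearMap.lTensor_surjective S hgs
    have hexS : Function.Exact fS gS := lTensor_exact S hex hgs
    let d := LinearMap.lTensor S (LCδ a i f g hex hf hgs)
    have hδ : Function.Surjective (LCδ a i f g hex hf hgs) := LC_surj_δ f g hex hf hgs (fun x => LC_inj_vanish x)
    have hd : Function.Surjective d := LinearMap.lTensor_surjective S hδ
    have hdex : Function.Exact (LinearMap.lTensor S (LCmap a i g)) d := lTensor_exact S (LC_exact3 f g hex hf hgs) hδ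
    have main : ∃ e : (S ⊗[R] LC a i Q) ≃+ LC a i (S ⊗[R] Q),
      (∀ (r : R) x, e (r • x) = r • e x) ∧
      (∀ x, d x = 0 ↔ LCδ a i fS gS hexS hfS hgsS (e x) = 0) := by
      cases i with
      | zero =>
        obtain ⟨e, he, he2⟩ := E7_zero (R := R) (S := S) (a := a) Q
        refine ⟨e, he, fun x => ?_⟩
        rw [hdex x, LC_exact3 fS gS hexS hfS hgsS (e x), LC0_range_iff]
        have hnat : ∀ y, gS (LinearMap.lTensor S (LC0fun a J) y) =
            LinearMap.lTensor S (LC0fun a Q) (LinearMap.lTensor S (LCmap a 0 g) y) := by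
          intro y
          have : g ∘ₗ LC0fun a J = LC0fun a Q ∘ₗ LCmap a 0 g := by
            exact LinearMap.ext fun y => (LC0fun_nat g y).symm
          change (LinearMap.lTensor S g ∘ₗ LinearMap.lTensor S (LC0fun a J)) y =
            (LinearMap.lTensor S (LC0fun a Q) ∘ₗ LinearMap.lTensor S (LCmap a 0 g)) y
          rw [← LinearMap.lTensor_comp, ← LinearMap.lTensor_comp, this]
        constructor
        · rintro ⟨y, rfl⟩
          refine ⟨LinearMap.lTensor S (LC0fun a J) y, (LC0fun_tensor_range _).1 ⟨y, rfl⟩, ?_⟩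
          rw [he2, hnat]
        · rintro ⟨z, hz, h⟩
          obtain ⟨y, rfl⟩ := (LC0fun_tensor_range _).2 hz
          refine ⟨y, ?_⟩
          apply Module.Flat.lTensor_preserves_injective_linearMap (M := S) _ (LC0fun_inj (a := a) (N := Q))
          rw [← hnat, h, he2]
      | succ i =>
        obtain ⟨e, he⟩ := ih Q
        refine ⟨e, he, fun x => ?_⟩
        rw [hdex x, LC_exact3 fS gS hexS hfS hgsS (e x)]
        have h0 : LCmap a (i+1) g = 0 := by
          refine LinearMap.ext fun x => ?_
          rw [LC_inj_vanish x, map_zero, map_zero]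
        constructor
        · rintro ⟨y, rfl⟩
          exact ⟨0, by rw [h0]; simp⟩
        · rintro ⟨y, hy⟩
          refine ⟨0, e.injective ?_⟩
          rw [← hy, acyE7 J i y]; simp
    obtain ⟨e, he1, he2⟩ := main
    obtain ⟨e', he'⟩ := induced_addEquiv d.toAddMonoidHom
      (LCδ a i fS gS hexS hfS hgsS).toAddMonoidHom hd
      (LC_surj_δ fS gS hexS hfS hgsS (acyE7 J i)) e he2
    refine ⟨e', fun r x => ?_⟩
    obtain ⟨x, rfl⟩ := hd x
    have h1 : ∀ x, e' (d x) = LCδ a i fS gS hexS hfS hgsS (e x) := he'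
    have h2 : r • d x = d (r • x) := (d.map_smul r x).symm
    have h3 : LCδ a i fS gS hexS hfS hgsS (r • e x) = r • LCδ a i fS gS hexS hfS hgsS (e x) :=
      (LCδ a i fS gS hexS hfS hgsS).map_smul r (e x)
    exact (congrArg e' h2).trans ((h1 _).trans ((congrArg _ (he1 r x)).trans
      (h3.trans (congrArg (fun z => r • z) (h1 x).symm))))

end E7
end LCaux

open CategoryTheory
namespace LCaux
open Opposite Limits

section dim
variable {R : Type} [CommRing R] [IsNoetherianRing R] {a : Ideal R} {i : ℕ}
variable {N N' N'' : Type} [AddCommGroup N] [Module R N] [AddCommGroup N'] [Module R N']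
  [AddCommGroup N''] [Module R N'']

lemma LCv_subsing [Subsingleton N] : LCv a i N := by
  intro x
  rw [← LCmap_id x, show (LinearMap.id : N →ₗ[R] N) = 0 from Subsingleton.elim _ _, LCmap_zero]

lemma LC_smul_inj_vanish (y : R) (hy : y ∈ a) (hinj : ∀ x : LC a i N, y • x = 0 → x = 0) : LCv a i N := by
  intro x
  obtain ⟨n, hn⟩ := LC_torsion x
  have := hn (y ^ n) (Ideal.pow_mem_pow hy n)
  clear hn
  induction n with
  | zero => simpa using this
  | succ n ih =>
    apply ih
    apply hinj
    rw [smul_smul, ← pow_succ', this]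

lemma ann_le_of_inj (f : N →ₗ[R] N') (hf : Function.Injective f) :
    Module.annihilator R N' ≤ Module.annihilator R N := f.annihilator_le_of_injective hf

lemma ann_le_of_surj (f : N →ₗ[R] N') (hf : Function.Surjective f) :
    Module.annihilator R N ≤ Module.annihilator R N' := f.annihilator_le_of_surjective hf

lemma LCv_of_primes [Module.Finite R N]
    (h : ∀ P : Ideal R, P.IsPrime → Module.annihilator R N ≤ P → LCv a i (R ⧸ P)) : LCv a i N := by
  revert h
  induction ‹Module.Finite R N› using IsNoetherianRing.induction_on_isQuotientEquivQuotientPrime R with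
  | subsingleton N => exact fun _ => LCv_subsing
  | quotient N p f =>
    intro h
    refine LCv_equiv f.symm (h p.1 p.2 ?_)
    rw [f.annihilator_eq, Ideal.annihilator_quotient]
  | exact N₁ N₂ N₃ f g hf hg hfg h₁ h₃ =>
    intro h
    exact LCv_mid f g hfg hf hg (h₁ fun P hP hle => h P hP ((ann_le_of_inj f hf).trans hle))
      (h₃ fun P hP hle => h P hP ((ann_le_of_surj g hg).trans hle))

lemma dim_mono {I I' : Ideal R} (h : I ≤ I') : ringKrullDim (R ⧸ I') ≤ ringKrullDim (R ⧸ I) :=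
  ringKrullDim_le_of_surjective (Ideal.Quotient.factor h) (Ideal.Quotient.factor_surjective h)

lemma dim_drop {P I : Ideal R} (hP : P.IsPrime) {y : R} (hy : y ∉ P) (hI : P ≤ I) (hyI : y ∈ I) {n : ℕ}
    (h : ringKrullDim (R ⧸ P) < (n + 1 : ℕ)) : ringKrullDim (R ⧸ I) < (n : ℕ) := by
  have := ringKrullDim_succ_le_of_surjective (Ideal.Quotient.factor hI) (Ideal.Quotient.factor_surjective hI)
    (r := Ideal.Quotient.mk P y) (mem_nonZeroDivisors_of_ne_zero (by rwa [Ne, Ideal.Quotient.eq_zero_iff_mem]))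
    (by rw [Ideal.Quotient.factor_mk, Ideal.Quotient.eq_zero_iff_mem]; exact hyI)
  have h2 := this.trans_lt h
  generalize ringKrullDim (R ⧸ I) = d at h2
  cases d with
  | bot => exact WithBot.bot_lt_coe _
  | coe d =>
    have h3 : d + 1 < ((n + 1 : ℕ) : ℕ∞) := by exact_mod_cast h2
    cases d with
    | top => simp at h3
    | coe d =>
      have h4 : d + 1 < n + 1 := by exact_mod_cast h3
      have h5 : d < n := by omega
      exact_mod_cast h5

lemma smul_exact (P : Ideal R) (hP : P.IsPrime) (y : R) (hy : y ∉ P) :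
    Function.Injective (y • (LinearMap.id : (R ⧸ P) →ₗ[R] (R ⧸ P))) := by
  rw [injective_iff_map_eq_zero]
  intro x hx
  obtain ⟨x, rfl⟩ := Ideal.Quotient.mk_surjective x
  have hx : Ideal.Quotient.mk P (y * x) = 0 := hx
  rw [Ideal.Quotient.eq_zero_iff_mem] at hx ⊢
  exact (hP.mem_or_mem hx).resolve_left hy

lemma smul_coker_ann (y : R) :
    y ∈ Module.annihilator R (N ⧸ LinearMap.range (y • (LinearMap.id : N →ₗ[R] N))) := by
  rw [Module.mem_annihilator]
  intro x
  obtain ⟨x, rfl⟩ := Submodule.mkQ_surjective _ x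
  rw [← map_smul, Submodule.mkQ_apply, Submodule.Quotient.mk_eq_zero]
  exact ⟨x, rfl⟩

/-- Grothendieck vanishing -/
lemma Gvanish (n : ℕ) : ∀ (N : Type) [AddCommGroup N] [Module R N] [Module.Finite R N],
    ringKrullDim (R ⧸ Module.annihilator R N) < (n : ℕ) → ∀ i, n ≤ i → LCv a i N := by
  induction n with
  | zero =>
    intro N _ _ _ h i _
    have h1 : Subsingleton (R ⧸ Module.annihilator R N) := by
      by_contra hc
      rw [not_subsingleton_iff_nontrivial] at hc
      exact absurd h (not_lt.2 (by exact_mod_cast ringKrullDim_nonneg_of_nontrivial))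
    rw [Ideal.Quotient.subsingleton_iff, Module.annihilator_eq_top_iff] at h1
    exact LCv_subsing
  | succ n ih =>
    intro N _ _ _ h i hi
    obtain ⟨i, rfl⟩ : ∃ j, i = j + 1 := ⟨i - 1, by omega⟩
    apply LCv_of_primes
    intro P hP hle
    have hPd := (dim_mono hle).trans_lt h
    by_cases hap : a ≤ P
    · apply LC_tors_vanish
      intro x
      refine ⟨1, fun r hr => ?_⟩
      obtain ⟨x, rfl⟩ := Ideal.Quotient.mk_surjective x
      change Ideal.Quotient.mk P (r * x) = 0
      rw [Ideal.Quotient.eq_zero_iff_mem]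
      exact P.mul_mem_right _ (hap (by simpa using hr))
    · obtain ⟨y, hya, hyP⟩ := SetLike.not_le_iff_exists.1 hap
      apply LC_smul_inj_vanish y hya
      intro x hx
      rw [← LCmap_smul_id] at hx
      have hin := smul_exact P hP y hyP
      obtain ⟨z, rfl⟩ := (LC_exact1 _ _ (ses_range (y • (LinearMap.id : (R ⧸ P) →ₗ[R] (R ⧸ P)))) hin
        (Submodule.mkQ_surjective _) x).1 hx
      rw [ih (_ ⧸ LinearMap.range (y • (LinearMap.id : (R ⧸ P) →ₗ[R] (R ⧸ P)))) ?_ i (by omega) z, map_zero]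
      refine dim_drop hP hyP ?_ (smul_coker_ann y) hPd
      refine le_trans ?_ (ann_le_of_surj (Submodule.mkQ _) (Submodule.mkQ_surjective _))
      rw [Ideal.annihilator_quotient]

lemma exists_nonzero_hom [Module.Finite R N] (P : Ideal R) [hP : P.IsPrime] (h : Module.annihilator R N ≤ P) :
    ∃ f : N →ₗ[R] (R ⧸ P), f ≠ 0 := by
  let p : PrimeSpectrum R := ⟨P, hP⟩
  have h1 : p ∈ Module.support R N := by
    rw [Module.support_eq_zeroLocus]; exact h
  rw [Module.mem_support_iff_nontrivial_residueField_tensorProduct] at h1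
  let K := P.ResidueField
  have h1 : Nontrivial (TensorProduct R K N) := h1
  obtain ⟨v, hv⟩ := exists_ne (0 : TensorProduct R K N)
  obtain ⟨φ, hφ⟩ : ∃ φ : Module.Dual K (TensorProduct R K N), φ v ≠ 0 := by
    by_contra hc
    push Not at hc
    exact hv ((Module.forall_dual_apply_eq_zero_iff K v).1 hc)
  let f0 : N →ₗ[R] K := (φ.restrictScalars R) ∘ₗ (TensorProduct.mk R K N 1)
  have hf0 : f0 ≠ 0 := by
    intro hc
    apply hφ
    have : ∀ w : TensorProduct R K N, φ w = 0 := by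
      intro w
      induction w with
      | zero => simp
      | tmul s n =>
        have h2 : φ ((1 : K) ⊗ₜ[R] n) = 0 := congrArg (fun z => z n) hc
        have h3 : s ⊗ₜ[R] n = s • ((1 : K) ⊗ₜ[R] n) := by rw [TensorProduct.smul_tmul', smul_eq_mul, mul_one]
        rw [h3, map_smul, h2, smul_zero]
      | add x z hx hz => rw [map_add, hx, hz, add_zero]
    exact this v
  classical
  obtain ⟨s, hs⟩ := (Module.Finite.fg_top : (⊤ : Submodule R N).FG)
  obtain ⟨b, hb⟩ := IsLocalization.exist_integer_multiples_of_finset (nonZeroDivisors (R ⧸ P)) (s.image f0)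
  let ι : (R ⧸ P) →ₗ[R] K := (Algebra.linearMap (R ⧸ P) K).restrictScalars R
  have hι : Function.Injective ι := IsFractionRing.injective (R ⧸ P) K
  obtain ⟨b', hb'⟩ := Ideal.Quotient.mk_surjective (b : R ⧸ P)
  have hbs : ∀ z : K, (b : R ⧸ P) • z = b' • z := by
    intro z
    rw [← hb']
    exact algebraMap_smul (R ⧸ P) b' z
  have hrange : ∀ n, b' • f0 n ∈ LinearMap.range ι := by
    intro n
    have : n ∈ Submodule.span R (s : Set N) := by rw [hs]; trivial
    have h4 : Submodule.span R (s : Set N) ≤ (LinearMap.range ι).comap (b' • f0) := by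
      rw [Submodule.span_le]
      intro x hx
      obtain ⟨y, hy⟩ := hb (f0 x) (Finset.mem_image_of_mem _ hx)
      refine ⟨y, ?_⟩
      change algebraMap (R ⧸ P) K y = b' • f0 x
      rw [hy, hbs]
    exact h4 this
  let e := LinearEquiv.ofInjective ι hι
  refine ⟨e.symm.toLinearMap ∘ₗ LinearMap.codRestrict _ (b' • f0) hrange, fun hc => hf0 ?_⟩
  ext n
  have h5 := congrArg (fun z => z n) hc
  have h6 : e.symm (LinearMap.codRestrict _ (b' • f0) hrange n) = 0 := h5
  rw [LinearEquiv.map_eq_zero_iff] at h6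
  have h7 : b' • f0 n = 0 := congrArg Subtype.val h6
  rw [← hbs, Algebra.smul_def, mul_eq_zero] at h7
  refine h7.resolve_left fun h8 => ?_
  have := IsFractionRing.injective (R ⧸ P) K (h8.trans (map_zero _).symm)
  exact nonZeroDivisors.ne_zero b.2 this

/-- N' -/
lemma vanish_of_kill [Module.Finite R N] (P : Ideal R) (hP : P.IsPrime) (h : Module.annihilator R N ≤ P)
    (c : ℕ) (hd : ringKrullDim (R ⧸ Module.annihilator R N) < (c + 1 : ℕ)) (d : R) (hdP : d ∉ P)
    (hk : ∀ x : LC a c N, d • x = 0) : LCv a c (R ⧸ P) := by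
  obtain ⟨f, hf⟩ := exists_nonzero_hom (N := N) P h
  have hPd := (dim_mono h).trans_lt hd
  let I := LinearMap.range f
  have h1 : Function.Surjective (LCmap a c f.rangeRestrict) := by
    refine LC_surj_right (LinearMap.ker f).subtype f.rangeRestrict ?_ Subtype.val_injective
      f.surjective_rangeRestrict ?_
    · rw [LinearMap.exact_iff, LinearMap.ker_rangeRestrict, Submodule.range_subtype]
    · exact Gvanish (c+1) _ ((dim_mono (ann_le_of_inj (LinearMap.ker f).subtype Subtype.val_injective)).trans_lt hd) _ le_rfl
  have h2 : ∀ x : LC a c I, d • x = 0 := by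
    intro x
    obtain ⟨x, rfl⟩ := h1 x
    rw [← map_smul, hk, map_zero]
  have hPI : P ≤ Module.annihilator R I := by
    refine le_trans ?_ (ann_le_of_inj I.subtype Subtype.val_injective)
    rw [Ideal.annihilator_quotient]
  have h3 : Function.Injective (d • (LinearMap.id : I →ₗ[R] I)) := by
    intro x y hxy
    exact Subtype.ext (smul_exact P hP d hdP (congrArg Subtype.val hxy))
  have h4 : Function.Surjective (LCmap a c (d • (LinearMap.id : I →ₗ[R] I))) := by
    refine LC_surj_left _ _ (ses_range _) h3 (Submodule.mkQ_surjective _) (Gvanish c _ ?_ _ le_rfl)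
    exact dim_drop hP hdP (hPI.trans (ann_le_of_surj (Submodule.mkQ _) (Submodule.mkQ_surjective _)))
      (smul_coker_ann d) hPd
  have h5 : LCv a c I := by
    intro x
    obtain ⟨x, rfl⟩ := h4 x
    rw [LCmap_smul_id, h2]
  have h6 : Function.Surjective (LCmap a c I.subtype) := by
    refine LC_surj_left _ _ (ses_sub I) Subtype.val_injective (Submodule.mkQ_surjective _) (Gvanish c _ ?_ _ le_rfl)
    obtain ⟨n, hn⟩ : ∃ n, f n ≠ 0 := by
      by_contra hc
      push Not at hc
      exact hf (LinearMap.ext hc)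
    obtain ⟨y, hy⟩ := Ideal.Quotient.mk_surjective (f n)
    refine dim_drop hP (y := y) ?_ ?_ ?_ hPd
    · intro hyP
      exact hn (by rw [← hy, Ideal.Quotient.eq_zero_iff_mem.2 hyP])
    · refine le_trans ?_ (ann_le_of_surj (Submodule.mkQ _) (Submodule.mkQ_surjective _))
      rw [Ideal.annihilator_quotient]
    · rw [Module.mem_annihilator]
      intro x
      obtain ⟨x, rfl⟩ := Submodule.mkQ_surjective _ x
      obtain ⟨x, rfl⟩ := Ideal.Quotient.mk_surjective x
      rw [← map_smul, Submodule.mkQ_apply, Submodule.Quotient.mk_eq_zero]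
      have : y • Ideal.Quotient.mk P x = x • f n := by
        rw [← hy]
        change Ideal.Quotient.mk P (y * x) = Ideal.Quotient.mk P (x * y)
        rw [mul_comm]
      rw [this]
      exact I.smul_mem _ ⟨n, rfl⟩
  intro x
  obtain ⟨x, rfl⟩ := h6 x
  rw [h5 x, map_zero]

/-- surjectivity of top cohomology -/
lemma top_surj [Module.Finite R N] (c : ℕ) (hd : ringKrullDim (R ⧸ Module.annihilator R N) < (c + 1 : ℕ))
    (g : N →ₗ[R] N') (hg : Function.Surjective g) : Function.Surjective (LCmap a c g) := by
  refine LC_surj_right (LinearMap.ker g).subtype g ?_ Subtype.val_injective hg ?_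
  · rw [LinearMap.exact_iff, Submodule.range_subtype]
  · exact Gvanish (c+1) _ ((dim_mono (ann_le_of_inj (LinearMap.ker g).subtype Subtype.val_injective)).trans_lt hd) _ le_rfl

/-- Claim A -/
lemma claimA [Module.Finite R N] (c : ℕ) (hd : ringKrullDim (R ⧸ Module.annihilator R N) < (c + 1 : ℕ))
    (m : ℕ) (q p : Fin m → Ideal R) (hrad : ∀ i, (q i).radical = p i)
    (hdec : Module.annihilator R N = ⨅ i, q i) (x : R)
    (hx : ∀ i, ¬ LCv a c (R ⧸ p i) → x ∈ q i) (b : LC a c N) : x • b = 0 := by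
  let g : N →ₗ[R] N := x • LinearMap.id
  let L := LinearMap.range g
  have hL : LCv a c L := by
    apply LCv_of_primes
    intro P hP hle
    have h1 : (⨅ i, ⨅ (_ : LCv a c (R ⧸ p i)), q i) ≤ P := by
      refine le_trans ?_ hle
      intro r hr
      rw [Module.mem_annihilator]
      rintro ⟨_, n, rfl⟩
      apply Subtype.ext
      change r • x • n = 0
      rw [smul_smul]
      have : r * x ∈ Module.annihilator R N := by
        rw [hdec, Ideal.mem_iInf]
        intro i
        by_cases hi : LCv a c (R ⧸ p i)
        · apply (q i).mul_mem_right
          simp only [Ideal.mem_iInf] at hr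
          exact hr i hi
        · exact (q i).mul_mem_left _ (hx i hi)
      exact Module.mem_annihilator.1 this n
    have h2 : ∃ i, LCv a c (R ⧸ p i) ∧ q i ≤ P := by
      classical
      let s : Finset (Fin m) := Finset.univ.filter (fun i => LCv a c (R ⧸ p i))
      have h3 : s.inf q ≤ P := by
        refine le_trans ?_ h1
        simp [Finset.inf_eq_iInf, s]
      obtain ⟨i, hi, h4⟩ := (Ideal.IsPrime.inf_le' hP).1 h3
      exact ⟨i, (Finset.mem_filter.1 hi).2, h4⟩
    obtain ⟨i, hi, hqP⟩ := h2
    have hpP : p i ≤ P := by rw [← hrad i]; exact hP.radical_le_iff.2 hqP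
    have hAp : Module.annihilator R N ≤ p i := by
      rw [hdec]; exact (iInf_le q i).trans (by rw [← hrad i]; exact Ideal.le_radical)
    have := top_surj (a := a) (N := R ⧸ p i) (N' := R ⧸ P) c (by
      rw [Ideal.annihilator_quotient]; exact (dim_mono hAp).trans_lt hd)
      (Submodule.factor hpP) (Submodule.factor_surjective hpP)
    intro z
    obtain ⟨z, rfl⟩ := this z
    rw [hi z, map_zero]
  rw [← LCmap_smul_id, show (x • LinearMap.id : N →ₗ[R] N) = L.subtype ∘ₗ g.rangeRestrict from rfl, LCmap_comp,
    hL (LCmap a c g.rangeRestrict b), map_zero]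

end dim
end LCaux

open CategoryTheory
namespace LCaux
open Opposite Limits

theorem noeth_adic (R : Type) [CommRing R] [IsNoetherianRing R] (I : Ideal R) :
    IsNoetherianRing (AdicCompletion I R) := by
  obtain ⟨s, hs⟩ := (IsNoetherian.noetherian I : I.FG)
  let σ := {x // x ∈ s}
  let P := MvPolynomial σ R
  let J : Ideal P := MvPolynomial.idealOfVars σ R
  let f : P →+* R := (MvPolynomial.aeval (fun i : σ => (i : R)) : P →ₐ[R] R).toRingHom
  have hX (i : σ) : f (MvPolynomial.X i) = (i : R) := MvPolynomial.aeval_X _ _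
  have hC (r : R) : f (MvPolynomial.C r) = r := MvPolynomial.aeval_C _ _
  have hJf : J.map f = I := by
    show Ideal.map f (Ideal.span (Set.range MvPolynomial.X)) = I
    rw [Ideal.map_span, ← hs, ← Set.range_comp]
    congr 1
    ext x
    simp only [Set.mem_range, Function.comp_apply, hX]
    simp [σ]
  have hle (n : ℕ) : J ^ n ≤ (I ^ n).comap f := by
    rw [← Ideal.map_le_iff_le_comap, Ideal.map_pow, hJf]
  let F0 (n : ℕ) : AdicCompletion J P →+* R ⧸ I ^ n :=
    (Ideal.quotientMap (I ^ n) f (hle n)).comp (AdicCompletion.evalₐ J n : _ →ₐ[P] _).toRingHom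
  have hF0 : ∀ {m n : ℕ} (h : m ≤ n),
      (Ideal.Quotient.factorPow I h).comp (F0 n) = F0 m := by
    intro m n h
    ext x
    obtain ⟨y, rfl⟩ := AdicCompletion.mk_surjective J P x
    simp only [F0, AlgHom.toRingHom_eq_coe, RingHom.coe_comp, RingHom.coe_coe, Function.comp_apply,
      AdicCompletion.evalₐ_mk, Ideal.quotientMap_mk]
    have := AdicCompletion.Ideal.mk_eq_mk (I := J) h y
    show Ideal.Quotient.mk _ _ = Ideal.Quotient.mk _ _
    rw [Ideal.Quotient.eq, ← map_sub]
    apply hle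
    rwa [Ideal.Quotient.eq] at this
  let F := AdicCompletion.liftRingHom I F0 hF0
  have hFa : F.comp (algebraMap P (AdicCompletion J P)) = (algebraMap R (AdicCompletion I R)).comp f := by
    apply RingHom.ext
    intro x
    apply AdicCompletion.ext_evalₐ
    intro n
    rw [RingHom.comp_apply, AdicCompletion.evalₐ_liftRingHom]
    show Ideal.quotientMap (I ^ n) f (hle n) (AdicCompletion.evalₐ J n (algebraMap _ _ x)) =
      AdicCompletion.evalₐ I n (algebraMap _ _ (f x))
    rw [AlgHom.commutes, AlgHom.commutes]
    rfl
  have hmap : (J.map (algebraMap P (AdicCompletion J P))).map F = I.map (algebraMap R (AdicCompletion I R)) := by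
    rw [Ideal.map_map, hFa, ← Ideal.map_map, hJf]
  have : IsNoetherianRing (AdicCompletion J P) :=
    isNoetherianRing_of_ringEquiv (MvPowerSeries σ R)
      (MvPowerSeries.toAdicCompletionAlgEquiv σ R).toRingEquiv
  have := AdicCompletion.isAdicComplete_self J (MvPolynomial.idealOfVars_fg σ R)
  have := AdicCompletion.isAdicComplete_self I (IsNoetherian.noetherian I : I.FG)
  have : IsHausdorff ((J.map (algebraMap P (AdicCompletion J P))).map F) (AdicCompletion I R) := by
    rw [hmap]; infer_instance
  apply isNoetherianRing_of_surjective (AdicCompletion J P) _ F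
  apply surjective_of_mk_map_comp_surjective (I := J.map (algebraMap P (AdicCompletion J P)))
  intro y
  obtain ⟨y, rfl⟩ := Ideal.Quotient.mk_surjective y
  obtain ⟨r, hr⟩ := Ideal.Quotient.mk_surjective (AdicCompletion.evalOneₐ I y)
  refine ⟨algebraMap P _ (MvPolynomial.C r), ?_⟩
  rw [RingHom.comp_apply]
  rw [Ideal.Quotient.eq, hmap, ← AdicCompletion.ker_evalOneₐ_eq_map I (IsNoetherian.noetherian I : I.FG)]
  rw [← RingHom.comp_apply, hFa, RingHom.mem_ker, map_sub, RingHom.comp_apply]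
  show AdicCompletion.evalOneₐ I (algebraMap _ _ (f _)) - AdicCompletion.evalOneₐ I y = 0
  rw [AlgHom.commutes, ← hr, hC]
  exact sub_self _
end LCaux

open CategoryTheory
namespace LCaux
open Opposite Limits

section dims
variable {R S : Type} [CommRing R] [IsNoetherianRing R] [CommRing S] [IsNoetherianRing S]

lemma dim_loc (n : Ideal R) [n.IsPrime] (I : Ideal R) :
    ringKrullDim (Localization.AtPrime n ⧸ I.map (algebraMap R (Localization.AtPrime n))) ≤
      ringKrullDim (R ⧸ I) := by
  rw [ringKrullDim_quotient, ringKrullDim_quotient]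
  let f : PrimeSpectrum.zeroLocus (I.map (algebraMap R (Localization.AtPrime n)) : Set (Localization.AtPrime n)) →
    PrimeSpectrum.zeroLocus (I : Set R) := fun p => ⟨PrimeSpectrum.comap (algebraMap R _) p.1, by
      have := p.2
      rw [PrimeSpectrum.mem_zeroLocus, SetLike.coe_subset_coe] at this ⊢
      exact Ideal.map_le_iff_le_comap.1 this⟩
  refine Order.krullDim_le_of_strictMono f (Monotone.strictMono_of_injective ?_ ?_)
  · intro p q h
    exact Ideal.comap_mono (f := algebraMap R (Localization.AtPrime n)) h
  · intro p q h
    have h1 := congrArg Subtype.val h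
    exact Subtype.ext (PrimeSpectrum.localization_comap_injective _ n.primeCompl h1)

lemma pow_le_of_primes [IsLocalRing R] (I : Ideal R) (h : ∀ P : Ideal R, P.IsPrime → I ≤ P → P = IsLocalRing.maximalIdeal R) :
    ∃ k, IsLocalRing.maximalIdeal R ^ k ≤ I := by
  apply Ideal.exists_pow_le_of_le_radical_of_fg
  · rw [Ideal.radical_eq_sInf]
    refine le_sInf ?_
    rintro P ⟨h1, h2⟩
    exact (h P h2 h1).ge
  · exact IsNoetherian.noetherian _

lemma dim_param_exists [IsLocalRing R] (I : Ideal R) (hI : I ≠ ⊤) (c : ℕ)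
    (h : ringKrullDim (R ⧸ I) < (c + 1 : ℕ)) :
    ∃ s : Finset R, s.card ≤ c ∧ (s : Set R) ⊆ IsLocalRing.maximalIdeal R ∧
      ∃ k, IsLocalRing.maximalIdeal R ^ k ≤ I ⊔ Ideal.span s := by
  classical
  have : Nontrivial (R ⧸ I) := Ideal.Quotient.nontrivial_iff.2 hI
  have : IsLocalRing (R ⧸ I) := IsLocalRing.of_surjective' (Ideal.Quotient.mk I) Ideal.Quotient.mk_surjective
  obtain ⟨t, ht, htc⟩ := (IsLocalRing.maximalIdeal (R ⧸ I)).exists_finset_card_eq_height_of_isNoetherianRing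
  rw [← IsLocalRing.maximalIdeal_height_eq_ringKrullDim, ← htc] at h
  have hc : t.card < c + 1 := by exact_mod_cast h
  choose g hg using (Ideal.Quotient.mk_surjective (I := I))
  refine ⟨t.image g, Finset.card_image_le.trans (by omega), ?_, ?_⟩
  · intro x hx
    obtain ⟨y, hy, rfl⟩ := Finset.mem_image.1 (Finset.mem_coe.1 hx)
    rw [SetLike.mem_coe, IsLocalRing.mem_maximalIdeal, mem_nonunits_iff]
    intro hu
    have h2 : y ∈ IsLocalRing.maximalIdeal (R ⧸ I) := ht.1.2 (Ideal.subset_span hy)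
    rw [IsLocalRing.mem_maximalIdeal, mem_nonunits_iff] at h2
    apply h2
    rw [← hg y]
    exact hu.map _
  · apply pow_le_of_primes
    intro P hP hle
    have hIP : I ≤ P := le_sup_left.trans hle
    have hmap : (P.map (Ideal.Quotient.mk I)).IsPrime :=
      Ideal.map_isPrime_of_surjective Ideal.Quotient.mk_surjective (by rwa [Ideal.mk_ker])
    have h3 : Ideal.span t ≤ P.map (Ideal.Quotient.mk I) := by
      rw [Ideal.span_le]
      intro y hy
      rw [← hg y]
      exact Ideal.mem_map_of_mem _ (hle (Ideal.mem_sup_right (Ideal.subset_span (Finset.mem_coe.2 (Finset.mem_image_of_mem g hy)))))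
    have h4 := ht.2 ⟨hmap, h3⟩ (IsLocalRing.le_maximalIdeal hmap.ne_top)
    refine le_antisymm (IsLocalRing.le_maximalIdeal hP.ne_top) ?_
    intro x hx
    have h5 : Ideal.Quotient.mk I x ∈ IsLocalRing.maximalIdeal (R ⧸ I) := by
      rw [IsLocalRing.mem_maximalIdeal, mem_nonunits_iff]
      intro hu
      have : IsLocalHom (Ideal.Quotient.mk I) := IsLocalHom.of_surjective _ Ideal.Quotient.mk_surjective
      exact (IsLocalRing.mem_maximalIdeal _).1 hx (isUnit_of_map_unit _ _ hu)
    have h6 := h4 h5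
    rw [Ideal.mem_map_iff_of_surjective _ Ideal.Quotient.mk_surjective] at h6
    obtain ⟨w, hw, hwx⟩ := h6
    rw [Ideal.Quotient.eq] at hwx
    simpa using P.sub_mem hw (hIP hwx)

lemma dim_param_bound [IsLocalRing R] (I : Ideal R) (s : Finset R) (hs : (s : Set R) ⊆ IsLocalRing.maximalIdeal R)
    (k : ℕ) (hk : IsLocalRing.maximalIdeal R ^ k ≤ I ⊔ Ideal.span s) :
    ringKrullDim (R ⧸ I) < (s.card + 1 : ℕ) := by
  classical
  by_cases hI : I = ⊤
  · subst hI
    rw [ringKrullDim_eq_bot_of_subsingleton]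
    exact WithBot.bot_lt_coe _
  have : Nontrivial (R ⧸ I) := Ideal.Quotient.nontrivial_iff.2 hI
  have : IsLocalRing (R ⧸ I) := IsLocalRing.of_surjective' (Ideal.Quotient.mk I) Ideal.Quotient.mk_surjective
  have hloc : IsLocalHom (Ideal.Quotient.mk I) := IsLocalHom.of_surjective _ Ideal.Quotient.mk_surjective
  let t := s.image (Ideal.Quotient.mk I)
  have h1 : ((t : Finset (R ⧸ I)) : Set (R ⧸ I)) ⊆ Ring.jacobson (R ⧸ I) := by
    rw [IsLocalRing.ringJacobson_eq_maximalIdeal]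
    intro x hx
    obtain ⟨y, hy, rfl⟩ := Finset.mem_image.1 (Finset.mem_coe.1 hx)
    rw [SetLike.mem_coe, IsLocalRing.mem_maximalIdeal, mem_nonunits_iff]
    intro hu
    exact (IsLocalRing.mem_maximalIdeal _).1 (hs hy) (isUnit_of_map_unit _ _ hu)
  have h2 := ringKrullDim_le_ringKrullDim_quotient_add_card t h1
  have h3 : ringKrullDim ((R ⧸ I) ⧸ Ideal.span (t : Set (R ⧸ I))) ≤ 0 := by
    have : Ring.KrullDimLE 0 ((R ⧸ I) ⧸ Ideal.span (t : Set (R ⧸ I))) := by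
      rw [Ring.krullDimLE_zero_iff]
      intro P hP
      let φ : R →+* ((R ⧸ I) ⧸ Ideal.span (t : Set (R ⧸ I))) := (Ideal.Quotient.mk _).comp (Ideal.Quotient.mk I)
      have hφ : Function.Surjective φ := Ideal.Quotient.mk_surjective.comp Ideal.Quotient.mk_surjective
      have h4 : I ⊔ Ideal.span s ≤ P.comap φ := by
        refine sup_le ?_ (Ideal.span_le.2 ?_)
        · intro x hx
          rw [Ideal.mem_comap, RingHom.comp_apply, Ideal.Quotient.eq_zero_iff_mem.2 hx, map_zero]
          exact P.zero_mem
        · intro x hx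
          rw [SetLike.mem_coe, Ideal.mem_comap, RingHom.comp_apply, Ideal.Quotient.eq_zero_iff_mem.2 (Ideal.subset_span (Finset.mem_coe.2 (Finset.mem_image_of_mem _ hx)))]
          exact P.zero_mem
      have h5 : (P.comap φ) = IsLocalRing.maximalIdeal R :=
        le_antisymm (IsLocalRing.le_maximalIdeal (Ideal.IsPrime.ne_top inferInstance))
          (Ideal.IsPrime.le_of_pow_le (hk.trans h4))
      have h6 : (P.comap φ).IsMaximal := h5 ▸ inferInstance
      rw [← Ideal.map_comap_of_surjective φ hφ P]
      exact (Ideal.map_eq_top_or_isMaximal_of_surjective φ hφ h6).resolve_left (by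
        rw [Ideal.map_comap_of_surjective φ hφ P]; exact hP.ne_top)
    exact Order.KrullDimLE.krullDim_le (n := 0)
  have h4 : ringKrullDim (R ⧸ I) ≤ (t.card : ℕ) := by
    refine h2.trans ((add_le_add_left h3 _).trans ?_)
    simp
  refine h4.trans_lt ?_
  have h7 : t.card < s.card + 1 := Nat.lt_succ_of_le Finset.card_image_le
  exact_mod_cast h7

end dims

/-- The inclusion of annihilators in the form used for base change. -/
def CB (R : Type) [CommRing R] (c : ℕ) : Prop :=
  ∀ (a : Ideal R) (M : Type) [AddCommGroup M] [Module R M] [Module.Finite R M],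
    ringKrullDim (R ⧸ Module.annihilator R M) < (c + 1 : ℕ) →
    ∀ (P : Ideal R), P.IsPrime → ¬ LCv a c (R ⧸ P) → ∀ x : R, (∀ y : LC a c M, x • y = 0) →
    ∀ z : M, (∀ r : R, r • x • z = 0 → r ∈ P) → False

section BC
open TensorProduct
variable {R S : Type} [CommRing R] [IsNoetherianRing R] [CommRing S] [IsNoetherianRing S] [Algebra R S]
  [Module.Flat R S]

lemma flat_ann {N : Type} [AddCommGroup N] [Module R N] (b : N) (I : Ideal R) (hI : ∀ r : R, r • b = 0 → r ∈ I) (s : S)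
    (h : s ⊗ₜ[R] b = 0) : s ∈ I.map (algebraMap R S) := by
  have h1 : ∑ i : Unit, (fun _ => b) i ⊗ₜ[R] (fun _ => s) i = 0 := by
    simp only [Finset.univ_unique, Finset.sum_singleton]
    have := congrArg (TensorProduct.comm R S N) h
    simpa using this
  obtain ⟨k, f, y, h2, h3⟩ := TensorProduct.vanishesTrivially_of_sum_tmul_eq_zero_of_rTensor_injective R
    (Module.Flat.rTensor_preserves_injective_linearMap _ Subtype.val_injective) h1
  have h4 : s = ∑ j, f () j • y j := h2 ()
  rw [h4]
  refine Ideal.sum_mem _ fun j _ => ?_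
  rw [Algebra.smul_def]
  refine Ideal.mul_mem_right _ _ (Ideal.mem_map_of_mem _ (hI _ ?_))
  simpa using h3 j

lemma BC (c : ℕ) (a : Ideal R) (M : Type) [AddCommGroup M] [Module R M] [Module.Finite R M]
    (hd : ringKrullDim (S ⧸ (Module.annihilator R M).map (algebraMap R S)) < (c + 1 : ℕ))
    (P : Ideal R) (b : LC a c (R ⧸ P)) (I : Ideal R) (hI : ∀ r : R, r • b = 0 → r ∈ I)
    (hIS : I.map (algebraMap R S) ≠ ⊤) (x : R) (hx : ∀ y : LC a c M, x • y = 0) (z : M)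
    (hz : ∀ r : R, r • x • z = 0 → r ∈ P) (hS : CB S c) : False := by
  have h1 : Module.annihilator R M ≤ (Module.annihilator S (S ⊗[R] M)).comap (algebraMap R S) := by
    intro r hr
    rw [Ideal.mem_comap, Module.mem_annihilator]
    intro t
    rw [algebraMap_smul]
    induction t with
    | zero => simp
    | add u v hu hv => rw [smul_add, hu, hv, add_zero]
    | tmul s m => rw [← TensorProduct.tmul_smul, Module.mem_annihilator.1 hr, TensorProduct.tmul_zero]
  have h2 := (dim_mono (Ideal.map_le_iff_le_comap.2 h1)).trans_lt hd
  have h3 : ∀ y : LC (a.map (algebraMap R S)) c (S ⊗[R] M), algebraMap R S x • y = 0 := by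
    intro y
    obtain ⟨e, he⟩ := E6 (R := R) (S := S) (a := a) c (S ⊗[R] M)
    obtain ⟨e', he'⟩ := E7 (S := S) (a := a) c M
    obtain ⟨y, rfl⟩ := e.surjective y
    obtain ⟨y, rfl⟩ := e'.surjective y
    rw [← he, ← he']
    have : x • y = 0 := by
      induction y with
      | zero => simp
      | add u v hu hv => rw [smul_add, hu, hv, add_zero]
      | tmul s m => rw [← TensorProduct.tmul_smul, hx, TensorProduct.tmul_zero]
    rw [this, map_zero, map_zero]
  have h4 : ¬ LCv (a.map (algebraMap R S)) c (S ⊗[R] (R ⧸ P)) := by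
    intro hv
    obtain ⟨e, he⟩ := E6 (R := R) (S := S) (a := a) c (S ⊗[R] (R ⧸ P))
    obtain ⟨e', he'⟩ := E7 (S := S) (a := a) c (R ⧸ P)
    have h5 : (1 : S) ⊗ₜ[R] b = 0 := by
      apply e'.injective
      apply e.injective
      rw [hv (e _), hv (e _)]
    exact hIS ((Ideal.eq_top_iff_one _).2 (flat_ann b I hI 1 h5))
  have h5 : ∃ Q : Ideal S, Q.IsPrime ∧ Module.annihilator S (S ⊗[R] (R ⧸ P)) ≤ Q ∧ ¬ LCv (a.map (algebraMap R S)) c (S ⧸ Q) := by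
    by_contra hc
    push Not at hc
    exact h4 (LCv_of_primes hc)
  obtain ⟨Q, hQ, hQP, hQv⟩ := h5
  have h6 : P.map (algebraMap R S) ≤ Q := by
    refine le_trans (Ideal.map_le_iff_le_comap.2 ?_) hQP
    intro r hr
    rw [Ideal.mem_comap, Module.mem_annihilator]
    intro t
    rw [algebraMap_smul]
    induction t with
    | zero => simp
    | add u v hu hv => rw [smul_add, hu, hv, add_zero]
    | tmul s m =>
      rw [← TensorProduct.tmul_smul]
      obtain ⟨m, rfl⟩ := Ideal.Quotient.mk_surjective m
      have : r • (Ideal.Quotient.mk P m) = Ideal.Quotient.mk P (r * m) := rfl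
      rw [this, Ideal.Quotient.eq_zero_iff_mem.2 (P.mul_mem_right _ hr), TensorProduct.tmul_zero]
  refine hS (a.map (algebraMap R S)) (S ⊗[R] M) h2 Q hQ hQv (algebraMap R S x) h3 (1 ⊗ₜ z) ?_
  intro s hs
  apply h6
  refine flat_ann (x • z) P hz s ?_
  rw [← hs, algebraMap_smul, ← TensorProduct.tmul_smul, TensorProduct.smul_tmul', smul_eq_mul, mul_one]
end BC

/-- Reduction to complete local rings. -/
lemma CB_local {R : Type} [CommRing R] [IsNoetherianRing R] [IsLocalRing R] (c : ℕ)
    (hS : ∀ (S : Type) [CommRing S] [IsNoetherianRing S] [IsLocalRing S]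
      [IsAdicComplete (IsLocalRing.maximalIdeal S) S], CB S c) : CB R c := by
  intro a M _ _ _ hd P hP hv x hx z hz
  have := noeth_adic R (IsLocalRing.maximalIdeal R)
  have hM : Module.annihilator R M ≠ ⊤ := by
    intro h
    have : (1 : R) ∈ Module.annihilator R M := h ▸ Submodule.mem_top
    rw [Module.mem_annihilator] at this
    have h2 : z = 0 := by simpa using this z
    exact hP.ne_top ((Ideal.eq_top_iff_one _).2 (hz 1 (by simp [h2])))
  obtain ⟨s, hsc, hsm, k, hk⟩ := dim_param_exists _ hM c hd
  have hv' : ∃ b : LC a c (R ⧸ P), b ≠ 0 := by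
    by_contra hc; push Not at hc; exact hv hc
  obtain ⟨b, hb⟩ := hv'
  classical
  let S := AdicCompletion (IsLocalRing.maximalIdeal R) R
  have hdS : ringKrullDim (S ⧸ (Module.annihilator R M).map (algebraMap R S)) < (c + 1 : ℕ) := by
    have h1 := dim_param_bound (R := S) ((Module.annihilator R M).map (algebraMap R S)) (s.image (algebraMap R S)) (by
      intro y hy
      obtain ⟨y, hy2, rfl⟩ := Finset.mem_image.1 (Finset.mem_coe.1 hy)
      rw [AdicCompletion.maximalIdeal_eq_map]
      exact Ideal.mem_map_of_mem _ (hsm hy2)) k (by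
      have h2 := Ideal.map_mono (f := algebraMap R S) hk
      rw [Ideal.map_pow, ← AdicCompletion.maximalIdeal_eq_map, Ideal.map_sup, Ideal.map_span] at h2
      rwa [Finset.coe_image])
    refine h1.trans_le ?_
    have h3 : (s.image (algebraMap R S)).card + 1 ≤ c + 1 := Nat.succ_le_succ (Finset.card_image_le.trans hsc)
    exact_mod_cast h3
  refine BC (S := S) c a M hdS P b (IsLocalRing.maximalIdeal R) ?_ ?_ x hx z hz (hS S)
  · intro r hr
    rw [IsLocalRing.mem_maximalIdeal, mem_nonunits_iff]
    intro hu
    exact hb (hu.smul_eq_zero.1 hr)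
  · rw [← AdicCompletion.maximalIdeal_eq_map]
    exact Ideal.IsPrime.ne_top inferInstance

lemma CB_reduce {R : Type} [CommRing R] [IsNoetherianRing R] (c : ℕ)
    (hS : ∀ (S : Type) [CommRing S] [IsNoetherianRing S] [IsLocalRing S]
      [IsAdicComplete (IsLocalRing.maximalIdeal S) S], CB S c) : CB R c := by
  intro a M _ _ _ hd P hP hv x hx z hz
  have hv' : ∃ b : LC a c (R ⧸ P), b ≠ 0 := by
    by_contra hc; push Not at hc; exact hv hc
  obtain ⟨b, hb⟩ := hv'
  have h1 : LinearMap.ker (LinearMap.toSpanSingleton R _ b) ≠ ⊤ := by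
    intro h
    have : (1 : R) ∈ LinearMap.ker (LinearMap.toSpanSingleton R _ b) := h ▸ Submodule.mem_top
    rw [LinearMap.mem_ker, LinearMap.toSpanSingleton_apply, one_smul] at this
    exact hb this
  obtain ⟨n, hn, hle⟩ := Ideal.exists_le_maximal _ h1
  have := IsLocalization.isNoetherianRing n.primeCompl (Localization.AtPrime n) inferInstance
  have : Module.Flat R (Localization.AtPrime n) := IsLocalization.flat _ n.primeCompl
  refine BC (S := Localization.AtPrime n) c a M ((dim_loc n _).trans_lt hd) P b n (fun r hr => hle hr) ?_ x hx z hz (CB_local c hS)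
  rw [Localization.AtPrime.map_eq_maximalIdeal]
  exact Ideal.IsPrime.ne_top inferInstance
end LCaux

open CategoryTheory
namespace LCaux
open Opposite Limits

section hull
variable {S : Type} [CommRing S]

lemma exists_max_disj {J : Type} [AddCommGroup J] [Module S J] (A B : Submodule S J) (h : B ⊓ A = ⊥) :
    ∃ L : Submodule S J, B ≤ L ∧ L ⊓ A = ⊥ ∧ ∀ L', L ≤ L' → L' ⊓ A = ⊥ → L' = L := by
  obtain ⟨L, h1, h2⟩ := zorn_le_nonempty₀ {L : Submodule S J | Disjoint L A} (by
    intro c hc hch y hy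
    refine ⟨sSup c, ?_, fun z hz => le_sSup hz⟩
    rw [Set.mem_setOf_eq, DirectedOn.disjoint_sSup_left hch.directedOn]
    exact fun z hz => hc hz) B (disjoint_iff.2 h)
  exact ⟨L, h1, disjoint_iff.1 h2.1, fun L' hL hL' => le_antisymm (h2.2 (disjoint_iff.2 hL') hL) hL⟩

lemma exists_E [IsNoetherianRing S] [IsLocalRing S] : ∃ (E : Type) (_ : AddCommGroup E) (_ : Module S E), Module.Injective S E ∧
    (∃ e : E, e ≠ 0 ∧ (∀ r ∈ IsLocalRing.maximalIdeal S, r • e = 0) ∧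
      ∀ u : E, (∀ r ∈ IsLocalRing.maximalIdeal S, r • u = 0) → ∃ s : S, u = s • e) := by
  obtain ⟨J, _, _, _, f, hf⟩ := exists_inj_embed S (S ⧸ IsLocalRing.maximalIdeal S)
  let e0 : J := f (Ideal.Quotient.mk _ 1)
  have he0 : e0 ≠ 0 := by
    intro h
    have h1 : Ideal.Quotient.mk (IsLocalRing.maximalIdeal S) 1 = 0 := hf (by rw [map_zero]; exact h)
    rw [Ideal.Quotient.eq_zero_iff_mem] at h1
    exact (Ideal.IsPrime.ne_top inferInstance) ((Ideal.eq_top_iff_one _).2 h1)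
  have he0m : ∀ r ∈ IsLocalRing.maximalIdeal S, r • e0 = 0 := by
    intro r hr
    have h1 : r • Ideal.Quotient.mk (IsLocalRing.maximalIdeal S) 1 = 0 := by
      have h2 : r • Ideal.Quotient.mk (IsLocalRing.maximalIdeal S) 1 = Ideal.Quotient.mk (IsLocalRing.maximalIdeal S) (r * 1) := rfl
      rw [h2, mul_one, Ideal.Quotient.eq_zero_iff_mem.2 hr]
    show r • f _ = 0
    rw [← map_smul, h1, map_zero]
  obtain ⟨A, hA⟩ : ∃ A, A = Submodule.span S {e0} := ⟨_, rfl⟩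
  have hA' : ∀ u, u ∈ A ↔ ∃ s : S, s • e0 = u := by
    intro u; rw [hA, Submodule.mem_span_singleton]
  obtain ⟨L, -, hL, hLmax⟩ := exists_max_disj (S := S) A ⊥ (by simp)
  obtain ⟨K, hAK, hK, hKmax⟩ := exists_max_disj (S := S) L A (by rw [inf_comm]; exact hL)
  have d0 : ∀ u, u ∈ K → u ∈ L → u = 0 := fun u h1 h2 => by
    have : u ∈ K ⊓ L := ⟨h1, h2⟩
    rwa [hK, Submodule.mem_bot] at this
  have d1 : ∀ u, u ∈ L → u ∈ A → u = 0 := fun u h1 h2 => by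
    have : u ∈ L ⊓ A := ⟨h1, h2⟩
    rwa [hL, Submodule.mem_bot] at this
  obtain ⟨r, hr⟩ := inj_extend (J := J) (LinearMap.coprod K.subtype L.subtype) (K.subtype.comp (LinearMap.fst S K L)) (by
    rintro ⟨k, l⟩ h
    rw [LinearMap.mem_ker, LinearMap.coprod_apply] at h
    rw [LinearMap.mem_ker]
    show (k : J) = 0
    have h1 : (k : J) = -(l : J) := eq_neg_of_add_eq_zero_left h
    exact d0 _ k.2 (h1 ▸ L.neg_mem l.2))
  have hrK : ∀ k ∈ K, r k = k := fun k hk => by simpa using hr (⟨k, hk⟩, 0)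
  have hrL : ∀ l ∈ L, r l = 0 := fun l hl => by simpa using hr (0, ⟨l, hl⟩)
  have h1 : L.comap r = L := by
    apply hLmax
    · intro l hl
      rw [Submodule.mem_comap, hrL l hl]; exact L.zero_mem
    · rw [eq_bot_iff]
      rintro u ⟨hu, huA⟩
      have h2 : r u ∈ L := hu
      rw [hrK u (hAK huA)] at h2
      exact d1 _ h2 huA
  have h2 : LinearMap.range r = K := by
    apply hKmax
    · intro k hk; exact ⟨k, hrK k hk⟩
    · rw [eq_bot_iff]
      rintro u ⟨⟨w, rfl⟩, hw⟩
      have : w ∈ L := h1 ▸ hw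
      rw [hrL w this]; exact Submodule.zero_mem _
  have hrm : ∀ w, r w ∈ K := fun w => h2 ▸ ⟨w, rfl⟩
  refine ⟨K, inferInstance, inferInstance, ⟨?_⟩, ⟨e0, hAK ((hA' _).2 ⟨1, one_smul _ _⟩)⟩, ?_, ?_, ?_⟩
  · intro X Y _ _ _ _ p hp g
    obtain ⟨h, hh⟩ := inj_extend (J := J) p (K.subtype.comp g) (by rw [LinearMap.ker_eq_bot.2 hp]; exact bot_le)
    refine ⟨(r.codRestrict K hrm).comp h, fun x => Subtype.ext ?_⟩
    show r (h (p x)) = g x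
    rw [hh]
    exact hrK _ (g x).2
  · intro h
    exact he0 (congrArg Subtype.val h)
  · intro s hs
    exact Subtype.ext (he0m s hs)
  · rintro ⟨u, hu⟩ hum
    have hum' : ∀ r ∈ IsLocalRing.maximalIdeal S, r • u = 0 := fun r hr => congrArg Subtype.val (hum r hr)
    by_cases hu0 : u = 0
    · exact ⟨0, Subtype.ext (by simp [hu0])⟩
    by_contra hcon
    have hdis : (L ⊔ Submodule.span S {u}) ⊓ A = ⊥ := by
      rw [eq_bot_iff]
      rintro v ⟨hv, hvA⟩
      obtain ⟨l, hl, w, hw, rfl⟩ := Submodule.mem_sup.1 hv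
      obtain ⟨s, rfl⟩ := Submodule.mem_span_singleton.1 hw
      have hlK : l ∈ K := by
        have : l = (l + s • u) - s • u := by abel
        rw [this]
        exact K.sub_mem (hAK hvA) (K.smul_mem _ hu)
      have hl0 := d0 l hlK hl
      rw [hl0, zero_add] at hvA ⊢
      by_cases hs : s ∈ IsLocalRing.maximalIdeal S
      · rw [hum' s hs]; exact Submodule.zero_mem _
      · exfalso
        have hsu : IsUnit s := by
          by_contra hh; exact hs hh
        obtain ⟨t, ht⟩ := hsu.exists_left_inv
        obtain ⟨w, hw⟩ := (hA' _).1 hvA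
        refine hcon ⟨t * w, Subtype.ext ?_⟩
        show u = (t * w) • e0
        rw [mul_smul, hw, ← mul_smul, ht, one_smul]
    have h3 := hLmax _ le_sup_left hdis
    have h4 : u ∈ L := h3 ▸ Submodule.mem_sup_right (Submodule.mem_span_singleton_self u)
    exact hu0 (d0 u hu h4)

/-- package of the properties of the dualizing injective -/
structure IsDual (S : Type) [CommRing S] [IsLocalRing S] (E : Type) [AddCommGroup E] [Module S E] : Prop where
  inj : Module.Injective S E
  cog : ∀ (N : Type) [AddCommGroup N] [Module S N] (b : N), b ≠ 0 → ∃ φ : N →ₗ[S] E, φ b ≠ 0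
  fin : ∀ (N : Type) [AddCommGroup N] [Module S N] [Module.Finite S N] (k : ℕ),
    (∀ r ∈ IsLocalRing.maximalIdeal S ^ k, ∀ x : N, r • x = 0) → Module.Finite S (N →ₗ[S] E)

lemma finite_hom_mid [IsNoetherianRing S] {X Y Z E : Type} [AddCommGroup X] [Module S X] [AddCommGroup Y] [Module S Y]
    [AddCommGroup Z] [Module S Z] [AddCommGroup E] [Module S E] (f : X →ₗ[S] Y) (g : Y →ₗ[S] Z) (h : Function.Exact f g)
    (hg : Function.Surjective g) (h1 : Module.Finite S (X →ₗ[S] E)) (h2 : Module.Finite S (Z →ₗ[S] E)) :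
    Module.Finite S (Y →ₗ[S] E) := by
  let F := LinearMap.lcomp S E f
  let G := LinearMap.lcomp S E g
  have hex : Function.Exact G F := by
    intro φ
    constructor
    · intro hφ
      have h3 : LinearMap.ker g ≤ LinearMap.ker φ := by
        intro y hy
        obtain ⟨x, rfl⟩ := (h y).1 hy
        exact LinearMap.congr_fun hφ x
      have h4 : (LinearMap.ker g).liftQ φ h3 ∘ₗ (g.quotKerEquivOfSurjective hg).symm.toLinearMap ∈ Set.univ := trivial
      refine ⟨(LinearMap.ker g).liftQ φ h3 ∘ₗ (g.quotKerEquivOfSurjective hg).symm.toLinearMap, LinearMap.ext fun y => ?_⟩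
      show (LinearMap.ker g).liftQ φ h3 ((g.quotKerEquivOfSurjective hg).symm (g y)) = φ y
      have : (g.quotKerEquivOfSurjective hg).symm (g y) = Submodule.Quotient.mk y := by
        rw [LinearEquiv.symm_apply_eq]; rfl
      rw [this]; rfl
    · rintro ⟨ψ, rfl⟩
      refine LinearMap.ext fun x => ?_
      show ψ (g (f x)) = 0
      rw [(h (f x)).2 ⟨x, rfl⟩, map_zero]
  have := isNoetherian_of_isNoetherianRing_of_finite S (X →ₗ[S] E)
  have := isNoetherian_of_isNoetherianRing_of_finite S (Z →ₗ[S] E)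
  have : IsNoetherian S (Y →ₗ[S] E) := isNoetherian_of_range_eq_ker G F (LinearMap.exact_iff.1 hex).symm
  infer_instance

lemma exists_dual [IsNoetherianRing S] [IsLocalRing S] : ∃ (E : Type) (_ : AddCommGroup E) (_ : Module S E), IsDual S E := by
  obtain ⟨E, _, _, hinj, e, he, hem, heu⟩ := exists_E (S := S)
  refine ⟨E, inferInstance, inferInstance, hinj, ?_, ?_⟩
  · intro N _ _ b hb
    obtain ⟨h, hh⟩ := inj_extend (J := E) (LinearMap.toSpanSingleton S N b) (LinearMap.toSpanSingleton S E e) (by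
      intro s hs
      rw [LinearMap.mem_ker, LinearMap.toSpanSingleton_apply] at hs ⊢
      apply hem
      rw [IsLocalRing.mem_maximalIdeal, mem_nonunits_iff]
      intro hu
      exact hb (hu.smul_eq_zero.1 hs))
    refine ⟨h, ?_⟩
    have := hh 1
    rw [LinearMap.toSpanSingleton_apply, LinearMap.toSpanSingleton_apply, one_smul, one_smul] at this
    rwa [this]
  · intro N _ _ hN k
    induction hN using IsNoetherianRing.induction_on_isQuotientEquivQuotientPrime S with
    | subsingleton N => exact fun _ => inferInstance
    | quotient N p f =>
      intro hk
      have hp : p.asIdeal = IsLocalRing.maximalIdeal S := by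
        refine le_antisymm (IsLocalRing.le_maximalIdeal p.2.ne_top) (p.2.le_of_pow_le (n := k) ?_)
        intro r hr
        have h1 := hk r hr (f.symm (Ideal.Quotient.mk _ 1))
        rw [← map_smul, LinearEquiv.map_eq_zero_iff] at h1
        have h2 : r • Ideal.Quotient.mk p.asIdeal 1 = Ideal.Quotient.mk p.asIdeal (r * 1) := rfl
        rwa [h2, mul_one, Ideal.Quotient.eq_zero_iff_mem] at h1
      let A : Submodule S E := Submodule.span S {e}
      have hA : Module.Finite S A := inferInstance
      let n0 : N := f.symm (Ideal.Quotient.mk _ 1)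
      have hn0 : ∀ n : N, ∃ s : S, n = s • n0 := by
        intro n
        obtain ⟨s, hs⟩ := Ideal.Quotient.mk_surjective (f n)
        refine ⟨s, f.injective ?_⟩
        have h2 : s • Ideal.Quotient.mk p.asIdeal 1 = Ideal.Quotient.mk p.asIdeal (s * 1) := rfl
        rw [← hs, map_smul, LinearEquiv.apply_symm_apply, h2, mul_one]
      have hmem : ∀ φ : N →ₗ[S] E, φ n0 ∈ A := by
        intro φ
        obtain ⟨s, hs⟩ := heu (φ n0) (by
          intro r hr
          rw [← hp] at hr
          have h2 : r • Ideal.Quotient.mk p.asIdeal 1 = Ideal.Quotient.mk p.asIdeal (r * 1) := rfl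
          rw [← map_smul, ← map_smul, h2, mul_one, Ideal.Quotient.eq_zero_iff_mem.2 hr, map_zero, map_zero])
        rw [hs]
        exact Submodule.smul_mem _ _ (Submodule.mem_span_singleton_self e)
      let G : (N →ₗ[S] E) →ₗ[S] A := (LinearMap.applyₗ n0).codRestrict A hmem
      refine Module.Finite.of_injective G ?_
      rw [injective_iff_map_eq_zero]
      intro φ hφ
      have h3 : φ n0 = 0 := congrArg Subtype.val hφ
      refine LinearMap.ext fun n => ?_
      obtain ⟨s, rfl⟩ := hn0 n
      rw [map_smul, h3, smul_zero, LinearMap.zero_apply]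
    | exact N₁ N₂ N₃ f g hf hg h h1 h3 =>
      intro hk
      refine finite_hom_mid f g h hg (h1 fun r hr x => hf ?_) (h3 fun r hr x => ?_)
      · rw [map_smul, hk r hr, map_zero]
      · obtain ⟨x, rfl⟩ := hg x
        rw [← map_smul, hk r hr, map_zero]
end hull

section fg
variable {S : Type} [CommRing S]

lemma precomplete_pi (I : Ideal S) [IsPrecomplete I S] (n : ℕ) : IsPrecomplete I (Fin n → S) := by
  constructor
  intro f hf
  have h1 : ∀ (k : ℕ) (v : Fin n → S), v ∈ (I ^ k • ⊤ : Submodule S (Fin n → S)) ↔ ∀ j, v j ∈ (I ^ k • ⊤ : Submodule S S) := by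
    intro k v
    constructor
    · intro hv j
      have h2 := Submodule.mem_map_of_mem (f := LinearMap.proj (R := S) (φ := fun _ : Fin n => S) j) hv
      rw [Submodule.map_smul''] at h2
      exact Submodule.smul_mono le_rfl le_top h2
    · intro hv
      have : v = ∑ j, v j • (Pi.single j (1 : S) : Fin n → S) := by
        exact (pi_eq_sum_univ' v)
      rw [this]
      refine Submodule.sum_mem _ fun j _ => Submodule.smul_mem_smul ?_ trivial
      simpa using hv j
  have h2 : ∀ j, ∃ L : S, ∀ k, f k j ≡ L [SMOD (I ^ k • ⊤ : Submodule S S)] := by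
    intro j
    apply IsPrecomplete.prec'
    intro m k hmk
    have := hf hmk
    rw [SModEq.sub_mem, h1] at this
    rw [SModEq.sub_mem]
    exact this j
  choose L hL using h2
  refine ⟨L, fun k => ?_⟩
  rw [SModEq.sub_mem, h1]
  intro j
  have := hL j k
  rwa [SModEq.sub_mem] at this

lemma fg_of_quot (I : Ideal S) [IsPrecomplete I S] {Y : Type} [AddCommGroup Y] [Module S Y] [IsHausdorff I Y]
    (h : Module.Finite S (Y ⧸ (I • ⊤ : Submodule S Y))) : Module.Finite S Y := by
  obtain ⟨n, g, hg⟩ := Module.Finite.exists_fin' S (Y ⧸ (I • ⊤ : Submodule S Y))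
  have := precomplete_pi I n
  obtain ⟨f, hf⟩ := Module.projective_lifting_property (Submodule.mkQ (I • ⊤ : Submodule S Y)) g (Submodule.mkQ_surjective _)
  refine Module.Finite.of_surjective f (surjective_of_mkQ_comp_surjective (I := I) ?_)
  rw [hf]; exact hg
end fg
end LCaux

open CategoryTheory
namespace LCaux
open Opposite Limits

section factV
open IsLocalRing
variable {S : Type} [CommRing S] [IsNoetherianRing S] [IsLocalRing S]

/-- killing property -/
def Kill (H : Type) [AddCommGroup H] [Module S H] (i : ℕ) : Prop :=
  ∀ P : Ideal S, P.IsPrime → ((i : ℕ) : WithBot ℕ∞) ≤ ringKrullDim (S ⧸ P) → ∃ d, d ∉ P ∧ ∀ x : H, d • x = 0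

lemma exists_Q (P : Ideal S) (hP : P.IsPrime) (i : ℕ) (h : ((i + 1 : ℕ) : WithBot ℕ∞) ≤ ringKrullDim (S ⧸ P))
    (y : S) (hy : y ∈ maximalIdeal S) :
    ∃ Q : Ideal S, Q.IsPrime ∧ P ≤ Q ∧ y ∈ Q ∧ ((i : ℕ) : WithBot ℕ∞) ≤ ringKrullDim (S ⧸ Q) := by
  have h1 := Module.supportDim_le_supportDim_quotSMulTop_succ (M := S ⧸ P) hy
  rw [Module.supportDim_quotient_eq_ringKrullDim] at h1
  have h2 : ((i : ℕ) : WithBot ℕ∞) ≤ Module.supportDim S (QuotSMulTop y (S ⧸ P)) := by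
    have h3 := h.trans h1
    generalize Module.supportDim S (QuotSMulTop y (S ⧸ P)) = D at h3
    induction D with
    | bot => simp at h3
    | coe D =>
      induction D with
      | top => exact le_top
      | coe D => norm_cast at h3 ⊢; omega
  obtain ⟨l, hl⟩ := Order.le_krullDim_iff.1 h2
  have hm : ∀ j, P ≤ (l j).1.asIdeal ∧ y ∈ (l j).1.asIdeal := by
    intro j
    have := (l j).2
    generalize (l j).1 = Q at this ⊢
    rw [Module.support_quotSMulTop, Module.support_eq_zeroLocus] at this
    refine ⟨?_, by simpa using this.2⟩
    have := this.1
    rw [Ideal.annihilator_quotient] at this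
    exact this
  refine ⟨l.head.1.asIdeal, l.head.1.isPrime, (hm 0).1, (hm 0).2, ?_⟩
  rw [ringKrullDim_quotient]
  refine Order.le_krullDim_iff.2 ⟨⟨l.length, fun j => ⟨(l j).1, ?_⟩, ?_⟩, hl⟩
  · exact LTSeries.head_le l j
  · intro j
    exact l.step j

lemma dual_step [IsAdicComplete (maximalIdeal S) S] {E : Type} [AddCommGroup E] [Module S E] (hE : IsDual S E)
    {H H' : Type} [AddCommGroup H] [Module S H] [AddCommGroup H'] [Module S H'] (ht : IsTors (maximalIdeal S) H)
    (y : S) (hy : y ∈ maximalIdeal S) (δ : H' →ₗ[S] H) (hδ : ∀ x, y • x = 0 → ∃ z, δ z = x) (hδ' : ∀ z, y • δ z = 0)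
    (i : ℕ) (hf : Module.Finite S (H' →ₗ[S] E)) (hk : Kill (S := S) H' i) :
    Module.Finite S (H →ₗ[S] E) ∧ Kill (S := S) H (i + 1) := by
  have := hE.inj
  let F := LinearMap.lcomp S E δ
  have hF : ∀ ψ : H →ₗ[S] E, F ψ = 0 → ∃ φ : H →ₗ[S] E, ψ = y • φ := by
    intro ψ hψ
    obtain ⟨φ, hφ⟩ := inj_extend (J := E) (y • (LinearMap.id : H →ₗ[S] H)) ψ (by
      intro x hx
      obtain ⟨z, rfl⟩ := hδ x hx
      exact LinearMap.congr_fun hψ z)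
    refine ⟨φ, LinearMap.ext fun x => ?_⟩
    rw [LinearMap.smul_apply, ← φ.map_smul, ← hφ]; rfl
  have hH : IsHausdorff (maximalIdeal S) (H →ₗ[S] E) := by
    refine ⟨fun ψ hψ => LinearMap.ext fun x => ?_⟩
    obtain ⟨n, hn⟩ := ht x
    have h1 := hψ n
    rw [SModEq.zero] at h1
    refine Submodule.smul_induction_on (p := fun φ : H →ₗ[S] E => φ x = 0) h1 ?_ ?_
    · intro r hr φ _
      rw [LinearMap.smul_apply, ← φ.map_smul, hn r hr, map_zero]
    · intro φ φ' h h'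
      rw [LinearMap.add_apply, h, h', add_zero]
  have hle : LinearMap.ker F ≤ (maximalIdeal S • ⊤ : Submodule S (H →ₗ[S] E)) := by
    intro ψ hψ
    obtain ⟨φ, rfl⟩ := hF ψ hψ
    exact Submodule.smul_mem_smul hy trivial
  have hfin : Module.Finite S (H →ₗ[S] E) := by
    apply fg_of_quot (maximalIdeal S)
    have h1 : Module.Finite S ((H →ₗ[S] E) ⧸ LinearMap.ker F) :=
      Module.Finite.equiv F.quotKerEquivRange.symm
    exact Module.Finite.of_surjective _ (Submodule.factor_surjective hle)
  refine ⟨hfin, fun P hP hdim => ?_⟩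
  suffices hs : ∃ d, d ∉ P ∧ d ∈ Module.annihilator S (H →ₗ[S] E) by
    obtain ⟨d, hd, hd'⟩ := hs
    refine ⟨d, hd, fun x => by_contra fun hx => ?_⟩
    obtain ⟨φ, hφ⟩ := hE.cog H _ hx
    apply hφ
    rw [φ.map_smul]
    exact LinearMap.congr_fun (Module.mem_annihilator.1 hd' φ) x
  by_contra! hcon
  have hann : Module.annihilator S (H →ₗ[S] E) ≤ P := fun d hd => by_contra fun h => hcon d h hd
  obtain ⟨Q, hQ, hPQ, hyQ, hdQ⟩ := exists_Q P hP i hdim y hy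
  obtain ⟨d, hd, hdk⟩ := hk Q hQ hdQ
  have hsup : (⟨Q, hQ⟩ : PrimeSpectrum S) ∈ Module.support S (QuotSMulTop y (H →ₗ[S] E)) := by
    rw [Module.support_quotSMulTop, Module.support_eq_zeroLocus]
    exact ⟨hann.trans hPQ, by simpa using hyQ⟩
  rw [Module.support_eq_zeroLocus] at hsup
  apply hd
  apply hsup
  rw [SetLike.mem_coe, Module.mem_annihilator]
  intro ψ
  obtain ⟨ψ, rfl⟩ := Submodule.mkQ_surjective _ ψ
  rw [← map_smul, Submodule.mkQ_apply, Submodule.Quotient.mk_eq_zero]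
  obtain ⟨φ, hφ⟩ := hF (d • ψ) (LinearMap.ext fun z => by
    change (d • ψ) (δ z) = 0
    rw [LinearMap.smul_apply, ← ψ.map_smul, ← δ.map_smul, hdk, map_zero, map_zero])
  rw [hφ]
  exact Submodule.smul_mem_pointwise_smul _ _ _ trivial

lemma LC_ann {R : Type} [CommRing R] {a : Ideal R} {i : ℕ} {N : Type} [AddCommGroup N] [Module R N] {r : R}
    (hr : r ∈ Module.annihilator R N) (x : LC a i N) : r • x = 0 := by
  rw [← LCmap_smul_id]
  have : (r • LinearMap.id : N →ₗ[R] N) = 0 := LinearMap.ext fun n => Module.mem_annihilator.1 hr n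
  rw [this, LCmap_zero]

lemma pow_sup_kill {a b m : Ideal S} {k n : ℕ} (h : m ^ k ≤ a ⊔ b) : m ^ (k * (n + 1)) ≤ a ^ n ⊔ b := by
  rw [pow_mul]
  refine (Ideal.pow_right_mono h (n+1)).trans ?_
  refine Ideal.sup_pow_add_le_pow_sup_pow.trans ?_
  rw [pow_one]

lemma LC_mtors {a : Ideal S} {N : Type} [AddCommGroup N] [Module S N] {i k : ℕ} {m : Ideal S}
    (h : m ^ k ≤ a ⊔ Module.annihilator S N) : IsTors m (LC a i N) := by
  intro x
  obtain ⟨n, hn⟩ := LC_torsion x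
  refine ⟨k * (n + 1), fun r hr => ?_⟩
  obtain ⟨u, hu, v, hv, rfl⟩ := Submodule.mem_sup.1 (pow_sup_kill (n := n) h hr)
  rw [add_smul, hn u hu, LC_ann hv, add_zero]

lemma LC_top {a : Ideal S} (ha : a = ⊤) {N : Type} [AddCommGroup N] [Module S N] (i : ℕ) : LCv a i N := by
  intro x
  obtain ⟨n, hn⟩ := LC_torsion x
  simpa using hn 1 (by rw [ha, Ideal.top_pow]; trivial)

lemma kill_of_inj {H H' : Type} [AddCommGroup H] [Module S H] [AddCommGroup H'] [Module S H'] {i : ℕ}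
    (f : H →ₗ[S] H') (hf : Function.Injective f) (h : Kill (S := S) H' i) : Kill (S := S) H i := by
  intro P hP hd
  obtain ⟨d, hd, hk⟩ := h P hP hd
  exact ⟨d, hd, fun x => hf (by rw [map_smul, hk, map_zero])⟩

lemma fin_of_inj {E : Type} [AddCommGroup E] [Module S E] (hE : Module.Injective S E)
    {H H' : Type} [AddCommGroup H] [Module S H] [AddCommGroup H'] [Module S H']
    (f : H →ₗ[S] H') (hf : Function.Injective f) (h : Module.Finite S (H' →ₗ[S] E)) : Module.Finite S (H →ₗ[S] E) := by
  refine Module.Finite.of_surjective (LinearMap.lcomp S E f) fun ψ => ?_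
  obtain ⟨φ, hφ⟩ := inj_extend (J := E) f ψ (by rw [LinearMap.ker_eq_bot.2 hf]; exact bot_le)
  exact ⟨φ, LinearMap.ext hφ⟩

lemma Gam_torsion_free {a : Ideal S} {N : Type} [AddCommGroup N] [Module S N] (x : N ⧸ Gam a N)
    (hx : ∀ r ∈ a, r • x = 0) : x = 0 := by
  obtain ⟨x, rfl⟩ := Submodule.mkQ_surjective _ x
  rw [Submodule.mkQ_apply, Submodule.Quotient.mk_eq_zero]
  have h1 : ∀ r ∈ a, ∃ n, ∀ s ∈ a ^ n, s • r • x = 0 := by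
    intro r hr
    have := hx r hr
    rwa [← map_smul, Submodule.mkQ_apply, Submodule.Quotient.mk_eq_zero] at this
  obtain ⟨s, hs⟩ := IsNoetherian.noetherian a
  have h2 : ∃ n, ∀ r ∈ s, ∀ t ∈ a ^ n, t • r • x = 0 := by
    choose! n hn using h1
    refine ⟨s.sup n, fun r hr t ht => hn r (hs ▸ Submodule.subset_span hr) t (Ideal.pow_le_pow_right (Finset.le_sup hr) ht)⟩
  obtain ⟨n, hn⟩ := h2
  refine ⟨n + 1, fun r hr => ?_⟩
  rw [pow_succ] at hr
  induction hr using Submodule.mul_induction_on' with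
  | mem_mul_mem t ht r hr =>
    rw [← hs] at hr
    induction hr using Submodule.span_induction with
    | mem r hr => rw [mul_smul, hn r hr t ht]
    | zero => simp
    | add r r' _ _ h h' => rw [mul_add, add_smul, h, h', add_zero]
    | smul c r _ h => rw [smul_eq_mul, mul_left_comm, mul_smul, h, smul_zero]
  | add r _ r' _ h h' => rw [add_smul, h, h', add_zero]

theorem factV [IsAdicComplete (maximalIdeal S) S] {E : Type} [AddCommGroup E] [Module S E] (hE : IsDual S E)
    (a : Ideal S) (i : ℕ) : ∀ (N : Type) [AddCommGroup N] [Module S N] [Module.Finite S N] (k : ℕ)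
    (_ : maximalIdeal S ^ k ≤ a ⊔ Module.annihilator S N),
    Module.Finite S (LC a i N →ₗ[S] E) ∧ Kill (S := S) (LC a i N) (i + 1) := by
  by_cases ha : a = ⊤
  · intro N _ _ _ k _
    have h0 : LCv a i N := LC_top ha i
    constructor
    · have : Subsingleton (LC a i N →ₗ[S] E) := ⟨fun f g => LinearMap.ext fun x => by rw [h0 x, map_zero, map_zero]⟩
      infer_instance
    · intro P hP _
      exact ⟨1, fun h => hP.ne_top ((Ideal.eq_top_iff_one _).2 h), fun x => by rw [h0 x, smul_zero]⟩
  have ham : a ≤ maximalIdeal S := le_maximalIdeal ha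
  induction i with
  | zero =>
    intro N _ _ _ k hk
    have h1 : Module.Finite S (LC a 0 N) := Module.Finite.of_injective (LC0fun a N) LC0fun_inj
    have ht : IsTors (maximalIdeal S) (LC a 0 N) := LC_mtors hk
    obtain ⟨s, hs⟩ := h1.fg_top
    have h2 : ∃ n, ∀ r ∈ maximalIdeal S ^ n, ∀ x : LC a 0 N, r • x = 0 := by
      choose n hn using ht
      refine ⟨s.sup n, fun r hr x => ?_⟩
      have hx : x ∈ Submodule.span S (s : Set (LC a 0 N)) := by rw [hs]; trivial
      induction hx using Submodule.span_induction with
      | mem x hx => exact hn x r (Ideal.pow_le_pow_right (Finset.le_sup hx) hr)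
      | zero => simp
      | add x x' _ _ h h' => rw [smul_add, h, h', add_zero]
      | smul c x _ h => rw [smul_comm, h, smul_zero]
    obtain ⟨n, hn⟩ := h2
    refine ⟨hE.fin _ n hn, fun P hP hd => ?_⟩
    by_contra! hcon
    have h3 : maximalIdeal S ^ n ≤ P := fun r hr => by_contra fun h => by
      obtain ⟨x, hx⟩ := hcon r h
      exact hx (hn r hr x)
    have h4 : maximalIdeal S ≤ P := hP.le_of_pow_le h3
    have h5 : P = maximalIdeal S := le_antisymm (le_maximalIdeal hP.ne_top) h4
    subst h5
    have : ringKrullDim (S ⧸ maximalIdeal S) = 0 := by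
      letI := Ideal.Quotient.field (maximalIdeal S)
      exact ringKrullDim_eq_zero_of_field _
    rw [this] at hd
    norm_cast at hd
  | succ i ih =>
    intro N _ _ _ k hk
    obtain ⟨G, hG⟩ : ∃ G, G = Gam a N := ⟨_, rfl⟩
    have hGt : IsTors a G := by
      subst hG
      rintro ⟨x, n, hn⟩
      exact ⟨n, fun r hr => Subtype.ext (hn r hr)⟩
    have hinj : Function.Injective (LCmap a (i+1) G.mkQ) := by
      rw [injective_iff_map_eq_zero]
      intro x hx
      obtain ⟨z, rfl⟩ := (LC_exact2 _ _ (ses_sub G) G.injective_subtype G.mkQ_surjective x).1 hx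
      rw [LC_tors_vanish hGt z, map_zero]
    have hG0 : ∀ x : N ⧸ G, (∀ r ∈ a, r • x = 0) → x = 0 := by
      subst hG
      exact Gam_torsion_free
    have hk1 : maximalIdeal S ^ k ≤ a ⊔ Module.annihilator S (N ⧸ G) :=
      hk.trans (sup_le_sup_left (ann_le_of_surj G.mkQ G.mkQ_surjective) a)
    suffices hs : Module.Finite S (LC a (i+1) (N ⧸ G) →ₗ[S] E) ∧ Kill (S := S) (LC a (i+1) (N ⧸ G)) (i + 1 + 1) from
      ⟨fin_of_inj hE.inj _ hinj hs.1, kill_of_inj _ hinj hs.2⟩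
    obtain ⟨N1, _, _, hN1⟩ : ∃ (N1 : Type) (_ : AddCommGroup N1) (_ : Module S N1), Nonempty (N1 ≃ₗ[S] N ⧸ G) :=
      ⟨N ⧸ G, inferInstance, inferInstance, ⟨LinearEquiv.refl _ _⟩⟩
    have hsub : Subsingleton ((S ⧸ a) →ₗ[S] (N ⧸ G)) := by
      refine ⟨fun f g => ?_⟩
      have : ∀ f : (S ⧸ a) →ₗ[S] (N ⧸ G), f = 0 := by
        intro f
        apply Submodule.linearMap_qext
        apply LinearMap.ext_ring
        apply hG0
        intro r hr
        rw [← map_smul, LinearMap.comp_apply]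
        have : a.mkQ (r • 1) = 0 := by
          rw [Submodule.mkQ_apply, Submodule.Quotient.mk_eq_zero]; simpa using hr
        rw [this, map_zero]
      rw [this f, this g]
    obtain ⟨y, hya, hyr⟩ := IsSMulRegular.subsingleton_linearMap_iff.1 hsub
    rw [Ideal.annihilator_quotient] at hya
    let μ : (N ⧸ G) →ₗ[S] (N ⧸ G) := y • LinearMap.id
    have hμ : Function.Injective μ := hyr
    have hk2 : maximalIdeal S ^ k ≤ a ⊔ Module.annihilator S ((N ⧸ G) ⧸ LinearMap.range μ) :=
      hk1.trans (sup_le_sup_left (ann_le_of_surj (LinearMap.range μ).mkQ (LinearMap.range μ).mkQ_surjective) a)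
    obtain ⟨hf, hkl⟩ := ih _ k hk2
    refine dual_step hE (LC_mtors hk1) y (ham hya) (LCδ a i μ _ (ses_range μ) hμ (Submodule.mkQ_surjective _)) ?_ ?_ (i+1) hf hkl
    · intro x hx
      refine (LC_exact1 μ _ (ses_range μ) hμ (Submodule.mkQ_surjective _) x).1 ?_
      rw [LCmap_smul_id, hx]
    · intro z
      have := (LC_exact1 μ _ (ses_range μ) hμ (Submodule.mkQ_surjective _)).apply_apply_eq_zero z
      rwa [LCmap_smul_id] at this
end factV
end LCaux

open CategoryTheory
namespace LCaux
open Opposite Limits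

section stepA
open IsLocalRing
variable {R : Type} [CommRing R] [IsNoetherianRing R]

lemma Gam_sup {a : Ideal R} {y : R} {N : Type} [AddCommGroup N] [Module R N]
    (h : IsTors (Ideal.span {y}) N) (x : N) : x ∈ Gam (a ⊔ Ideal.span {y}) N ↔ x ∈ Gam a N := by
  constructor
  · rintro ⟨n, hn⟩
    exact ⟨n, fun r hr => hn r (Ideal.pow_right_mono le_sup_left n hr)⟩
  · rintro ⟨n, hn⟩
    obtain ⟨k, hk⟩ := h x
    refine ⟨n + k, fun r hr => ?_⟩
    obtain ⟨u, hu, v, hv, rfl⟩ := Submodule.mem_sup.1 (Ideal.sup_pow_add_le_pow_sup_pow hr)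
    rw [add_smul, hn u hu, hk v hv, add_zero]

lemma tors_compare (a : Ideal R) (y : R) (i : ℕ) : ∀ (W : Type) [AddCommGroup W] [Module R W],
    IsTors (Ideal.span {y}) W → LCv (a ⊔ Ideal.span {y}) i W → LCv a i W := by
  induction i with
  | zero =>
    intro W _ _ ht hv x
    apply LC0fun_inj
    have h1 := (LC0fun_range (a := a) (LC0fun a W x)).1 ⟨x, rfl⟩
    obtain ⟨z, hz⟩ := (LC0fun_range _).2 ((Gam_sup ht _).2 h1)
    rw [← hz, hv z, map_zero, map_zero]
  | succ i ih =>
    intro W _ _ ht hv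
    obtain ⟨J, _, _, _, f, hf, hJ⟩ := tors_embed ht
    have hq : IsTors (Ideal.span {y}) (J ⧸ LinearMap.range f) := hJ.quot _ (Submodule.mkQ_surjective _)
    cases i with
    | zero =>
      intro x
      obtain ⟨w, rfl⟩ := LC_surj_δ f _ (ses_range f) hf (Submodule.mkQ_surjective _)
        (fun x => LC_inj_vanish x) x
      have h1 := (LC0fun_range (a := a) (LC0fun a _ w)).1 ⟨w, rfl⟩
      obtain ⟨z, hz⟩ := (LC0fun_range _).2 ((Gam_sup hq _).2 h1)
      obtain ⟨u, rfl⟩ := (LC_exact3 f _ (ses_range f) hf (Submodule.mkQ_surjective _) z).1 (hv _)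
      rw [LC0fun_nat] at hz
      have h2 := (LC0fun_range (a := a ⊔ Ideal.span {y}) (LC0fun _ _ u)).1 ⟨u, rfl⟩
      obtain ⟨v, hv'⟩ := (LC0fun_range _).2 ((Gam_sup hJ _).1 h2)
      have : w = LCmap a 0 (LinearMap.range f).mkQ v := by
        apply LC0fun_inj
        rw [LC0fun_nat, hv', hz]
      rw [this]
      exact (LC_exact3 _ _ _ _ _).apply_apply_eq_zero v
    | succ i =>
      have h1 : LCv (a ⊔ Ideal.span {y}) (i+1) (J ⧸ LinearMap.range f) :=
        LCv_right f _ (ses_range f) hf (Submodule.mkQ_surjective _) (fun x => LC_inj_vanish x) hv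
      exact LCv_left f _ (ses_range f) hf (Submodule.mkQ_surjective _) (ih _ hq h1) (fun x => LC_inj_vanish x)

lemma dim_away [IsLocalRing R] (y : R) (hy : y ∈ maximalIdeal R) (c : ℕ) (hd : ringKrullDim R < (c + 1 : ℕ)) :
    ringKrullDim (Localization.Away y) < (c : ℕ) := by
  by_contra! h
  obtain ⟨l, hl⟩ := Order.le_krullDim_iff.1 h
  let f : PrimeSpectrum (Localization.Away y) → PrimeSpectrum R := PrimeSpectrum.comap (algebraMap R _)
  have hm : Monotone f := fun p q h => Ideal.comap_mono h
  have hs : StrictMono f := hm.strictMono_of_injective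
    (PrimeSpectrum.localization_comap_injective (Localization.Away y) (Submonoid.powers y))
  let l' := l.map f hs
  have hlt : l'.last < closedPoint R := by
    refine lt_of_le_of_ne (le_maximalIdeal l'.last.isPrime.ne_top) fun he => ?_
    have h1 : y ∈ l'.last.asIdeal := by rw [he]; exact hy
    have h2 : l'.last = f l.last := LTSeries.last_map _ _ _
    rw [h2] at h1
    exact l.last.isPrime.ne_top (Ideal.eq_top_of_isUnit_mem _ h1 (IsLocalization.Away.algebraMap_isUnit y))
  have h3 : ((c + 1 : ℕ) : WithBot ℕ∞) ≤ ringKrullDim R := by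
    refine Order.le_krullDim_iff.2 ⟨l'.snoc (closedPoint R) hlt, ?_⟩
    change l.length + 1 = _
    rw [hl]
  exact absurd hd (not_lt.2 h3)

lemma add_gen [IsLocalRing R] [IsDomain R] (a : Ideal R) (y : R) (hy : y ∈ maximalIdeal R) (c : ℕ)
    (hd : ringKrullDim R < (c + 2 : ℕ)) (hv : LCv (a ⊔ Ideal.span {y}) (c+1) R) : LCv a (c+1) R := by
  by_cases hy0 : y = 0
  · subst hy0
    simpa using hv
  have hN : IsNoetherianRing (Localization.Away y) :=
    IsLocalization.isNoetherianRing (Submonoid.powers y) _ inferInstance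
  let f : R →ₗ[R] Localization.Away y := Algebra.linearMap R _
  have hf : Function.Injective f :=
    IsLocalization.injective (M := Submonoid.powers y) _ (powers_le_nonZeroDivisors_of_noZeroDivisors hy0)
  have hyu : IsUnit (algebraMap R (Localization.Away y) y) := IsLocalization.Away.algebraMap_isUnit y
  have h1 : ∀ i, LCv (a ⊔ Ideal.span {y}) i (Localization.Away y) := fun i => by
    refine LC_bij_vanish y (Ideal.mem_sup_right (Ideal.mem_span_singleton_self y)) ?_
    have : (fun n : Localization.Away y => y • n) = fun n => (hyu.unit : Localization.Away y) * n := by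
      ext n; rw [Algebra.smul_def]; rfl
    rw [this]
    exact Units.mulLeft_bijective _
  have h2 := LCv_right f _ (ses_range f) hf (Submodule.mkQ_surjective _) (h1 c) hv
  have ht : IsTors (Ideal.span {y}) (Localization.Away y ⧸ LinearMap.range f) := by
    intro x
    obtain ⟨x, rfl⟩ := Submodule.mkQ_surjective _ x
    obtain ⟨⟨r, s⟩, hs⟩ := IsLocalization.surj (Submonoid.powers y) x
    obtain ⟨n, hn⟩ := s.2
    refine ⟨n, fun t ht => ?_⟩
    rw [Ideal.span_singleton_pow, Ideal.mem_span_singleton] at ht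
    obtain ⟨u, rfl⟩ := ht
    rw [← map_smul, Submodule.mkQ_apply, Submodule.Quotient.mk_eq_zero]
    refine ⟨u * r, ?_⟩
    change algebraMap R _ (u * r) = _
    rw [Algebra.smul_def, map_mul, map_mul, ← hs]
    simp only at hn
    rw [← hn]; ring
  refine LCv_left f _ (ses_range f) hf (Submodule.mkQ_surjective _) (tors_compare a y c _ ht h2) ?_
  rw [E6_vanish_iff (S := Localization.Away y)]
  refine Gvanish (c+1) _ ?_ _ le_rfl
  refine lt_of_le_of_lt ?_ (dim_away y hy (c+1) hd)
  exact ringKrullDim_quotient_le _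

lemma add_gens [IsLocalRing R] [IsDomain R] (c : ℕ) (hd : ringKrullDim R < (c + 2 : ℕ)) (s : Finset R)
    (hs : (s : Set R) ⊆ maximalIdeal R) : ∀ a : Ideal R, LCv (a ⊔ Ideal.span s) (c+1) R → LCv a (c+1) R := by
  classical
  induction s using Finset.induction_on with
  | empty => intro a h; simpa using h
  | insert y s _ ih =>
    intro a h
    rw [Finset.coe_insert, Set.insert_subset_iff] at hs
    refine add_gen a y hs.1 c hd (ih hs.2 _ ?_)
    rw [Finset.coe_insert, Ideal.span_insert] at h
    rwa [sup_assoc]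

lemma stepA [IsLocalRing R] [IsDomain R] (c : ℕ) (hd : ringKrullDim R < (c + 2 : ℕ)) (a : Ideal R)
    (ha : a ≤ maximalIdeal R) (hv : LCv (maximalIdeal R) (c+1) R) : LCv a (c+1) R := by
  obtain ⟨s, hs⟩ := IsNoetherian.noetherian (maximalIdeal R)
  refine add_gens c hd s (by rw [← hs]; exact Submodule.subset_span) a ?_
  have : Ideal.span (s : Set R) = maximalIdeal R := hs
  rwa [this, sup_eq_right.2 ha]
end stepA
end LCaux

open CategoryTheory
namespace LCaux
open Opposite Limits

section stepC
variable {R : Type} [CommRing R]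
variable {N N' N'' : Type} [AddCommGroup N] [Module R N] [AddCommGroup N'] [Module R N']
  [AddCommGroup N''] [Module R N'']

noncomputable def EXd (K : Type) [AddCommGroup K] [Module R K] (i : ℕ) (f : N →ₗ[R] N') (g : N' →ₗ[R] N'')
    (h : Function.Exact f g) (hf : Function.Injective f) (hg : Function.Surjective g) :
    EX (R := R) N K i →ₗ[R] EX (R := R) N'' K (i+1) :=
  (EXcl f g h hf hg).precompOfLinear R (ModuleCat.of R K) (add_comm 1 i)

lemma EXd_surj (K : Type) [AddCommGroup K] [Module R K] (i : ℕ) (f : N →ₗ[R] N') (g : N' →ₗ[R] N'')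
    (h : Function.Exact f g) (hf : Function.Injective f) (hg : Function.Surjective g) [hP : Module.Projective R N'] :
    Function.Surjective (EXd K i f g h hf hg) := by
  intro z
  have : Projective (ModuleCat.of R N') := (IsProjective.iff_projective N').1 hP
  exact Abelian.Ext.contravariant_sequence_exact₃ (sesC_se f g h hf hg) (ModuleCat.of R K) z
    (@Abelian.Ext.eq_zero_of_projective _ _ _ _ (ModuleCat.of R N') _ _ this _) (add_comm 1 i)

lemma EXd_pre (K : Type) [AddCommGroup K] [Module R K] (i : ℕ) (f : N →ₗ[R] N') (g : N' →ₗ[R] N'')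
    (h : Function.Exact f g) (hf : Function.Injective f) (hg : Function.Surjective g) (x : EX (R := R) N' K i) :
    EXd K i f g h hf hg (EXpre K i f x) = 0 :=
  (sesC_se f g h hf hg).extClass_comp_assoc x (h := add_comm 1 i)

variable {b : Ideal R} {c : ℕ}

lemma LCmap_sum {ι : Type} (s : Finset ι) (f : ι → (N →ₗ[R] N')) (x : LC b c N) :
    LCmap b c (∑ k ∈ s, f k) x = ∑ k ∈ s, LCmap b c (f k) x := by
  classical
  induction s using Finset.induction_on with
  | empty => simp [LCmap_zero]
  | insert k s hk ih => rw [Finset.sum_insert hk, Finset.sum_insert hk, LCmap_add, ih]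

lemma LC_pi_sum (n : ℕ) (x : LC b c (Fin n → R)) :
    x = ∑ k, LCmap b c (LinearMap.toSpanSingleton R (Fin n → R) (Pi.single k 1)) (LCmap b c (LinearMap.proj k) x) := by
  have h1 : (LinearMap.id : (Fin n → R) →ₗ[R] (Fin n → R)) =
      ∑ k, (LinearMap.toSpanSingleton R (Fin n → R) (Pi.single k 1)) ∘ₗ (LinearMap.proj k) := by
    refine LinearMap.ext fun v => ?_
    rw [LinearMap.sum_apply]
    simp only [LinearMap.comp_apply, LinearMap.toSpanSingleton_apply, LinearMap.proj_apply, LinearMap.id_apply]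
    exact pi_eq_sum_univ' v
  conv_lhs => rw [← LCmap_id x, h1, LCmap_sum]
  exact Finset.sum_congr rfl fun k _ => LCmap_comp _ _ _

lemma LC_pi_kill (n : ℕ) (d : R) (h : ∀ x : LC b c R, d • x = 0) (x : LC b c (Fin n → R)) : d • x = 0 := by
  rw [LC_pi_sum n x, Finset.smul_sum]
  refine Finset.sum_eq_zero fun k _ => ?_
  rw [← map_smul, h, map_zero]

/-- theta map -/
noncomputable def theta {E : Type} [AddCommGroup E] [Module R E] (φ : LC b c N →ₗ[R] E) :
    N →ₗ[R] (LC b c R →ₗ[R] E) where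
  toFun n := φ ∘ₗ LCmap b c (LinearMap.toSpanSingleton R N n)
  map_add' n n' := by
    refine LinearMap.ext fun x => ?_
    have : LinearMap.toSpanSingleton R N (n + n') = LinearMap.toSpanSingleton R N n + LinearMap.toSpanSingleton R N n' := by
      refine LinearMap.ext fun r => ?_
      simp
    rw [LinearMap.comp_apply, this, LCmap_add, map_add]; rfl
  map_smul' r n := by
    refine LinearMap.ext fun x => ?_
    have : LinearMap.toSpanSingleton R N (r • n) = LinearMap.toSpanSingleton R N n ∘ₗ (r • LinearMap.id) := by
      refine LinearMap.ext fun s => ?_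
      simp [smul_smul, mul_comm]
    rw [LinearMap.comp_apply, this, LCmap_comp, LCmap_smul_id, map_smul, map_smul]; rfl

lemma theta_apply {E : Type} [AddCommGroup E] [Module R E] (φ : LC b c N →ₗ[R] E) (n : N) (x : LC b c R) :
    theta φ n x = φ (LCmap b c (LinearMap.toSpanSingleton R N n) x) := rfl

lemma theta_nat {E : Type} [AddCommGroup E] [Module R E] (f : N →ₗ[R] N') (φ : LC b c N' →ₗ[R] E) :
    theta (φ ∘ₗ LCmap b c f) = theta φ ∘ₗ f := by
  refine LinearMap.ext fun n => LinearMap.ext fun x => ?_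
  have h1 : LinearMap.toSpanSingleton R N' (f n) = f ∘ₗ LinearMap.toSpanSingleton R N n :=
    LinearMap.ext fun r => by simp
  rw [LinearMap.comp_apply, theta_apply, theta_apply, LinearMap.comp_apply, ← LCmap_comp, h1]

lemma theta_smul {E : Type} [AddCommGroup E] [Module R E] (e : R) (φ : LC b c N →ₗ[R] E) :
    theta (e • φ) = e • theta φ := by
  refine LinearMap.ext fun n => LinearMap.ext fun x => ?_
  rw [theta_apply, LinearMap.smul_apply, LinearMap.smul_apply, LinearMap.smul_apply, theta_apply]

variable [IsNoetherianRing R]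

lemma dimq (hd : ringKrullDim R < (c + 1 : ℕ)) (I : Ideal R) : ringKrullDim (R ⧸ I) < (c + 1 : ℕ) :=
  (ringKrullDim_quotient_le I).trans_lt hd

lemma theta_inj (hd : ringKrullDim R < (c + 1 : ℕ)) [Module.Finite R N] {E : Type} [AddCommGroup E] [Module R E]
    (φ : LC b c N →ₗ[R] E) (h : theta φ = 0) : φ = 0 := by
  obtain ⟨n, g, hg⟩ := Module.Finite.exists_fin' R N
  refine LinearMap.ext fun x => ?_
  obtain ⟨x, rfl⟩ := top_surj c (dimq hd _) g hg x
  rw [LC_pi_sum n x, map_sum, map_sum]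
  refine Finset.sum_eq_zero fun k _ => ?_
  have h1 : theta (φ ∘ₗ LCmap b c g) = 0 := by rw [theta_nat, h]; rfl
  have h2 := LinearMap.congr_fun (LinearMap.congr_fun h1 (Pi.single k 1)) (LCmap b c (LinearMap.proj k) x)
  exact h2

lemma theta_surj_pi {E : Type} [AddCommGroup E] [Module R E] (n : ℕ) (g : (Fin n → R) →ₗ[R] (LC b c R →ₗ[R] E)) :
    ∃ φ : LC b c (Fin n → R) →ₗ[R] E, theta φ = g := by
  refine ⟨∑ k, (g (Pi.single k 1)) ∘ₗ LCmap b c (LinearMap.proj k), ?_⟩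
  refine LinearMap.ext fun v => LinearMap.ext fun x => ?_
  rw [theta_apply, LinearMap.sum_apply]
  have h1 : ∀ k, ((g (Pi.single k 1)) ∘ₗ LCmap b c (LinearMap.proj k)) (LCmap b c (LinearMap.toSpanSingleton R (Fin n → R) v) x)
      = (v k • g (Pi.single k 1)) x := by
    intro k
    have h2 : LinearMap.proj k ∘ₗ LinearMap.toSpanSingleton R (Fin n → R) v = v k • (LinearMap.id : R →ₗ[R] R) :=
      LinearMap.ext fun r => by simp [mul_comm]
    rw [LinearMap.comp_apply, ← LCmap_comp, LinearMap.smul_apply, h2, LCmap_smul_id, LinearMap.map_smul]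
  rw [Finset.sum_congr rfl fun k _ => h1 k, ← LinearMap.sum_apply]
  have h3 : g v = ∑ k, v k • g (Pi.single k 1) := by
    conv_lhs => rw [pi_eq_sum_univ' v, map_sum]
    exact Finset.sum_congr rfl fun k _ => g.map_smul _ _
  rw [h3]

lemma theta_surj (hd : ringKrullDim R < (c + 1 : ℕ)) [Module.Finite R N] {E : Type} [AddCommGroup E] [Module R E]
    (hE : Module.Injective R E) (g : N →ₗ[R] (LC b c R →ₗ[R] E)) :
    ∃ φ : LC b c N →ₗ[R] E, theta φ = g := by
  obtain ⟨n, π, hπ⟩ := Module.Finite.exists_fin' R N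
  obtain ⟨ψ, hψ⟩ := theta_surj_pi n (g ∘ₗ π)
  have h0 : ψ ∘ₗ LCmap b c (LinearMap.ker π).subtype = 0 := by
    apply theta_inj hd
    rw [theta_nat, hψ]
    refine LinearMap.ext fun l => ?_
    rw [LinearMap.comp_apply, LinearMap.comp_apply]
    have : π ((LinearMap.ker π).subtype l) = 0 := l.2
    rw [this, map_zero]; rfl
  have hex : Function.Exact (LinearMap.ker π).subtype π := by rw [LinearMap.exact_iff, Submodule.range_subtype]
  obtain ⟨φ, hφ⟩ := inj_extend (J := E) (LCmap b c π) ψ (by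
    intro x hx
    obtain ⟨y, rfl⟩ := (LC_exact2 _ _ hex Subtype.val_injective hπ x).1 hx
    exact LinearMap.congr_fun h0 y)
  refine ⟨φ, LinearMap.ext fun v => ?_⟩
  obtain ⟨v, rfl⟩ := hπ v
  have h1 : φ ∘ₗ LCmap b c π = ψ := LinearMap.ext hφ
  have h2 := theta_nat π φ
  rw [h1, hψ] at h2
  exact (LinearMap.congr_fun h2 v).symm

lemma ext_base (hd : ringKrullDim R < (c + 2 : ℕ)) {E : Type} [AddCommGroup E] [Module R E]
    (hE : Module.Injective R E) {O F X : Type} [AddCommGroup O] [Module R O] [AddCommGroup F] [Module R F]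
    [AddCommGroup X] [Module R X] [Module.Finite R O] [Module.Projective R F]
    (f : O →ₗ[R] F) (g : F →ₗ[R] X) (h : Function.Exact f g) (hf : Function.Injective f) (hg : Function.Surjective g)
    (e : R) (hX : ∀ x : LC b c X, e • x = 0) (z : EX (R := R) X (LC b (c+1) R →ₗ[R] E) (0+1)) : e • z = 0 := by
  obtain ⟨w, rfl⟩ := EXd_surj _ 0 f g h hf hg z
  obtain ⟨φ, hφ⟩ := theta_surj (b := b) (c := c+1) hd hE (EX0 w)
  obtain ⟨ψ, hψ⟩ := inj_extend (J := E) (LCmap b (c+1) f) (e • φ) (by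
    intro x hx
    obtain ⟨y, rfl⟩ := (LC_exact1 f g h hf hg x).1 hx
    rw [LinearMap.mem_ker, LinearMap.smul_apply, ← LinearMap.map_smul, ← LinearMap.map_smul, hX, map_zero, map_zero])
  have h1 : ψ ∘ₗ LCmap b (c+1) f = e • φ := LinearMap.ext hψ
  have h2 : e • EX0 w = theta ψ ∘ₗ f := by
    rw [← theta_nat, h1, theta_smul, hφ]
  have h3 : e • w = EXpre _ 0 f (EX0.symm (theta ψ)) := by
    apply EX0.injective
    rw [EX0_pre, LinearEquiv.apply_symm_apply, LinearEquiv.map_smul, h2]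
  rw [← LinearMap.map_smul, h3, EXd_pre]

lemma ext_kill [IsDomain R] (hd : ringKrullDim R < (c + 1 : ℕ)) {E : Type} [AddCommGroup E] [Module R E]
    (hE : Module.Injective R E) (hk : ∀ i < c, ∃ d : R, d ≠ 0 ∧ ∀ x : LC b i R, d • x = 0) (j : ℕ) :
    ∀ i, i + (j + 1) = c → ∀ e : R, e ≠ 0 → ∃ e' : R, e' ≠ 0 ∧ ∀ (X : Type) [AddCommGroup X] [Module R X]
      [Module.Finite R X], (∀ x : LC b i X, e • x = 0) → ∀ z : EX (R := R) X (LC b c R →ₗ[R] E) (j+1), e' • z = 0 := by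
  induction j with
  | zero =>
    intro i hi e he
    obtain rfl : c = i + 1 := by omega
    refine ⟨e, he, fun X _ _ _ hX z => ?_⟩
    obtain ⟨n, π, hπ⟩ := Module.Finite.exists_fin' R X
    have hex : Function.Exact (LinearMap.ker π).subtype π := by rw [LinearMap.exact_iff, Submodule.range_subtype]
    exact ext_base (c := i) hd hE (LinearMap.ker π).subtype π hex Subtype.val_injective hπ e hX z
  | succ j ih =>
    intro i hi e he
    obtain ⟨d, hd0, hdk⟩ := hk (i+1) (by omega)
    obtain ⟨e', he', hk'⟩ := ih (i+1) (by omega) (e * d) (mul_ne_zero he hd0)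
    refine ⟨e', he', fun X _ _ _ hX z => ?_⟩
    obtain ⟨n, π, hπ⟩ := Module.Finite.exists_fin' R X
    have hex : Function.Exact (LinearMap.ker π).subtype π := by rw [LinearMap.exact_iff, Submodule.range_subtype]
    obtain ⟨w, rfl⟩ := EXd_surj _ (j+1) _ π hex Subtype.val_injective hπ z
    have hO : ∀ x : LC b (i+1) (LinearMap.ker π), (e * d) • x = 0 := by
     intro x
     obtain ⟨y, hy⟩ := (LC_exact1 _ _ hex Subtype.val_injective hπ (d • x)).1 (by
      rw [LinearMap.map_smul, LC_pi_kill n d hdk])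
     rw [mul_smul, ← hy, ← LinearMap.map_smul, hX, map_zero]
    rw [← LinearMap.map_smul, hk' _ hO, map_zero]
end stepC
end LCaux

open CategoryTheory
namespace LCaux
open Opposite Limits

section chev
open IsLocalRing
variable {D : Type} [CommRing D] [IsNoetherianRing D] [IsLocalRing D]

lemma artin_of_kill (k : ℕ) (N : Type) [AddCommGroup N] [Module D N] [hN : Module.Finite D N]
    (hk : ∀ r ∈ maximalIdeal D ^ k, ∀ x : N, r • x = 0) : IsArtinian D N := by
  revert hk
  induction hN using IsNoetherianRing.induction_on_isQuotientEquivQuotientPrime D with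
  | subsingleton N => exact fun _ => inferInstance
  | quotient N p f =>
    intro hk
    have hp : p.asIdeal = maximalIdeal D := by
      refine le_antisymm (le_maximalIdeal p.2.ne_top) (p.2.le_of_pow_le (n := k) ?_)
      intro r hr
      have h1 := hk r hr (f.symm (Ideal.Quotient.mk _ 1))
      rw [← map_smul, LinearEquiv.map_eq_zero_iff] at h1
      have h2 : r • Ideal.Quotient.mk p.asIdeal 1 = Ideal.Quotient.mk p.asIdeal (r * 1) := rfl
      rwa [h2, mul_one, Ideal.Quotient.eq_zero_iff_mem] at h1
    have hs : IsSimpleModule D (D ⧸ p.asIdeal) := by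
      rw [hp]
      exact isSimpleModule_iff_isCoatom.2 (maximalIdeal.isMaximal D).out
    exact isArtinian_of_linearEquiv f.symm
  | exact N₁ N₂ N₃ f g hf hg h h1 h3 =>
    intro hk
    have := h1 fun r hr x => hf (by rw [map_smul, hk r hr, map_zero])
    have := h3 fun r hr x => by
      obtain ⟨x, rfl⟩ := hg x
      rw [← map_smul, hk r hr, map_zero]
    exact isArtinian_of_range_eq_ker f g (LinearMap.exact_iff.1 h).symm

lemma closed_ideal (J : Ideal D) (z : D) (h : ∀ j : ℕ, z ∈ J ⊔ maximalIdeal D ^ j) : z ∈ J := by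
  have h1 := Ideal.iInf_pow_smul_eq_bot_of_isLocalRing (M := D ⧸ J) (maximalIdeal D) (maximalIdeal.isMaximal D).ne_top
  rw [← Ideal.Quotient.eq_zero_iff_mem]
  have h2 : Ideal.Quotient.mk J z ∈ (⨅ i : ℕ, maximalIdeal D ^ i • ⊤ : Submodule D (D ⧸ J)) := by
    rw [Submodule.mem_iInf]
    intro j
    obtain ⟨u, hu, v, hv, rfl⟩ := Submodule.mem_sup.1 (h j)
    rw [map_add, Ideal.Quotient.eq_zero_iff_mem.2 hu, zero_add]
    have h3 : Ideal.Quotient.mk J v = v • Ideal.Quotient.mk J 1 := by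
      have h2 : v • Ideal.Quotient.mk J 1 = Ideal.Quotient.mk J (v * 1) := rfl
      rw [h2, mul_one]
    rw [h3]
    exact Submodule.smul_mem_smul hv trivial
  rw [h1] at h2
  exact h2

lemma chev [IsPrecomplete (maximalIdeal D) D] (a : Ideal D) (ha : a ≤ maximalIdeal D) (T : ℕ → Ideal D)
    (hT : Antitone T) (h1 : ∀ n, a ^ n ≤ T n) (h2 : ⨅ n, T n = ⊥)
    (h3 : ∀ n, ∃ N, ∀ n' ≥ N, T N ≤ T n' ⊔ a ^ n) (n : ℕ) : ∃ n', T n' ≤ a ^ n := by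
  have h4 : ∀ k, ∃ M, k ≤ M ∧ ∀ n', T M ≤ T n' ⊔ a ^ k := by
    intro k
    obtain ⟨N, hN⟩ := h3 k
    refine ⟨max k N, le_max_left _ _, fun n' => ?_⟩
    refine (hT (le_max_right k N)).trans ((hN (max n' N) (le_max_right _ _)).trans ?_)
    exact sup_le_sup_right (hT (le_max_left _ _)) _
  choose M hM hM' using h4
  by_contra! hcon
  obtain ⟨x0, hx0, hx0'⟩ := SetLike.not_le_iff_exists.1 (hcon (M n))
  have hst : ∀ j (x : T (M (n + j))), ∃ y : T (M (n + (j + 1))), (x : D) - y ∈ a ^ (n + j) := by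
    intro j x
    obtain ⟨u, hu, v, hv, huv⟩ := Submodule.mem_sup.1 (hM' (n+j) (M (n + (j+1))) x.2)
    exact ⟨⟨u, hu⟩, by rw [← huv]; simpa using hv⟩
  choose F hF using hst
  let x : ∀ j, T (M (n + j)) := fun j => Nat.rec (motive := fun j => T (M (n + j))) ⟨x0, hx0⟩ (fun j y => F j y) j
  have hx : ∀ j, (x j : D) - x (j+1) ∈ a ^ (n + j) := fun j => hF j (x j)
  have hxx : ∀ i j, i ≤ j → (x i : D) - x j ∈ a ^ (n + i) := by
    intro i j hij
    induction j, hij using Nat.le_induction with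
    | base => simp
    | succ j hj ih =>
      have := Ideal.add_mem _ ih (Ideal.pow_le_pow_right (by omega) (hx j))
      simpa using this
  have ham : ∀ k, a ^ k ≤ maximalIdeal D ^ k := fun k => Ideal.pow_right_mono ha k
  obtain ⟨L, hL⟩ := IsPrecomplete.prec (I := maximalIdeal D) (M := D) inferInstance (f := fun j => (x j : D)) (by
    intro i j hij
    rw [SModEq.sub_mem, smul_eq_mul, Ideal.mul_top]
    exact Ideal.pow_le_pow_right (by omega) (ham _ (hxx i j hij)))
  simp only [SModEq.sub_mem, smul_eq_mul, Ideal.mul_top] at hL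
  have hLx : ∀ i, (x i : D) - L ∈ a ^ (n + i) := by
    intro i
    apply closed_ideal
    intro j
    have e1 : (x i : D) - L = (x i - x (max i j)) + (x (max i j) - L) := by ring
    rw [e1]
    exact Ideal.add_mem _ (Ideal.mem_sup_left (hxx _ _ (le_max_left _ _)))
      (Ideal.mem_sup_right (Ideal.pow_le_pow_right (le_max_right _ _) (hL _)))
  have hL0 : L ∈ ⨅ k, T k := by
    rw [Submodule.mem_iInf]
    intro k
    have e1 : L = x k - (x k - L) := by ring
    rw [e1]
    refine Ideal.sub_mem _ (hT ?_ (x k).2) (hT ?_ (h1 _ (hLx k)))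
    · exact le_trans (by omega) (hM (n+k))
    · omega
  rw [h2, Ideal.mem_bot] at hL0
  apply hx0'
  have h9 := hLx 0
  rw [hL0, sub_zero] at h9
  exact h9

/-- saturation -/
def sat (a : Ideal D) (n : ℕ) : Ideal D := (Gam (maximalIdeal D) (D ⧸ a ^ n)).comap (Submodule.mkQ (a ^ n))

lemma mem_sat {a : Ideal D} {n : ℕ} {r : D} : r ∈ sat a n ↔ ∃ k, ∀ s ∈ maximalIdeal D ^ k, s * r ∈ a ^ n := by
  unfold sat
  rw [Submodule.mem_comap, Gam_mem]
  refine exists_congr fun k => forall₂_congr fun s _ => ?_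
  rw [← map_smul, Submodule.mkQ_apply, Submodule.Quotient.mk_eq_zero, smul_eq_mul]

lemma le_sat (a : Ideal D) (n : ℕ) : a ^ n ≤ sat a n := fun r hr => mem_sat.2 ⟨0, fun s _ => Ideal.mul_mem_left _ s hr⟩

lemma sat_anti (a : Ideal D) : Antitone (sat a) := fun n n' h r hr => by
  obtain ⟨k, hk⟩ := mem_sat.1 hr
  exact mem_sat.2 ⟨k, fun s hs => Ideal.pow_le_pow_right h (hk s hs)⟩

lemma sat_LC0 (a : Ideal D) (n : ℕ) : LCv (maximalIdeal D) 0 (D ⧸ sat a n) := by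
  have h1 : ∀ x : D, (∀ r ∈ maximalIdeal D, r * x ∈ sat a n) → x ∈ sat a n := by
    intro x hx
    have : (Submodule.mkQ (Gam (maximalIdeal D) (D ⧸ a ^ n))) (Submodule.mkQ (a ^ n) x) = 0 := by
      apply Gam_torsion_free
      intro r hr
      rw [← map_smul, ← map_smul, Submodule.mkQ_apply, Submodule.Quotient.mk_eq_zero]
      exact hx r hr
    rw [Submodule.mkQ_apply, Submodule.Quotient.mk_eq_zero] at this
    exact this
  have h2 : ∀ k, ∀ x : D, (∀ r ∈ maximalIdeal D ^ k, r * x ∈ sat a n) → x ∈ sat a n := by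
    intro k
    induction k with
    | zero => intro x hx; simpa using hx 1 (by simp)
    | succ k ih =>
      intro x hx
      apply h1
      intro r hr
      apply ih
      intro s hs
      rw [← mul_assoc]
      exact hx _ (by rw [pow_succ]; exact Ideal.mul_mem_mul hs hr)
  intro x
  apply LC0fun_inj
  rw [map_zero]
  obtain ⟨k, hk⟩ := (LC0fun_range (a := maximalIdeal D) (LC0fun _ _ x)).1 ⟨x, rfl⟩
  obtain ⟨z, hz⟩ := Ideal.Quotient.mk_surjective (LC0fun _ _ x)
  rw [← hz] at hk ⊢
  rw [Ideal.Quotient.eq_zero_iff_mem]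
  refine h2 k z fun r hr => ?_
  have h3 : r • Ideal.Quotient.mk (sat a n) z = Ideal.Quotient.mk (sat a n) (r * z) := rfl
  have := hk r hr
  rwa [h3, Ideal.Quotient.eq_zero_iff_mem] at this

lemma sat_iInf [IsDomain D] (a : Ideal D) (h : ¬ ∃ k, maximalIdeal D ^ k ≤ a) : ⨅ n, sat a n = ⊥ := by
  have h1 : ∃ P : Ideal D, P.IsPrime ∧ a ≤ P ∧ P ≠ maximalIdeal D := by
    by_contra! hc
    exact h (pow_le_of_primes a fun P h1 h2 => hc P h1 h2)
  obtain ⟨P, hP, haP, hPm⟩ := h1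
  obtain ⟨s, hs, hsP⟩ : ∃ s ∈ maximalIdeal D, s ∉ P := by
    by_contra! hc
    exact hPm (le_antisymm (le_maximalIdeal hP.ne_top) hc)
  rw [eq_bot_iff]
  intro r hr
  rw [Submodule.mem_iInf] at hr
  have : IsNoetherianRing (Localization.AtPrime P) := IsLocalization.isNoetherianRing P.primeCompl _ inferInstance
  have h2 := Ideal.iInf_pow_eq_bot_of_isLocalRing (maximalIdeal (Localization.AtPrime P)) (maximalIdeal.isMaximal _).ne_top
  have h3 : algebraMap D (Localization.AtPrime P) r ∈ (⨅ i : ℕ, maximalIdeal (Localization.AtPrime P) ^ i) := by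
    rw [Submodule.mem_iInf]
    intro n
    obtain ⟨k, hk⟩ := mem_sat.1 (hr n)
    have h4 := hk (s ^ k) (Ideal.pow_mem_pow hs k)
    have h5 : algebraMap D (Localization.AtPrime P) (s ^ k * r) ∈ maximalIdeal (Localization.AtPrime P) ^ n := by
      rw [← Localization.AtPrime.map_eq_maximalIdeal, ← Ideal.map_pow]
      exact Ideal.mem_map_of_mem _ (Ideal.pow_right_mono haP n h4)
    rw [map_mul] at h5
    refine (Ideal.unit_mul_mem_iff_mem _ ?_).1 h5
    exact IsLocalization.map_units (Localization.AtPrime P) (⟨s ^ k, fun h => hsP (hP.mem_of_pow_mem k h)⟩ : P.primeCompl)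
  rw [h2, Ideal.mem_bot] at h3
  exact (IsLocalization.injective (M := P.primeCompl) (Localization.AtPrime P) P.primeCompl_le_nonZeroDivisors)
    (h3.trans (map_zero _).symm)

lemma sat_stab (a : Ideal D) (n : ℕ) : ∃ N, ∀ n' ≥ N, sat a N ≤ sat a n' ⊔ a ^ n := by
  obtain ⟨G, hG⟩ : ∃ G, G = Gam (maximalIdeal D) (D ⧸ a ^ n) := ⟨_, rfl⟩
  have hk : ∃ k, ∀ r ∈ maximalIdeal D ^ k, ∀ x : G, r • x = 0 := by
    have ht : ∀ x : G, ∃ k, ∀ r ∈ maximalIdeal D ^ k, r • x = 0 := by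
      subst hG
      rintro ⟨x, k, hk⟩
      exact ⟨k, fun r hr => Subtype.ext (hk r hr)⟩
    have hfin : Module.Finite D (↥G) := Module.IsNoetherian.finite D _
    obtain ⟨s, hs⟩ := hfin.fg_top
    choose k hk using ht
    refine ⟨s.sup k, fun r hr x => ?_⟩
    have hx : x ∈ Submodule.span D (s : Set G) := by rw [hs]; trivial
    induction hx using Submodule.span_induction with
    | mem x hx => exact hk x r (Ideal.pow_le_pow_right (Finset.le_sup hx) hr)
    | zero => simp
    | add x x' _ _ h h' => rw [smul_add, h, h', add_zero]
    | smul c x _ h => rw [smul_comm, h, smul_zero]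
  obtain ⟨k, hk⟩ := hk
  have hA : IsArtinian D G := artin_of_kill k G hk
  let f : ℕ →o (Submodule D G)ᵒᵈ := ⟨fun n' => OrderDual.toDual ((Submodule.map (Submodule.mkQ (a ^ n)) (sat a n')).comap G.subtype),
    fun i j h => Submodule.comap_mono (Submodule.map_mono (sat_anti a h))⟩
  obtain ⟨N0, hN0⟩ := IsArtinian.monotone_stabilizes f
  refine ⟨max N0 n, fun n' hn' x hx => ?_⟩
  have hxG : Submodule.mkQ (a ^ n) x ∈ G := by
    rw [hG]
    exact sat_anti a (le_max_right N0 n) hx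
  have h1 : f (max N0 n) = f n' := by
    rw [← hN0 _ (le_max_left _ _), ← hN0 n' (le_trans (le_max_left _ _) hn')]
  have h2 : (⟨_, hxG⟩ : G) ∈ OrderDual.ofDual (f (max N0 n)) := Submodule.mem_map_of_mem hx
  rw [h1] at h2
  obtain ⟨u, hu, hux⟩ := Submodule.mem_map.1 (Submodule.mem_comap.1 h2)
  have h3 : x - u ∈ a ^ n := by
    rw [← Submodule.Quotient.mk_eq_zero, ← Submodule.mkQ_apply, map_sub, hux]
    exact sub_self _
  rw [show x = u + (x - u) by ring]
  exact Ideal.add_mem _ (Ideal.mem_sup_left hu) (Ideal.mem_sup_right h3)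

lemma sat_cofinal [IsDomain D] [IsPrecomplete (maximalIdeal D) D] (a : Ideal D) (ha : a ≤ maximalIdeal D)
    (h : ¬ ∃ k, maximalIdeal D ^ k ≤ a) (n : ℕ) : ∃ n', sat a n' ≤ a ^ n :=
  chev a ha (sat a) (sat_anti a) (le_sat a) (sat_iInf a h) (sat_stab a) n

end chev
end LCaux

open CategoryTheory
namespace LCaux
open Opposite Limits

section c1
open IsLocalRing
variable {D : Type} [CommRing D] [IsNoetherianRing D] [IsLocalRing D]

lemma lc_kill_of_sat (a : Ideal D) (c : ℕ) (K : Type) [AddCommGroup K] [Module D K] (e : D)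
    (hcof : ∀ n, ∃ n', sat a n' ≤ a ^ n)
    (he : ∀ n, ∀ z : EX (R := D) (D ⧸ sat a n) K c, e • z = 0) (x : LC a c K) : e • x = 0 := by
  obtain ⟨n, z, rfl⟩ := LC_exists a c K x
  obtain ⟨n0, h0⟩ := hcof n
  obtain ⟨n', hn', h1⟩ : ∃ n', n ≤ n' ∧ sat a n' ≤ a ^ n :=
    ⟨max n n0, le_max_left _ _, (sat_anti a (le_max_right _ _)).trans h0⟩
  rw [← LCof_t hn' z, ← LinearMap.map_smul]
  have h2 : LCt a c K n n' hn' z = EXpre K c (Submodule.factor (le_sat a n')) (EXpre K c (Submodule.factor h1) z) := by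
    rw [← EXpre_comp]
    have h3 : (Submodule.factor h1) ∘ₗ (Submodule.factor (le_sat a n')) =
        Submodule.factor (Ideal.pow_le_pow_right hn' : a ^ n' ≤ a ^ n) := by
      refine LinearMap.ext fun x => ?_
      obtain ⟨x, rfl⟩ := Submodule.mkQ_surjective _ x
      rfl
    rw [h3]
    rfl
  rw [h2, ← LinearMap.map_smul, he, map_zero, map_zero]

lemma dim_bot : ringKrullDim (D ⧸ (⊥ : Ideal D)) = ringKrullDim D :=
  ringKrullDim_eq_of_ringEquiv (RingEquiv.quotientBot D)

lemma LCv_bot {a : Ideal D} {c : ℕ} : LCv a c (D ⧸ (⊥ : Ideal D)) ↔ LCv a c D :=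
  ⟨LCv_equiv (Submodule.quotEquivOfEqBot ⊥ rfl), LCv_equiv (Submodule.quotEquivOfEqBot ⊥ rfl).symm⟩

lemma top_div [IsDomain D] (a : Ideal D) (c : ℕ) (hd : ringKrullDim D < (c + 1 : ℕ)) (y : D) (hy : y ≠ 0)
    (x : LC a c D) : ∃ x', y • x' = x := by
  have hinj : Function.Injective (y • (LinearMap.id : D →ₗ[D] D)) := by
    intro u v h
    simpa [hy] using h
  obtain ⟨x', hx'⟩ := LC_surj_left (a := a) (i := c) _ _ (ses_range (y • (LinearMap.id : D →ₗ[D] D))) hinj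
    (Submodule.mkQ_surjective _) (Gvanish c _ (dim_drop (Ideal.isPrime_bot) (y := y) (by simpa using hy) bot_le
      (smul_coker_ann y) (by rw [dim_bot]; exact hd)) _ le_rfl) x
  exact ⟨x', by rw [← hx', LCmap_smul_id]⟩

lemma C1dom [IsDomain D] [IsAdicComplete (maximalIdeal D) D] (a : Ideal D) (c : ℕ)
    (hd : ringKrullDim D < (c + 1 : ℕ)) (hv : ¬ LCv a c D) : ∃ k, maximalIdeal D ^ k ≤ a := by
  by_contra hno
  have hane : a ≠ ⊤ := fun h => hv (LC_top h c)
  have ha : a ≤ maximalIdeal D := le_maximalIdeal hane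
  cases c with
  | zero =>
    apply hno
    refine ⟨1, ?_⟩
    have : ∀ y ∈ maximalIdeal D, y = 0 := by
      intro y hy
      by_contra hy0
      have := dim_drop (P := (⊥ : Ideal D)) Ideal.isPrime_bot (y := y) (I := maximalIdeal D) (by simpa using hy0) bot_le hy
        (n := 0) (by rw [dim_bot]; exact hd)
      exact absurd this (not_lt.2 (by exact_mod_cast ringKrullDim_nonneg_of_nontrivial))
    rw [pow_one]
    intro y hy
    rw [this y hy]; exact a.zero_mem
  | succ c' =>
    have hvm : ¬ LCv (maximalIdeal D) (c'+1) D := fun h => hv (stepA c' (by exact_mod_cast hd) a ha h)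
    obtain ⟨E, _, _, hE⟩ := exists_dual (S := D)
    obtain ⟨K, hK⟩ : ∃ K, K = (LC (maximalIdeal D) (c'+1) D →ₗ[D] E) := ⟨_, rfl⟩
    have hdim : ((c' + 1 : ℕ) : WithBot ℕ∞) ≤ ringKrullDim D := by
      by_contra h
      push Not at h
      exact hvm (Gvanish (c'+1) _ ((ringKrullDim_quotient_le _).trans_lt h) _ le_rfl)
    have hfin : Module.Finite D (LC (maximalIdeal D) (c'+1) D →ₗ[D] E) :=
      (factV hE (maximalIdeal D) (c'+1) D 1 (by rw [pow_one]; exact le_sup_left)).1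
    have hkill : ∀ i < c'+1, ∃ d : D, d ≠ 0 ∧ ∀ x : LC (maximalIdeal D) i D, d • x = 0 := by
      intro i hi
      obtain ⟨d, hd1, hd2⟩ := (factV hE (maximalIdeal D) i D 1 (by rw [pow_one]; exact le_sup_left)).2 ⊥ Ideal.isPrime_bot
        (by rw [dim_bot]; exact le_trans (by exact_mod_cast hi) hdim)
      exact ⟨d, by simpa using hd1, hd2⟩
    obtain ⟨e', he', hk⟩ := ext_kill (b := maximalIdeal D) (c := c'+1) hd hE.inj hkill c' 0 (by omega) 1 one_ne_zero
    have hall := lc_kill_of_sat a (c'+1) (LC (maximalIdeal D) (c'+1) D →ₗ[D] E) e' (sat_cofinal a ha hno)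
      (fun n z => hk _ (fun x => by rw [sat_LC0 a n x, smul_zero]) z)
    have hann : Module.annihilator D (LC (maximalIdeal D) (c'+1) D →ₗ[D] E) ≤ ⊥ := by
      intro y hy
      rw [Ideal.mem_bot]
      by_contra hy0
      rw [Module.mem_annihilator] at hy
      apply hvm
      intro x
      by_contra hx
      obtain ⟨φ, hφ⟩ := hE.cog _ x hx
      obtain ⟨x', rfl⟩ := top_div (maximalIdeal D) (c'+1) hd y hy0 x
      apply hφ
      rw [LinearMap.map_smul]
      exact LinearMap.congr_fun (hy φ) x'
    exact hv (LCv_bot.1 (vanish_of_kill (a := a) ⊥ Ideal.isPrime_bot hann (c'+1)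
      ((ringKrullDim_quotient_le _).trans_lt hd) e' (by simpa using he') hall))

lemma adic_quot (S : Type) [CommRing S] [IsNoetherianRing S] [IsLocalRing S] [IsAdicComplete (maximalIdeal S) S]
    (P : Ideal S) [hP : P.IsPrime] : ∃ _ : IsLocalRing (S ⧸ P), maximalIdeal (S ⧸ P) = (maximalIdeal S).map (Ideal.Quotient.mk P) ∧
      IsAdicComplete (maximalIdeal (S ⧸ P)) (S ⧸ P) := by
  have hloc : IsLocalRing (S ⧸ P) := .of_surjective' (Ideal.Quotient.mk P) Ideal.Quotient.mk_surjective
  have hm : maximalIdeal (S ⧸ P) = (maximalIdeal S).map (Ideal.Quotient.mk P) := by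
    refine le_antisymm ?_ ?_
    · intro x hx
      obtain ⟨x, rfl⟩ := Ideal.Quotient.mk_surjective x
      apply Ideal.mem_map_of_mem
      rw [mem_maximalIdeal, mem_nonunits_iff] at hx ⊢
      exact fun h => hx (h.map _)
    · refine le_maximalIdeal fun h => ?_
      have h2 := Ideal.comap_map_of_surjective (Ideal.Quotient.mk P) Ideal.Quotient.mk_surjective (maximalIdeal S)
      rw [h, Ideal.comap_top, ← RingHom.ker_eq_comap_bot, Ideal.mk_ker, sup_eq_left.2 (le_maximalIdeal hP.ne_top)] at h2
      exact (maximalIdeal.isMaximal S).ne_top h2.symm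
  refine ⟨hloc, hm, ?_⟩
  have h1 : IsPrecomplete (maximalIdeal (S ⧸ P)) (S ⧸ P) := by
    rw [hm]
    refine IsPrecomplete.map_algebraMap_iff.2 ?_
    rw [← AdicCompletion.of_surjective_iff]
    intro x
    obtain ⟨y, rfl⟩ := AdicCompletion.map_surjective (maximalIdeal S) (f := Submodule.mkQ P) (Submodule.mkQ_surjective P) x
    obtain ⟨z, rfl⟩ := AdicCompletion.of_surjective (maximalIdeal S) S y
    exact ⟨Submodule.mkQ P z, by rw [AdicCompletion.map_of]⟩
  have h2 : IsHausdorff (maximalIdeal (S ⧸ P)) (S ⧸ P) := inferInstance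
  exact ⟨⟩

lemma C1 (S : Type) [CommRing S] [IsNoetherianRing S] [IsLocalRing S] [IsAdicComplete (maximalIdeal S) S]
    (a P : Ideal S) (hP : P.IsPrime) (c : ℕ) (hd : ringKrullDim (S ⧸ P) < (c + 1 : ℕ)) (hv : ¬ LCv a c (S ⧸ P)) :
    ∃ k, maximalIdeal S ^ k ≤ a ⊔ P := by
  obtain ⟨_, hm, _⟩ := adic_quot S P
  rw [E6_vanish_iff (S := S ⧸ P)] at hv
  obtain ⟨k, hk⟩ := C1dom _ c hd hv
  refine ⟨k, ?_⟩
  rw [hm, ← Ideal.map_pow] at hk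
  have h2 := Ideal.comap_map_of_surjective (Ideal.Quotient.mk P) Ideal.Quotient.mk_surjective a
  rw [← RingHom.ker_eq_comap_bot, Ideal.mk_ker] at h2
  rw [← h2]
  exact Ideal.map_le_iff_le_comap.1 hk

end c1
end LCaux

open CategoryTheory
namespace LCaux
open Opposite Limits

section c2
open IsLocalRing
variable {S : Type} [CommRing S] [IsNoetherianRing S]

lemma min_pow (A P : Ideal S) (hP : P.IsPrime) (hmin : ∀ Q : Ideal S, Q.IsPrime → A ≤ Q → Q ≤ P → Q = P) :
    ∃ t ∉ P, ∃ k, ∀ r ∈ P ^ k, t * r ∈ A := by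
  classical
  let J : Ideal S := (A.map (algebraMap S (Localization.AtPrime P))).comap (algebraMap S (Localization.AtPrime P))
  have hJ : ∀ s, s ∈ J ↔ ∃ t ∈ P.primeCompl, t * s ∈ A := fun s =>
    IsLocalization.algebraMap_mem_map_algebraMap_iff P.primeCompl (Localization.AtPrime P) A s
  obtain ⟨k, hk⟩ : ∃ k, P ^ k ≤ J := by
    obtain ⟨k, hk⟩ := pow_le_of_primes (A.map (algebraMap S (Localization.AtPrime P))) (by
      intro Q hQ hAQ
      have h1 := hmin (Q.comap (algebraMap S (Localization.AtPrime P))) (hQ.comap _) (Ideal.map_le_iff_le_comap.1 hAQ) (by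
        refine (Ideal.comap_mono (le_maximalIdeal hQ.ne_top)).trans ?_
        exact le_of_eq (IsLocalization.AtPrime.under_maximalIdeal (Localization.AtPrime P) P))
      have h3 : Q.under S = P := h1
      rw [← IsLocalization.map_under P.primeCompl (Localization.AtPrime P) Q, h3,
        Localization.AtPrime.map_eq_maximalIdeal])
    refine ⟨k, ?_⟩
    rw [← Ideal.map_le_iff_le_comap, Ideal.map_pow, Localization.AtPrime.map_eq_maximalIdeal]
    exact hk
  obtain ⟨s, hs⟩ := (inferInstance : IsNoetherianRing S).noetherian (P ^ k)
  have h1 : ∀ r : s, ∃ t ∈ P.primeCompl, t * r ∈ A := fun r =>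
    (hJ r).1 (hk (hs ▸ Submodule.subset_span r.2))
  choose t ht hta using h1
  refine ⟨∏ r, t r, ?_, k, ?_⟩
  · exact P.primeCompl.prod_mem (fun r _ => ht r)
  · intro r hr
    rw [← hs] at hr
    induction hr using Submodule.span_induction with
    | mem x hx =>
      rw [← Finset.mul_prod_erase Finset.univ t (Finset.mem_univ ⟨x, hx⟩), mul_right_comm]
      exact A.mul_mem_right _ (hta ⟨x, hx⟩)
    | zero => rw [mul_zero]; exact A.zero_mem
    | add x y _ _ h h' => rw [mul_add]; exact A.add_mem h h'
    | smul c x _ h => rw [smul_eq_mul, mul_left_comm]; exact A.mul_mem_left _ h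

lemma sup_pow_le (a P : Ideal S) (k : ℕ) : (a ⊔ P) ^ k ≤ a ⊔ P ^ k := by
  induction k with
  | zero => simp
  | succ n ih =>
    rw [pow_succ, Ideal.mul_le]
    intro u hu v hv
    have hu' := ih hu
    obtain ⟨u1, h1, u2, h2, rfl⟩ := Submodule.mem_sup.1 hu'
    obtain ⟨v1, h3, v2, h4, rfl⟩ := Submodule.mem_sup.1 hv
    have e : (u1 + u2) * (v1 + v2) = (u1 * (v1 + v2) + u2 * v1) + u2 * v2 := by ring
    rw [e]
    refine Ideal.add_mem _ (Ideal.mem_sup_left (a.add_mem (a.mul_mem_right _ h1) (a.mul_mem_left _ h3)))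
      (Ideal.mem_sup_right ?_)
    rw [pow_succ]
    exact Ideal.mul_mem_mul h2 h4

variable [IsLocalRing S] [IsAdicComplete (maximalIdeal S) S]

/-- the case of a module killed by a power of `P` -/
lemma C2aux (a P : Ideal S) (hP : P.IsPrime) (c : ℕ) (M : Type) [AddCommGroup M] [Module S M] [Module.Finite S M]
    (hd : ringKrullDim (S ⧸ Module.annihilator S M) < (c + 1 : ℕ)) (hv : ¬ LCv a c (S ⧸ P)) (k : ℕ)
    (hk : P ^ k ≤ Module.annihilator S M) (x : S) (hx : ∀ y : LC a c M, x • y = 0) (z : M)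
    (hz : ∀ r : S, r • x • z = 0 → r ∈ P) : False := by
  have hAP : Module.annihilator S M ≤ P := fun r hr => hz r (Module.mem_annihilator.1 hr _)
  have hdP := (dim_mono hAP).trans_lt hd
  have hcP : ((c : ℕ) : WithBot ℕ∞) ≤ ringKrullDim (S ⧸ P) := by
    by_contra h
    push Not at h
    exact hv (Gvanish c _ (by rwa [Ideal.annihilator_quotient]) _ le_rfl)
  obtain ⟨k1, hk1⟩ := C1 S a P hP c hdP hv
  obtain ⟨g, hg⟩ : ∃ g : M →ₗ[S] M, g = x • LinearMap.id := ⟨_, rfl⟩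
  obtain ⟨L, hL⟩ : ∃ L, L = LinearMap.range g := ⟨_, rfl⟩
  have hgL : ∀ u, g u ∈ L := fun u => hL ▸ ⟨u, rfl⟩
  have hzero : ∀ y : LC a c L, LCmap a c L.subtype y = 0 := by
    intro y
    obtain ⟨w, rfl⟩ := top_surj (a := a) c hd (g.codRestrict L hgL) (by
      rintro ⟨u, hu⟩
      rw [hL] at hu
      obtain ⟨v, rfl⟩ := hu
      exact ⟨v, rfl⟩) y
    rw [← LCmap_comp]
    have : L.subtype ∘ₗ g.codRestrict L hgL = x • LinearMap.id := by rw [← hg]; rfl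
    rw [this, LCmap_smul_id, hx]
  have hAL : Module.annihilator S L ≤ P := by
    intro r hr
    refine hz r ?_
    have h1 := Module.mem_annihilator.1 hr ⟨g z, hgL z⟩
    have h2 : r • g z = 0 := congrArg L.subtype h1
    rw [hg] at h2
    exact h2
  have hdL : ringKrullDim (S ⧸ Module.annihilator S L) < (c + 1 : ℕ) :=
    (dim_mono (ann_le_of_inj L.subtype Subtype.val_injective)).trans_lt hd
  suffices h : ∃ d, d ∉ P ∧ ∀ y : LC a c L, d • y = 0 by
    obtain ⟨d, hd1, hd2⟩ := h
    exact hv (vanish_of_kill P hP hAL c hdL d hd1 hd2)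
  cases c with
  | zero =>
    refine ⟨1, fun h => hP.ne_top ((Ideal.eq_top_iff_one _).2 h), fun y => ?_⟩
    rw [one_smul]
    apply LC0fun_inj
    rw [map_zero]
    apply Subtype.val_injective
    have := LC0fun_nat L.subtype y
    rw [hzero, map_zero] at this
    exact this.symm
  | succ c' =>
    obtain ⟨E, _, _, hE⟩ := exists_dual (S := S)
    obtain ⟨d, hd1, hd2⟩ := (factV hE a c' (M ⧸ L) (k1 * k) (by
      rw [pow_mul]
      refine (Ideal.pow_right_mono hk1 k).trans ((sup_pow_le a P k).trans (sup_le_sup_left ?_ a))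
      exact hk.trans (ann_le_of_surj L.mkQ L.mkQ_surjective))).2 P hP hcP
    refine ⟨d, hd1, fun y => ?_⟩
    obtain ⟨w, rfl⟩ := (LC_exact1 (a := a) (i := c') L.subtype L.mkQ (ses_sub L) Subtype.val_injective L.mkQ_surjective y).1 (hzero y)
    rw [← LinearMap.map_smul, hd2, map_zero]

lemma CBcomplete (c : ℕ) : CB S c := by
  intro a M _ _ _ hd P hP hv x hx z hz
  have hAP : Module.annihilator S M ≤ P := fun r hr => hz r (Module.mem_annihilator.1 hr _)
  obtain ⟨t, ht, k, hk⟩ := min_pow (Module.annihilator S M) P hP (by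
    intro Q hQ hAQ hQP
    refine le_antisymm hQP fun y hy => ?_
    by_contra hyQ
    exact hv (Gvanish c _ (by
      rw [Ideal.annihilator_quotient]
      exact dim_drop hQ hyQ hQP hy ((dim_mono hAQ).trans_lt hd)) _ le_rfl))
  obtain ⟨L, hL⟩ : ∃ L, L = (P ^ k • ⊤ : Submodule S M) := ⟨_, rfl⟩
  have htL : ∀ u ∈ L, t • u = 0 := by
    intro u hu
    rw [hL] at hu
    refine Submodule.smul_induction_on hu (fun r hr n _ => ?_) (fun u v h h' => ?_)
    · rw [smul_smul]; exact Module.mem_annihilator.1 (hk r hr) n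
    · rw [smul_add, h, h', add_zero]
  refine C2aux a P hP c (M ⧸ L) ((dim_mono (ann_le_of_surj L.mkQ L.mkQ_surjective)).trans_lt hd) hv k ?_ x ?_ (L.mkQ z) ?_
  · intro r hr
    rw [Module.mem_annihilator]
    intro u
    obtain ⟨u, rfl⟩ := L.mkQ_surjective u
    rw [← LinearMap.map_smul, Submodule.mkQ_apply, Submodule.Quotient.mk_eq_zero, hL]
    exact Submodule.smul_mem_smul hr trivial
  · intro y
    obtain ⟨w, rfl⟩ := top_surj (a := a) c hd L.mkQ L.mkQ_surjective y
    rw [← LinearMap.map_smul, hx, map_zero]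
  · intro r hr
    rw [← LinearMap.map_smul, ← LinearMap.map_smul, Submodule.mkQ_apply, Submodule.Quotient.mk_eq_zero] at hr
    have h1 := htL _ hr
    rw [smul_smul] at h1
    exact (hP.mem_or_mem (hz _ h1)).resolve_left ht

end c2

lemma CBall (R : Type) [CommRing R] [IsNoetherianRing R] (c : ℕ) : CB R c :=
  CB_reduce c (fun _ _ _ _ _ => CBcomplete c)

section final
variable {R : Type} [CommRing R] [IsNoetherianRing R]

lemma LCv_iff (a : Ideal R) (i : ℕ) (M : ModuleCat.{0} R) : LCv a i M ↔ Subsingleton ((localCohomology a i).obj M) := by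
  constructor
  · intro h
    refine subsingleton_of_forall_eq 0 fun y => ?_
    rw [← (lcEquiv a i M).apply_symm_apply y, h ((lcEquiv a i M).symm y), map_zero]
  · intro h x
    apply (lcEquiv a i M).injective
    exact Subsingleton.elim _ _

lemma exists_z (N : Type) [AddCommGroup N] [Module R N] [Module.Finite R N] (P : Ideal R) (hP : P.IsPrime) (x : R)
    (h : ∀ r, r * x ∈ Module.annihilator R N → r ∈ P) : ∃ z : N, ∀ r : R, r • x • z = 0 → r ∈ P := by
  obtain ⟨g, hg⟩ : ∃ g : N →ₗ[R] N, g = x • LinearMap.id := ⟨_, rfl⟩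
  have h1 : (⟨P, hP⟩ : PrimeSpectrum R) ∈ Module.support R (LinearMap.range g) := by
    rw [Module.support_eq_zeroLocus, PrimeSpectrum.mem_zeroLocus]
    intro r hr
    refine h r (Module.mem_annihilator.2 fun u => ?_)
    have h2 : r • g u = 0 := congrArg (LinearMap.range g).subtype (Module.mem_annihilator.1 hr ⟨g u, u, rfl⟩)
    rw [mul_smul]
    rw [hg] at h2
    exact h2
  obtain ⟨⟨_, z, rfl⟩, hz⟩ := Module.mem_support_iff_exists_annihilator.1 h1
  refine ⟨z, fun r hr => hz ?_⟩
  rw [Submodule.mem_annihilator_span_singleton]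
  apply Subtype.ext
  change r • g z = 0
  rw [hg]
  exact hr

theorem main
    (a : Ideal R) (M : ModuleCat.{0} R) [Module.Finite R M]
    (c : ℕ) (hdim : ringKrullDim (R ⧸ Module.annihilator R M) = (c : WithBot (WithTop ℕ)))
    (m : ℕ) (q p : Fin m → Ideal R)
    (hprimary : ∀ i, (q i).IsPrimary)
    (hrad : ∀ i, (q i).radical = p i)
    (hdec : Module.annihilator R M = ⨅ i, q i) :
    Module.annihilator R ((localCohomology a c).obj M) =
      ⨅ i ∈ {i : Fin m | HasCD a (ModuleCat.of R (R ⧸ p i)) c}, q i := by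
  have hd : ringKrullDim (R ⧸ Module.annihilator R M) < (c + 1 : ℕ) := by
    rw [hdim]; exact Nat.cast_lt.2 (Nat.lt_succ_self c)
  have hAp : ∀ i, Module.annihilator R M ≤ p i := fun i => by
    rw [hdec, ← hrad i]; exact (iInf_le _ i).trans Ideal.le_radical
  have hiff : ∀ i, HasCD a (ModuleCat.of R (R ⧸ p i)) c ↔ ¬ LCv a c (R ⧸ p i) := by
    intro i
    have h0 := LCv_iff a c (ModuleCat.of R (R ⧸ p i))
    constructor
    · intro h hv
      have h1 := h.1
      have h2 := h0.1 hv
      exact not_subsingleton_iff_nontrivial.2 h1 h2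
    · intro hv
      refine ⟨not_subsingleton_iff_nontrivial.1 fun h => hv (h0.2 h), fun j hj => ?_⟩
      refine (LCv_iff a j (ModuleCat.of R (R ⧸ p i))).1 ?_
      refine Gvanish (N := R ⧸ p i) (c+1) ?_ j hj
      rw [Ideal.annihilator_quotient]
      exact (dim_mono (hAp i)).trans_lt hd
  have hann : Module.annihilator R ((localCohomology a c).obj M) = Module.annihilator R (LC a c M) :=
    (lcEquiv a c M).annihilator_eq.symm
  rw [hann]
  refine le_antisymm ?_ ?_
  · intro x hx
    rw [Module.mem_annihilator] at hx
    simp only [Submodule.mem_iInf]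
    intro i hi
    by_contra hxq
    have hv := (hiff i).1 hi
    have hp : (p i).IsPrime := hrad i ▸ Ideal.isPrime_radical (hprimary i)
    obtain ⟨z, hz⟩ := exists_z (M : Type) (p i) hp x (by
      intro r hr
      have h1 : x * r ∈ q i := by
        rw [mul_comm]
        rw [hdec] at hr
        exact (iInf_le q i) hr
      rw [← hrad i]
      exact (Ideal.isPrimary_iff.1 (hprimary i)).2 h1 |>.resolve_left hxq)
    exact CBall R c a M hd (p i) hp hv x hx z hz
  · intro x hx
    rw [Module.mem_annihilator]
    simp only [Submodule.mem_iInf] at hx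
    exact claimA c hd m q p hrad hdec x (fun i hi => hx i ((hiff i).2 hi))

end final
end LCaux


theorem stmt0 {R : Type} [CommRing R] [IsNoetherianRing R]
    (a : Ideal R) (M : ModuleCat R) [Module.Finite R M] (hM : Nontrivial M)
    (c : ℕ) (hdim : ringKrullDim (R ⧸ Module.annihilator R M) = (c : WithBot (WithTop ℕ)))
    (hcd : HasCD a M c)
    (m : ℕ) (q p : Fin m → Ideal R)
    (hprimary : ∀ i, (q i).IsPrimary)
    (hrad : ∀ i, (q i).radical = p i)
    (hdec : Module.annihilator R M = ⨅ i, q i)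
    (hdistinct : Function.Injective p)
    (hirredundant : ∀ i, ¬ (⨅ j ∈ Finset.univ.erase i, q j) ≤ q i) :
    Module.annihilator R ((localCohomology a c).obj M) =
      ⨅ i ∈ {i : Fin m | HasCD a (ModuleCat.of R (R ⧸ p i)) c}, q i := by
  exact LCaux.main a M c hdim m q p hprimary hrad hdec
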